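/- arXiv:2502.07100 — 2 statements merged into one kernel-verified Lean document; each statement's English description precedes it below -/
import Mathlib

section
/- Let K be a field of characteristic zero and Γ a subgroup of K^* of finite rank, and let n be a positive integer. Then there exists a constant C > 0, depending only on n and the rank of Γ, such that for every finite subset A of Γ of cardinality A = #A and all a_0, a_1, …, a_n ∈ K^*, the number of solutions (x_1, …, x_n) ∈ A^n of the equation a_1 x_1 + … + a_n x_n = a_0 is at most C·A^{⌊(n−1)/2⌋}. -/
/-- A subgroup `Γ` of a (commutative) group has finite rank `ρ` if there is a finitely
generated subgroup `Γ₀ ≤ Γ`, generated by `ρ` elements, such that every `x ∈ Γ` has a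
positive power lying in `Γ₀`. -/
def FinRank {G : Type*} [CommGroup G] (Γ : Subgroup G) (ρ : ℕ) : Prop :=
  ∃ S : Finset G, S.card = ρ ∧ (S : Set G) ⊆ (Γ : Set G) ∧
    ∀ x ∈ Γ, ∃ k : ℕ, 0 < k ∧ x ^ k ∈ Subgroup.closure (S : Set G)

universe u v

open Finset in
/-- Every finite family has a maximal `r`-separated subfamily, which is then an `r`-net. -/
theorem exists_separated_net {α E : Type*} [SeminormedAddCommGroup E] (f : α → E) (r : ℝ)
    (s : Finset α) : ∃ t ⊆ s, (∀ x ∈ t, ∀ y ∈ t, x ≠ y → r < ‖f x - f y‖) ∧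
      ∀ x ∈ s, ∃ y ∈ t, ‖f x - f y‖ ≤ r ∨ x = y := by
  classical
  induction s using Finset.induction_on with
  | empty => exact ⟨∅, by simp⟩
  | insert a s ha ih =>
    obtain ⟨t, hts, hsep, hnet⟩ := ih
    by_cases h : ∃ y ∈ t, ‖f a - f y‖ ≤ r
    · obtain ⟨y, hy, hay⟩ := h
      refine ⟨t, hts.trans (subset_insert _ _), hsep, fun x hx => ?_⟩
      rcases mem_insert.1 hx with rfl | hx
      · exact ⟨y, hy, Or.inl hay⟩
      · exact hnet x hx
    · push Not at h
      refine ⟨insert a t, insert_subset_insert _ hts, ?_, fun x hx => ?_⟩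
      · intro x hx y hy hxy
        rcases mem_insert.1 hx with rfl | hx' <;> rcases mem_insert.1 hy with rfl | hy'
        · exact absurd rfl hxy
        · exact h y hy'
        · rw [norm_sub_rev]; exact h x hx'
        · exact hsep x hx' y hy' hxy
      · rcases mem_insert.1 hx with rfl | hx
        · exact ⟨x, mem_insert_self _ _, Or.inr rfl⟩
        · obtain ⟨y, hy, h'⟩ := hnet x hx
          exact ⟨y, mem_insert_of_mem hy, h'⟩

/-- A finite family in a ball of radius `2 * r` of a finite-dimensional subspace is covered by
boundedly many balls of radius `r` centred at members of the family. -/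
theorem exists_net_of_le_two_mul {α E : Type*} [NormedAddCommGroup E] [NormedSpace ℝ E]
    (F : Submodule ℝ E) [FiniteDimensional ℝ F] {d : ℕ} (hd : Module.finrank ℝ F ≤ d)
    (f : α → E) {r : ℝ} (hr : 0 < r) (s : Finset α) (hs : ∀ x ∈ s, f x ∈ F) (c : E) (hc : c ∈ F)
    (hR : ∀ x ∈ s, ‖f x - c‖ ≤ 2 * r) :
    ∃ t ⊆ s, t.card ≤ 5 ^ d ∧ ∀ x ∈ s, ∃ y ∈ t, ‖f x - f y‖ ≤ r := by
  classical
  obtain ⟨t, hts, hsep, hnet⟩ := exists_separated_net f r s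
  refine ⟨t, hts, ?_, fun x hx => ?_⟩
  · let g : t → F := fun x => r⁻¹ • (⟨f x, hs x (hts x.2)⟩ - ⟨c, hc⟩)
    have hg : ∀ x y : t, ‖g x - g y‖ = r⁻¹ * ‖f x - f y‖ := by
      intro x y
      rw [← smul_sub, sub_sub_sub_cancel_right, norm_smul, Real.norm_of_nonneg (by positivity)]
      rfl
    have hsep' : ∀ x y : t, x ≠ y → 1 ≤ ‖g x - g y‖ := by
      intro x y hxy
      rw [hg, ← div_eq_inv_mul, one_le_div hr]
      exact (hsep x x.2 y y.2 (fun h => hxy (Subtype.ext h))).le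
    have hinj : Function.Injective g := by
      intro x y hxy
      by_contra h
      have := hsep' x y h
      rw [hxy, sub_self, norm_zero] at this
      linarith
    have h1 := Besicovitch.card_le_of_separated (Finset.univ.image g) ?_ ?_
    · rw [Finset.card_image_of_injective _ hinj, Finset.card_univ, Fintype.card_coe] at h1
      exact h1.trans (Nat.pow_le_pow_right (by norm_num) hd)
    · intro x hx
      obtain ⟨x, -, rfl⟩ := Finset.mem_image.1 hx
      rw [norm_smul, Real.norm_of_nonneg (by positivity), ← div_eq_inv_mul, div_le_iff₀ hr]
      exact hR x (hts x.2)
    · intro x hx y hy hxy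
      obtain ⟨x, -, rfl⟩ := Finset.mem_image.1 hx
      obtain ⟨y, -, rfl⟩ := Finset.mem_image.1 hy
      exact hsep' x y (fun h => hxy (h ▸ rfl))
  · obtain ⟨y, hy, h | rfl⟩ := hnet x hx
    · exact ⟨y, hy, h⟩
    · exact ⟨x, hy, by simpa using hr.le⟩

/-- Covering numbers of finite-dimensional balls. -/
theorem exists_net {α E : Type*} [NormedAddCommGroup E] [NormedSpace ℝ E]
    (F : Submodule ℝ E) [FiniteDimensional ℝ F] {d : ℕ} (hd : Module.finrank ℝ F ≤ d)
    (f : α → E) {r : ℝ} (hr : 0 < r) (k : ℕ) (s : Finset α) (hs : ∀ x ∈ s, f x ∈ F) (c : E)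
    (hc : c ∈ F) (hR : ∀ x ∈ s, ‖f x - c‖ ≤ 2 ^ (k + 1) * r) :
    ∃ t ⊆ s, t.card ≤ (5 ^ d) ^ (k + 1) ∧ ∀ x ∈ s, ∃ y ∈ t, ‖f x - f y‖ ≤ r := by
  classical
  induction k generalizing s c with
  | zero => simpa using exists_net_of_le_two_mul F hd f hr s hs c hc (by simpa using hR)
  | succ k ih =>
    obtain ⟨t, hts, ht, hnet⟩ := exists_net_of_le_two_mul F hd f
      (r := 2 ^ (k + 1) * r) (by positivity) s hs c hc
      (fun x hx => (hR x hx).trans_eq (by ring))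
    have h2 : ∀ y : α, ∃ t' ⊆ s, y ∈ t → t'.card ≤ (5 ^ d) ^ (k + 1) ∧
        ∀ x ∈ s, ‖f x - f y‖ ≤ 2 ^ (k + 1) * r → ∃ z ∈ t', ‖f x - f z‖ ≤ r := by
      intro y
      by_cases hy : y ∈ t
      · obtain ⟨t', h1, h2, h3⟩ := ih (s.filter fun x => ‖f x - f y‖ ≤ 2 ^ (k + 1) * r)
          (fun x hx => hs x (Finset.mem_filter.1 hx).1) (f y) (hs y (hts hy))
          (fun x hx => (Finset.mem_filter.1 hx).2)
        exact ⟨t', h1.trans (Finset.filter_subset _ _), fun _ => ⟨h2, fun x hx hxy =>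
          h3 x (Finset.mem_filter.2 ⟨hx, hxy⟩)⟩⟩
      · exact ⟨∅, by simp, fun h => absurd h hy⟩
    choose T hTs hT using h2
    refine ⟨t.biUnion T, Finset.biUnion_subset.2 fun y _ => hTs y, ?_, fun x hx => ?_⟩
    · calc (t.biUnion T).card ≤ t.card * (5 ^ d) ^ (k + 1) :=
            Finset.card_biUnion_le_card_mul _ _ _ fun y hy => (hT y hy).1
        _ ≤ 5 ^ d * (5 ^ d) ^ (k + 1) := Nat.mul_le_mul_right _ ht
        _ = _ := by ring
    · obtain ⟨y, hy, hxy⟩ := hnet x hx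
      obtain ⟨z, hz, hxz⟩ := (hT y hy).2 x hx hxy
      exact ⟨z, Finset.mem_biUnion.2 ⟨y, hy, hz⟩, hxz⟩

/-- A finite system of normalised absolute values on a field, together with a subring of
integral elements whose product of absolute values is at least `1`. -/
structure HeightSystem (K : Type u) [Field K] (Q : ℕ) where
  /-- The index type of the absolute values. -/
  V : Type u
  fintypeV : Fintype V
  /-- The absolute values. -/
  abv : V → AbsoluteValue K ℝ
  /-- Whether an absolute value is archimedean. -/
  arch : V → Bool
  /-- The exponents in the product formula. -/
  w : V → ℝ
  w_pos : ∀ v, 0 < w v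
  nonarch : ∀ v, arch v = false → IsNonarchimedean (abv v)
  sum_arch : ∑ v, (if arch v then w v else 0) = 1
  /-- The integral elements. -/
  O : Subring K
  sum_nonneg : ∀ x ∈ O, x ≠ 0 → 0 ≤ ∑ v, w v * Real.log (abv v x)
  sum_prime : ∀ p : ℕ, p.Prime → p ≤ Q →
    ∑ v, (if arch v then 0 else w v * Real.log (abv v (p : K))) = -Real.log p

namespace HeightSystem

variable {K : Type u} [Field K] {Q : ℕ} (H : HeightSystem K Q)

instance : Fintype H.V := H.fintypeV

/-- The weight of an archimedean place, zero at the other places. -/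
def k (v : H.V) : ℝ := if H.arch v then H.w v else 0

theorem sum_k : ∑ v, H.k v = 1 := H.sum_arch

theorem k_nonneg (v : H.V) : 0 ≤ H.k v := by
  unfold k; split_ifs
  · exact (H.w_pos v).le
  · exact le_rfl

/-- The weighted logarithm of an absolute value. -/
noncomputable def l (v : H.V) (x : K) : ℝ := H.w v * Real.log (H.abv v x)

theorem l_mul (v : H.V) {x y : K} (hx : x ≠ 0) (hy : y ≠ 0) : H.l v (x * y) = H.l v x + H.l v y := by
  unfold l
  rw [map_mul, Real.log_mul ((H.abv v).ne_zero hx) ((H.abv v).ne_zero hy), mul_add]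

@[simp] theorem l_one (v : H.V) : H.l v 1 = 0 := by simp [l]

@[simp] theorem l_neg (v : H.V) (x : K) : H.l v (-x) = H.l v x := by simp [l]

@[simp] theorem l_inv (v : H.V) (x : K) : H.l v x⁻¹ = -H.l v x := by simp [l]

@[simp] theorem l_pow (v : H.V) (x : K) (n : ℕ) : H.l v (x ^ n) = n * H.l v x := by
  simp [l]; ring

theorem l_prod (v : H.V) {ι : Type*} (s : Finset ι) (f : ι → K) (hf : ∀ i ∈ s, f i ≠ 0) :
    H.l v (∏ i ∈ s, f i) = ∑ i ∈ s, H.l v (f i) := by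
  unfold l
  rw [map_prod, Real.log_prod (fun i hi => (H.abv v).ne_zero (hf i hi)), Finset.mul_sum]

theorem l_le_l (v : H.V) {x y : K} (hx : x ≠ 0) (h : H.abv v x ≤ H.abv v y) : H.l v x ≤ H.l v y :=
  mul_le_mul_of_nonneg_left (Real.log_le_log ((H.abv v).pos hx) h) (H.w_pos v).le

theorem exists_abv_max (v : H.V) {ι : Type*} {s : Finset ι} {f : ι → K} (hs : ∑ i ∈ s, f i ≠ 0) :
    ∃ i ∈ s, f i ≠ 0 ∧ ∀ j ∈ s, H.abv v (f j) ≤ H.abv v (f i) := by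
  obtain ⟨a, ha, hfa⟩ := Finset.exists_ne_zero_of_sum_ne_zero hs
  obtain ⟨i, hi, hmax⟩ := Finset.exists_max_image s (fun i => H.abv v (f i)) ⟨a, ha⟩
  refine ⟨i, hi, fun h => ?_, hmax⟩
  have h1 := (hmax a ha).trans_eq (by rw [h, map_zero])
  exact absurd ((H.abv v).pos hfa) (not_lt.2 h1)

/-- The logarithmic (ultrametric) triangle inequality. -/
theorem exists_l_sum_le (v : H.V) {ι : Type*} {s : Finset ι} {f : ι → K} (hs : ∑ i ∈ s, f i ≠ 0) :
    ∃ i ∈ s, f i ≠ 0 ∧ H.l v (∑ i ∈ s, f i) ≤ H.k v * Real.log s.card + H.l v (f i) := by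
  obtain ⟨i, hi, hfi, hmax⟩ := H.exists_abv_max v hs
  refine ⟨i, hi, hfi, ?_⟩
  have hcard : (0 : ℝ) < s.card := by exact_mod_cast Finset.card_pos.2 ⟨i, hi⟩
  have hpos : 0 < H.abv v (∑ i ∈ s, f i) := (H.abv v).pos hs
  have hpos' : 0 < H.abv v (f i) := (H.abv v).pos hfi
  cases ha : H.arch v with
  | true =>
    have h1 : H.abv v (∑ i ∈ s, f i) ≤ s.card * H.abv v (f i) := by
      refine ((H.abv v).sum_le s f).trans ?_
      simpa using Finset.sum_le_card_nsmul s _ _ hmax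
    have h2 := Real.log_le_log hpos h1
    rw [Real.log_mul hcard.ne' hpos'.ne'] at h2
    have := mul_le_mul_of_nonneg_left h2 (H.w_pos v).le
    simp only [k, ha, if_true, l]
    linarith
  | false =>
    simp only [k, ha, l]
    simp only [Bool.false_eq_true, if_false, zero_mul, zero_add]
    refine H.l_le_l v hs ?_
    obtain ⟨j, hj⟩ := (H.nonarch v ha).finset_image_add_of_nonempty f ⟨i, hi⟩
    exact hj.2.trans (hmax j hj.1)

/-- The group of units of the ring of integral elements. -/
def units : Subgroup Kˣ where
  carrier := {x | (x : K) ∈ H.O ∧ ((x⁻¹ : Kˣ) : K) ∈ H.O}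
  mul_mem' {a b} ha hb := by
    refine ⟨by simpa using H.O.mul_mem ha.1 hb.1, ?_⟩
    have := H.O.mul_mem ha.2 hb.2
    simpa [mul_comm] using this
  one_mem' := by simp [H.O.one_mem]
  inv_mem' {a} ha := ⟨ha.2, by simpa using ha.1⟩

theorem sum_l_nonneg {x : K} (hx : x ∈ H.O) (h0 : x ≠ 0) : 0 ≤ ∑ v, H.l v x := H.sum_nonneg x hx h0

theorem sum_l_eq_zero {x : Kˣ} (hx : x ∈ H.units) : ∑ v, H.l v x = 0 := by
  refine le_antisymm ?_ (H.sum_l_nonneg hx.1 x.ne_zero)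
  have := H.sum_l_nonneg hx.2 (Units.ne_zero _)
  simp only [Units.val_inv_eq_inv_val, l_inv, Finset.sum_neg_distrib] at this
  linarith

/-- The `ℓ¹` size of the vector of logarithmic absolute values. -/
noncomputable def nrm (x : K) : ℝ := ∑ v, |H.l v x|

theorem nrm_nonneg (x : K) : 0 ≤ H.nrm x := Finset.sum_nonneg fun _ _ => abs_nonneg _

@[simp] theorem nrm_one : H.nrm 1 = 0 := by simp [nrm]

@[simp] theorem nrm_neg (x : K) : H.nrm (-x) = H.nrm x := by simp [nrm]

@[simp] theorem nrm_pow (x : K) (n : ℕ) : H.nrm (x ^ n) = n * H.nrm x := by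
  simp [nrm, abs_mul, Finset.mul_sum]

theorem nrm_mul_le {x y : K} (hx : x ≠ 0) (hy : y ≠ 0) : H.nrm (x * y) ≤ H.nrm x + H.nrm y := by
  unfold nrm
  rw [← Finset.sum_add_distrib]
  refine Finset.sum_le_sum fun v _ => ?_
  rw [H.l_mul v hx hy]; exact abs_add_le _ _

theorem nrm_prod_le {ι : Type*} (s : Finset ι) (f : ι → K) (hf : ∀ i ∈ s, f i ≠ 0) :
    H.nrm (∏ i ∈ s, f i) ≤ ∑ i ∈ s, H.nrm (f i) := by
  unfold nrm
  rw [Finset.sum_comm]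
  refine Finset.sum_le_sum fun v _ => ?_
  rw [H.l_prod v s f hf]; exact Finset.abs_sum_le_sum_abs _ _

/-- For units the positive part of the logarithmic vector carries half of its size. -/
theorem nrm_eq_two_mul {x : Kˣ} (hx : x ∈ H.units) : H.nrm x = 2 * ∑ v, max (H.l v x) 0 := by
  have h := H.sum_l_eq_zero hx
  have h2 : ∀ v, |H.l v x| = 2 * max (H.l v x) 0 - H.l v x := by
    intro v
    rcases le_total (H.l v x) 0 with h | h
    · rw [abs_of_nonpos h, max_eq_right h]; ring
    · rw [abs_of_nonneg h, max_eq_left h]; ring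
  simp only [nrm, h2, Finset.sum_sub_distrib, h, ← Finset.mul_sum, sub_zero]

variable {ι : Type*}

/-- The vector of all logarithmic absolute values of all coordinates, with the `ℓ¹` norm. -/
noncomputable def vec (x : ι → Kˣ) : PiLp 1 (fun _ : ι × H.V => ℝ) :=
  WithLp.toLp 1 fun p => H.l p.2 (x p.1)

theorem vec_mul (x y : ι → Kˣ) : H.vec (x * y) = H.vec x + H.vec y := by
  ext p
  simp [vec, H.l_mul p.2 (x p.1).ne_zero (y p.1).ne_zero]

theorem vec_inv (x : ι → Kˣ) : H.vec x⁻¹ = -H.vec x := by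
  ext p
  simp [vec]

theorem vec_div (x y : ι → Kˣ) : H.vec (x / y) = H.vec x - H.vec y := by
  rw [div_eq_mul_inv, vec_mul, vec_inv, sub_eq_add_neg]

theorem vec_pow (x : ι → Kˣ) (n : ℕ) : H.vec (x ^ n) = (n : ℝ) • H.vec x := by
  ext p
  simp [vec]

variable [Fintype ι]

theorem norm_vec (x : ι → Kˣ) : ‖H.vec x‖ = ∑ i, H.nrm (x i) := by
  rw [PiLp.norm_eq_of_L1]
  simp [vec, nrm, Fintype.sum_prod_type]

theorem nrm_le_norm_vec (x : ι → Kˣ) (i : ι) : H.nrm (x i) ≤ ‖H.vec x‖ := by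
  rw [norm_vec]
  exact Finset.single_le_sum (f := fun i => H.nrm (x i)) (fun i _ => H.nrm_nonneg _)
    (Finset.mem_univ i)

theorem nrm_le_add (x y : ι → Kˣ) (i : ι) :
    H.nrm (x i) ≤ H.nrm (y i) + ‖H.vec x - H.vec y‖ := by
  have h : (x i : K) = y i * ((x / y) i : Kˣ) := by
    rw [Pi.div_apply, ← Units.val_mul, mul_div_cancel]
  rw [h, ← vec_div]
  exact (H.nrm_mul_le (Units.ne_zero _) (Units.ne_zero _)).trans
    (add_le_add_right (H.nrm_le_norm_vec _ i) _)

end HeightSystem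

/-- Either a finite set of vectors satisfies a common linear relation, or it contains a basis. -/
theorem exists_relation_or_det_ne_zero {K α : Type*} [Field K] {ι : Type*} [Fintype ι]
    [DecidableEq ι] (f : α → ι → K) (T : Set α) :
    (∃ b : ι → K, b ≠ 0 ∧ ∀ x ∈ T, ∑ i, b i * f x i = 0) ∨
      ∃ y : ι → α, (∀ j, y j ∈ T) ∧ (Matrix.of fun j i => f (y j) i).det ≠ 0 := by
  by_cases h : Submodule.span K (f '' T) = ⊤
  · right
    obtain ⟨b, hbs, hspan, hli⟩ := exists_linearIndependent K (f '' T)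
    rw [h] at hspan
    let B := Module.Basis.mk hli (by simp [hspan])
    let e := (Pi.basisFun K ι).indexEquiv B
    choose g hg hgT using fun x : b => hbs x.2
    refine ⟨fun j => g (e j), fun j => hg (e j), ?_⟩
    have h2 : LinearIndependent K (Matrix.of fun j i => f (g (e j)) i).row := by
      have : (Matrix.of fun j i => f (g (e j)) i).row = (fun x : b => (x : ι → K)) ∘ e := by
        ext j i
        simp [Matrix.row, hgT (e j)]
      rw [this]
      exact hli.comp _ e.injective
    rw [Matrix.linearIndependent_rows_iff_isUnit, Matrix.isUnit_iff_isUnit_det] at h2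
    exact h2.ne_zero
  · left
    obtain ⟨φ, hφ, hle⟩ := Submodule.exists_le_ker_of_lt_top _ (lt_top_iff_ne_top.2 h)
    have hφ' : ∀ x : ι → K, φ x = ∑ i, φ (Pi.single i 1) * x i := by
      intro x
      conv_lhs => rw [← Finset.univ_sum_single x, map_sum]
      refine Finset.sum_congr rfl fun i _ => ?_
      have : Pi.single i (x i) = x i • (Pi.single i (1 : K) : ι → K) := by
        rw [← Pi.single_smul, smul_eq_mul, mul_one]
      rw [this, map_smul, smul_eq_mul, mul_comm]
    refine ⟨fun i => φ (Pi.single i 1), fun h0 => hφ ?_, fun x hx => ?_⟩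
    · ext i
      simpa using congrFun h0 i
    · rw [← hφ']
      exact hle (Submodule.subset_span ⟨x, hx, rfl⟩)

namespace HeightSystem

variable {K : Type u} [Field K] {Q : ℕ} (H : HeightSystem K Q) {ι : Type*} [Fintype ι]

/-- The determinant of a matrix of units is bounded in terms of the sizes of its entries; the
bound also holds after replacing some entries by ones. -/
theorem l_det_le [DecidableEq ι] (v : H.V) (M : Matrix ι ι K) (g : ι → ι → Kˣ)
    (hM : ∀ i j, M i j = g i j ∨ M i j = 1) (hdet : M.det ≠ 0) :
    H.l v M.det ≤ H.k v * Real.log (Fintype.card ι).factorial + ∑ j, ∑ i, |H.l v (g j i)| := by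
  have hM0 : ∀ i j, M i j ≠ 0 := fun i j => by
    rcases hM i j with h | h <;> rw [h]
    · exact Units.ne_zero _
    · exact one_ne_zero
  rw [Matrix.det_apply'] at hdet ⊢
  obtain ⟨σ, -, hσ, hle⟩ := H.exists_l_sum_le v hdet
  rw [Finset.card_univ, Fintype.card_perm] at hle
  refine hle.trans (add_le_add_right ?_ _)
  have h1 : H.l v (((Equiv.Perm.sign σ : ℤˣ) : ℤ) * ∏ i, M (σ i) i) = ∑ i, H.l v (M (σ i) i) := by
    rw [← H.l_prod v _ _ (fun i _ => hM0 _ _)]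
    rcases Int.units_eq_one_or (Equiv.Perm.sign σ) with h | h <;> simp [h]
  rw [h1, ← Equiv.sum_comp σ (fun j => ∑ i, |H.l v (g j i)|)]
  refine Finset.sum_le_sum fun i _ => ?_
  refine le_trans ?_ (Finset.single_le_sum (f := fun k => |H.l v (g (σ i) k)|)
    (fun _ _ => abs_nonneg _) (Finset.mem_univ i))
  rcases hM (σ i) i with h | h <;> rw [h]
  · exact le_abs_self _
  · simp

theorem nrm_le_of_det_ne_zero [DecidableEq ι] {Y : ι → Kˣ} (hY : ∀ i, Y i ∈ H.units)
    {x : ι → ι → Kˣ} (hx : ∀ j i, x j i ∈ H.units) (hsum : ∀ j, ∑ i, (x j i : K) = 1)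
    (hdet : (Matrix.of fun j i => (x j i : K)).det ≠ 0) (i : ι) :
    H.nrm (Y i) ≤ 2 * (Real.log (Fintype.card ι).factorial +
      ∑ j, ‖H.vec (x j) - H.vec Y‖) := by
  set g : ι → ι → Kˣ := fun j => x j / Y with hg
  set M : Matrix ι ι K := Matrix.of fun j i => (g j i : K) with hMdef
  have hMx : (Matrix.of fun j i => (x j i : K)) = M * Matrix.diagonal fun i => (Y i : K) := by
    ext j i
    simp [M, g, Matrix.mul_diagonal]
  have hM : M.det ≠ 0 := by
    rw [hMx, Matrix.det_mul] at hdet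
    exact left_ne_zero_of_mul hdet
  have hMY : M.mulVec (fun i => (Y i : K)) = 1 := by
    ext j
    simp only [Matrix.mulVec, dotProduct, M, g, Matrix.of_apply, Pi.one_apply]
    rw [← hsum j]
    refine Finset.sum_congr rfl fun i _ => ?_
    simp
  have hcr : (M.updateCol i 1).det = M.det * Y i := by
    have h1 := Matrix.cramer_eq_adjugate_mulVec M 1
    have h2 := congrFun h1 i
    rw [Matrix.cramer_apply, ← hMY, Matrix.mulVec_mulVec, Matrix.adjugate_mul] at h2
    rw [hMY] at h2
    simpa [Matrix.smul_mulVec] using h2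
  have hO : M.det ∈ H.O := by
    rw [Matrix.det_apply']
    refine H.O.sum_mem fun σ _ => H.O.mul_mem ?_ (H.O.prod_mem fun i _ => ?_)
    · exact intCast_mem H.O _
    · exact (H.units.div_mem (hx _ _) (hY _)).1
  set S : H.V → ℝ := fun v => H.k v * Real.log (Fintype.card ι).factorial +
    ∑ j, ∑ i, |H.l v (g j i)| with hS
  have h1 : ∀ v, H.l v M.det ≤ S v := fun v =>
    H.l_det_le v M g (fun _ _ => Or.inl rfl) hM
  have h2 : ∀ v, H.l v M.det + H.l v (Y i) ≤ S v := fun v => by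
    rw [← H.l_mul v hM (Units.ne_zero _), ← hcr]
    refine H.l_det_le v _ g (fun j k => ?_) (by rw [hcr]; exact mul_ne_zero hM (Units.ne_zero _))
    by_cases hk : k = i
    · subst hk; right; simp
    · left; simp [Matrix.updateCol_ne hk, M]
  have h3 : ∑ v, (H.l v M.det + max (H.l v (Y i)) 0) ≤ ∑ v, S v := by
    refine Finset.sum_le_sum fun v _ => ?_
    rcases max_choice (H.l v (Y i)) 0 with h | h <;> rw [h]
    · exact h2 v
    · simpa using h1 v
  have h4 : ∑ v, S v = Real.log (Fintype.card ι).factorial + ∑ j, ‖H.vec (x j) - H.vec Y‖ := by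
    simp only [hS, Finset.sum_add_distrib, ← Finset.sum_mul, H.sum_k, one_mul]
    congr 1
    rw [Finset.sum_comm]
    refine Finset.sum_congr rfl fun j _ => ?_
    rw [← vec_div, norm_vec, Finset.sum_comm]
    rfl
  rw [H.nrm_eq_two_mul (hY i), ← h4]
  rw [Finset.sum_add_distrib] at h3
  have := H.sum_l_nonneg hO hM
  linarith

/-- The gap principle: solutions close to a solution of large size satisfy a common relation. -/
theorem exists_relation_of_large {Y : ι → Kˣ} (hY : ∀ i, Y i ∈ H.units) {δ : ℝ}
    (hlarge : 2 * Fintype.card ι * (Real.log (Fintype.card ι).factorial + Fintype.card ι * δ) <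
      ‖H.vec Y‖) :
    ∃ b : ι → K, b ≠ 0 ∧ ∀ x : ι → Kˣ, (∀ i, x i ∈ H.units) → ∑ i, (x i : K) = 1 →
      ‖H.vec x - H.vec Y‖ ≤ δ → ∑ i, b i * x i = 0 := by
  classical
  rcases exists_relation_or_det_ne_zero (fun (x : ι → Kˣ) i => (x i : K))
    {x | (∀ i, x i ∈ H.units) ∧ ∑ i, (x i : K) = 1 ∧ ‖H.vec x - H.vec Y‖ ≤ δ} with
    ⟨b, hb, h⟩ | ⟨y, hy, hdet⟩
  · exact ⟨b, hb, fun x h1 h2 h3 => h x ⟨h1, h2, h3⟩⟩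
  · exfalso
    have h1 : ‖H.vec Y‖ ≤ ∑ _i : ι, 2 * (Real.log (Fintype.card ι).factorial +
        Fintype.card ι * δ) := by
      rw [norm_vec]
      refine Finset.sum_le_sum fun i _ => ?_
      refine (H.nrm_le_of_det_ne_zero hY (fun j => (hy j).1) (fun j => (hy j).2.1) hdet i).trans ?_
      gcongr
      refine (Finset.sum_le_sum fun j _ => (hy j).2.2).trans ?_
      simp
    rw [Finset.sum_const, Finset.card_univ, nsmul_eq_mul] at h1
    linarith

end HeightSystem

theorem exists_sum_pow_prime_eq {R ι : Type*} [CommRing R] {p : ℕ} (hp : p.Prime) (s : Finset ι)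
    (f : ι → R) : ∃ r, (∑ i ∈ s, f i) ^ p = ∑ i ∈ s, f i ^ p + p * r := by
  classical
  induction s using Finset.induction_on with
  | empty => exact ⟨0, by simp [hp.ne_zero]⟩
  | insert a s ha ih =>
    obtain ⟨r, hr⟩ := ih
    obtain ⟨r', hr'⟩ := exists_add_pow_prime_eq hp (f a) (∑ i ∈ s, f i)
    refine ⟨r + f a * (∑ i ∈ s, f i) * r', ?_⟩
    rw [Finset.sum_insert ha, Finset.sum_insert ha, hr', hr]
    ring

/-- The closed unit ball of a nonarchimedean absolute value. -/
def IsNonarchimedean.unitBall {K : Type*} [Field K] {f : AbsoluteValue K ℝ}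
    (hf : IsNonarchimedean f) : Subring K where
  carrier := {x | f x ≤ 1}
  mul_mem' {a b} ha hb := by
    simpa using mul_le_one₀ (a := f a) (b := f b) ha (f.nonneg b) hb
  one_mem' := by simp
  add_mem' {a b} ha hb := (hf a b).trans (max_le ha hb)
  zero_mem' := by simp
  neg_mem' {a} ha := by simpa using ha

/-- A sum of `p`-th powers of elements with vanishing sum is divisible by `p`. -/
theorem IsNonarchimedean.map_sum_pow_le {K ι : Type*} [Field K] {f : AbsoluteValue K ℝ}
    (hf : IsNonarchimedean f) {p : ℕ} (hp : p.Prime) {s : Finset ι} {h : ι → K} {a : K}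
    (ha : a ≠ 0) (hs : ∀ i ∈ s, f (h i) ≤ f a) (hsum : ∑ i ∈ s, h i = 0) :
    f (∑ i ∈ s, h i ^ p) ≤ f p * f a ^ p := by
  have hfa : 0 < f a := f.pos ha
  let y : s → hf.unitBall := fun i => ⟨h i / a, by
    show f (h i / a) ≤ 1
    rw [map_div₀]; exact div_le_one_of_le₀ (hs i i.2) hfa.le⟩
  obtain ⟨r, hr⟩ := exists_sum_pow_prime_eq hp Finset.univ y
  have hy : (∑ i, y i : hf.unitBall) = 0 := by
    apply Subtype.ext
    simp only [AddSubmonoidClass.coe_finsetSum, y, ZeroMemClass.coe_zero]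
    rw [← Finset.sum_div, Finset.univ_eq_attach, Finset.sum_attach s h, hsum, zero_div]
  rw [hy, zero_pow hp.ne_zero] at hr
  have h2 : ∑ i ∈ s, h i ^ p = -(p * (r : K)) * a ^ p := by
    have h3 := congrArg (Subtype.val) hr
    simp only [AddSubmonoidClass.coe_finsetSum, y, ZeroMemClass.coe_zero, Subring.coe_add,
      Subring.coe_mul, SubmonoidClass.coe_pow, Subring.coe_natCast, div_pow] at h3
    rw [← Finset.sum_div, Finset.univ_eq_attach, Finset.sum_attach s (fun i => h i ^ p)] at h3
    have h4 : (∑ i ∈ s, h i ^ p) / a ^ p = -(p * (r : K)) := by linear_combination -h3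
    rw [← h4, div_mul_cancel₀ _ (pow_ne_zero _ ha)]
  rw [h2, map_mul, map_pow, AbsoluteValue.map_neg, map_mul]
  have hr1 : f (r : K) ≤ 1 := r.2
  gcongr
  exact mul_le_of_le_one_right (f.nonneg _) hr1

namespace HeightSystem

variable {K : Type u} [Field K] {Q : ℕ} (H : HeightSystem K Q) {ι : Type*}

/-- Vanishing sums of few units of tiny size are stable under raising to `p`-th powers for large
primes `p`. -/
theorem sum_pow_prime_eq_zero {s : Finset ι} {h : ι → Kˣ} (hO : ∀ i, h i ∈ H.units) {L p : ℕ}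
    (hL : s.card ≤ L) (hp : p.Prime) (hLp : L < p) (hpQ : p ≤ Q) {δ : ℝ}
    (hδ : ∀ i ∈ s, H.nrm (h i) ≤ δ) (hδp : p * (L * (L + 1)) * δ < 1)
    (hp0 : (p : K) ≠ 0) (hsum : ∑ i ∈ s, (h i : K) = 0) : ∑ i ∈ s, (h i : K) ^ p = 0 := by
  by_contra hz
  obtain ⟨i₀, hi₀, -⟩ := Finset.exists_ne_zero_of_sum_ne_zero hz
  have hs0 : 0 < s.card := Finset.card_pos.2 ⟨i₀, hi₀⟩
  have hz0 : 0 ≤ ∑ v, H.l v (∑ i ∈ s, (h i : K) ^ p) :=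
    H.sum_l_nonneg (H.O.sum_mem fun i _ => H.O.pow_mem (hO i).1 _) hz
  have hle : ∀ v, ∀ i ∈ s, H.l v (h i) ≤ ∑ i ∈ s, |H.l v (h i)| := fun v i hi =>
    (le_abs_self _).trans
      (Finset.single_le_sum (f := fun i => |H.l v (h i)|) (fun _ _ => abs_nonneg _) hi)
  have hv : ∀ v, H.l v (∑ i ∈ s, (h i : K) ^ p) ≤ H.k v * Real.log s.card +
      (if H.arch v then 0 else H.w v * Real.log (H.abv v (p : K))) +
        p * ∑ i ∈ s, |H.l v (h i)| := by
    intro v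
    cases ha : H.arch v with
    | true =>
      obtain ⟨i, hi, -, h1⟩ := H.exists_l_sum_le v hz
      refine h1.trans ?_
      rw [l_pow]
      have := mul_le_mul_of_nonneg_left (hle v i hi) (Nat.cast_nonneg (α := ℝ) p)
      simp only [if_true]
      linarith
    | false =>
      obtain ⟨i, hi, hmax⟩ := Finset.exists_max_image s (fun i => H.abv v (h i)) ⟨i₀, hi₀⟩
      have h1 := (H.nonarch v ha).map_sum_pow_le hp (h i).ne_zero hmax hsum
      rw [← map_pow, ← map_mul] at h1
      have h2 := H.l_le_l v hz h1
      rw [H.l_mul v hp0 (pow_ne_zero _ (Units.ne_zero _)), l_pow] at h2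
      have := mul_le_mul_of_nonneg_left (hle v i hi) (Nat.cast_nonneg (α := ℝ) p)
      simp only [k, ha, Bool.false_eq_true, if_false, zero_mul, zero_add]
      unfold l at h2 this ⊢
      linarith
  have htot := hz0.trans (Finset.sum_le_sum fun v _ => hv v)
  rw [Finset.sum_add_distrib, Finset.sum_add_distrib, ← Finset.sum_mul, H.sum_k, one_mul,
    H.sum_prime p hp hpQ, ← Finset.mul_sum, Finset.sum_comm] at htot
  have h3 : ∑ i ∈ s, ∑ v, |H.l v (h i)| ≤ L * δ := by
    have hδ0 : 0 ≤ δ := (H.nrm_nonneg _).trans (hδ i₀ hi₀)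
    refine (Finset.sum_le_card_nsmul s _ δ hδ).trans ?_
    rw [nsmul_eq_mul]
    gcongr
  have h4 : (p : ℝ) * ∑ i ∈ s, ∑ v, |H.l v (h i)| ≤ p * (L * δ) := by gcongr
  have hL0 : (0 : ℝ) < L := by exact_mod_cast hs0.trans_le hL
  have h5 : Real.log s.card ≤ Real.log L :=
    Real.log_le_log (by exact_mod_cast hs0) (by exact_mod_cast hL)
  have h6 : Real.log (L + 1) ≤ Real.log p :=
    Real.log_le_log (by positivity) (by exact_mod_cast hLp)
  have h7 : 1 / ((L : ℝ) + 1) ≤ Real.log (L + 1) - Real.log L := by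
    have := Real.one_sub_inv_le_log_of_pos (x := (L + 1) / L) (by positivity)
    rw [Real.log_div (by positivity) hL0.ne'] at this
    refine le_trans (le_of_eq ?_) this
    field_simp
    ring
  have h8 : (p : ℝ) * (L * δ) < 1 / (L + 1) := by
    rw [lt_div_iff₀ (by positivity)]
    linarith
  linarith

theorem sum_pow_eq_zero [CharZero K] {s : Finset ι} {L : ℕ} (hL : s.card ≤ L) {k : ℕ}
    (hk : k ≠ 0) (hkp : ∀ p : ℕ, p.Prime → p ∣ k → L < p) (hkQ : k ≤ Q) {h : ι → Kˣ}
    (hO : ∀ i, h i ∈ H.units) {δ : ℝ} (hδ : ∀ i ∈ s, H.nrm (h i) ≤ δ)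
    (hδk : k * (L * (L + 1)) * δ < 1) (hsum : ∑ i ∈ s, (h i : K) = 0) :
    ∑ i ∈ s, (h i : K) ^ k = 0 := by
  rcases s.eq_empty_or_nonempty with rfl | ⟨i₀, hi₀⟩
  · simp
  have hδ0 : 0 ≤ δ := (H.nrm_nonneg _).trans (hδ i₀ hi₀)
  induction k using Nat.recOnMul generalizing h δ with
  | zero => exact absurd rfl hk
  | one => simpa using hsum
  | prime p hp =>
    exact H.sum_pow_prime_eq_zero hO hL hp (hkp p hp dvd_rfl) hkQ hδ hδk
      (by exact_mod_cast hp.ne_zero) hsum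
  | mul a b iha ihb =>
    have ha : a ≠ 0 := left_ne_zero_of_mul hk
    have hb : b ≠ 0 := right_ne_zero_of_mul hk
    have hb1 : (1 : ℝ) ≤ b := by exact_mod_cast Nat.one_le_iff_ne_zero.2 hb
    have h1 := iha ha (fun p hp hpa => hkp p hp (hpa.mul_right b))
      ((Nat.le_mul_of_pos_right a (Nat.pos_of_ne_zero hb)).trans hkQ) hO hδ (by
        refine lt_of_le_of_lt ?_ hδk
        push_cast
        gcongr
        exact le_mul_of_one_le_right (by positivity) hb1) hsum hδ0
    have h2 := ihb hb (fun p hp hpb => hkp p hp (hpb.mul_left a))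
      ((Nat.le_mul_of_pos_left b (Nat.pos_of_ne_zero ha)).trans hkQ) (h := fun i => h i ^ a)
      (fun i => H.units.pow_mem (hO i) a) (δ := a * δ) (fun i hi => by
        rw [Units.val_pow_eq_pow_val, nrm_pow]
        exact mul_le_mul_of_nonneg_left (hδ i hi) (Nat.cast_nonneg _))
      (by refine lt_of_eq_of_lt ?_ hδk; push_cast; ring) (by simpa using h1) (by positivity)
    simpa [pow_mul] using h2

/-- In a vanishing sum of few units of tiny size, every term coincides with another one up to a
root of unity of bounded order. -/
theorem exists_ne_pow_factorial_eq [CharZero K] {s : Finset ι} {L : ℕ} (hL : s.card ≤ L)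
    (hQ : 1 + L * L.factorial ≤ Q) {h : ι → Kˣ} (hO : ∀ i, h i ∈ H.units) {δ : ℝ}
    (hδ : ∀ i ∈ s, H.nrm (h i) ≤ δ) (hδL : (1 + L * L.factorial) * (L * (L + 1)) * δ < 1)
    (hsum : ∑ i ∈ s, (h i : K) = 0) {i₀ : ι} (hi₀ : i₀ ∈ s) :
    ∃ i ∈ s, i ≠ i₀ ∧ h i ^ L.factorial = h i₀ ^ L.factorial := by
  classical
  by_contra! hne
  have hδ0 : 0 ≤ δ := (H.nrm_nonneg _).trans (hδ i₀ hi₀)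
  have h1 : ∀ j < s.card, ∑ i ∈ s, (h i : K) * ((h i : K) ^ L.factorial) ^ j = 0 := by
    intro j hj
    have hjL : 1 + j * L.factorial ≤ 1 + L * L.factorial := by
      gcongr; exact hj.le.trans hL
    have := H.sum_pow_eq_zero hL (k := 1 + j * L.factorial) (by omega) (fun p hp hpk => by
      by_contra! hpL
      have h2 : p ∣ j * L.factorial := (hp.dvd_factorial.2 hpL).mul_left _
      exact hp.one_lt.ne' (Nat.dvd_one.1 ((Nat.dvd_add_left h2).1 hpk)))
      (hjL.trans hQ) hO hδ (by
        refine lt_of_le_of_lt ?_ hδL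
        have : ((1 + j * L.factorial : ℕ) : ℝ) ≤ 1 + L * L.factorial := by exact_mod_cast hjL
        gcongr) hsum
    rw [← this]
    refine Finset.sum_congr rfl fun i _ => ?_
    rw [pow_add, pow_one, mul_comm j, pow_mul]
  have h2 : ∀ f : Polynomial K, f.natDegree < s.card →
      ∑ i ∈ s, (h i : K) * f.eval ((h i : K) ^ L.factorial) = 0 := by
    intro f hf
    simp_rw [Polynomial.eval_eq_sum_range, Finset.mul_sum]
    rw [Finset.sum_comm]
    refine Finset.sum_eq_zero fun j hj => ?_
    have hj' : j < s.card := by have := Finset.mem_range.1 hj; omega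
    rw [← mul_zero (f.coeff j), ← h1 j hj', Finset.mul_sum]
    exact Finset.sum_congr rfl fun i _ => by ring
  have h3 := h2 (∏ i ∈ s.erase i₀, (Polynomial.X - Polynomial.C ((h i : K) ^ L.factorial))) (by
    rw [Polynomial.natDegree_prod_of_monic _ _ fun i _ => Polynomial.monic_X_sub_C _]
    simp only [Polynomial.natDegree_X_sub_C, Finset.sum_const, smul_eq_mul, mul_one]
    exact Finset.card_erase_lt_of_mem hi₀)
  rw [Finset.sum_eq_single_of_mem i₀ hi₀] at h3
  · rcases mul_eq_zero.1 h3 with h4 | h4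
    · exact (h i₀).ne_zero h4
    · rw [Polynomial.eval_prod, Finset.prod_eq_zero_iff] at h4
      obtain ⟨i, hi, h5⟩ := h4
      rw [Polynomial.eval_sub, Polynomial.eval_X, Polynomial.eval_C, sub_eq_zero] at h5
      refine hne i (Finset.mem_of_mem_erase hi) (Finset.ne_of_mem_erase hi) (Units.ext ?_)
      simpa using h5.symm
  · intro i hi hii₀
    rw [Polynomial.eval_prod, Finset.prod_eq_zero (Finset.mem_erase.2 ⟨hii₀, hi⟩) (by simp),
      mul_zero]

end HeightSystem

open Finset in
/-- If every choice of members of `T` satisfies a nontrivial permutation identity, then boundedly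
many proportionalities between two coordinates cover `T`. -/
theorem exists_proportional_cover {J G α : Type*} [Fintype J] [DecidableEq J] [CommGroup G]
    (g : α → J → G) (T : Set α)
    (h : ∀ y : J → α, (∀ j, y j ∈ T) →
      ∃ π : Equiv.Perm J, π ≠ 1 ∧ ∏ j, g (y j) (π j) = ∏ j, g (y j) j) :
    ∃ C : Finset (J × J × G), C.card ≤ (Fintype.card J).factorial ∧ (∀ c ∈ C, c.1 ≠ c.2.1) ∧
      ∀ x ∈ T, ∃ c ∈ C, g x c.1 = c.2.2 * g x c.2.1 := by
  classical
  by_contra! hcon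
  have key : ∀ s : Finset J, ∃ y : J → α, (∀ j, y j ∈ T) ∧ ∀ π : Equiv.Perm J, π ≠ 1 →
      (∀ j ∉ s, π j = j) → ∏ j, g (y j) (π j) ≠ ∏ j, g (y j) j := by
    intro s
    induction s using Finset.induction_on with
    | empty =>
      obtain ⟨x, hx, -⟩ := hcon ∅ (by simp) (by simp)
      exact ⟨fun _ => x, fun _ => hx, fun π hπ h => absurd (Equiv.ext fun j => h j (by simp)) hπ⟩
    | insert a s ha ih =>
      obtain ⟨y, hyT, hy⟩ := ih
      let F : Equiv.Perm J → J × J × G := fun π =>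
        (π a, a, (∏ j ∈ univ.erase a, g (y j) j) / ∏ j ∈ univ.erase a, g (y j) (π j))
      obtain ⟨x, hxT, hx⟩ := hcon ((univ.filter fun π : Equiv.Perm J => π a ≠ a).image F)
        (by
          refine card_image_le.trans ((card_filter_le _ _).trans ?_)
          rw [card_univ, Fintype.card_perm])
        (by
          intro c hc
          obtain ⟨π, hπ, rfl⟩ := mem_image.1 hc
          exact (mem_filter.1 hπ).2)
      have hsplit : ∀ f : α → J → G, ∏ j, f (Function.update y a x j) j =
          f x a * ∏ j ∈ univ.erase a, f (y j) j := by
        intro f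
        rw [← mul_prod_erase univ _ (mem_univ a), Function.update_self]
        congr 1
        refine prod_congr rfl fun j hj => ?_
        rw [Function.update_of_ne (ne_of_mem_erase hj)]
      refine ⟨Function.update y a x, fun j => ?_, fun π hπ hfix heq => ?_⟩
      · by_cases hj : j = a
        · subst hj; simpa using hxT
        · simpa [hj] using hyT j
      · rw [hsplit (fun x j => g x (π j)), hsplit g] at heq
        by_cases hπa : π a = a
        · refine hy π hπ (fun j hj => ?_) ?_
          · by_cases hja : j = a
            · rw [hja, hπa]
            · exact hfix j (by simp [hja, hj])
          · rw [hπa] at heq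
            rw [← mul_prod_erase univ _ (mem_univ a), ← mul_prod_erase univ _ (mem_univ a), hπa,
              mul_left_cancel heq]
        · refine hx (F π) (mem_image_of_mem _ (mem_filter.2 ⟨mem_univ _, hπa⟩)) ?_
          simp only [F]
          rw [div_mul_eq_mul_div, eq_div_iff_mul_eq', heq, mul_comm]
  obtain ⟨y, hyT, hy⟩ := key univ
  obtain ⟨π, hπ, heq⟩ := h y hyT
  exact hy π hπ (by simp) heq

section

variable {K : Type u} [Field K] {ι : Type*}

/-- The ratios of the coordinates of `x` and `y`, extended by the coordinate `1`. -/
def extRatio (y x : ι → Kˣ) : Option ι → Kˣ := fun o => o.elim 1 (fun i => x i / y i)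

/-- A proportionality between two extended ratios gives a nontrivial linear relation. -/
theorem exists_relation_of_extRatio_eq [Fintype ι] (hι : 2 ≤ Fintype.card ι) (Y : ι → Kˣ)
    (i j : Option ι) (c : K) (hij : i ≠ j) : ∃ b : ι → K, b ≠ 0 ∧ ∀ x : ι → Kˣ,
      ∑ i, (x i : K) = 1 → (extRatio Y x i : K) = c * extRatio Y x j → ∑ i, b i * x i = 0 := by
  classical
  have : Nontrivial ι := Fintype.one_lt_card_iff_nontrivial.1 hι
  have aux : ∀ (i : ι) (c : K), ∃ b : ι → K, b ≠ 0 ∧ ∀ x : ι → Kˣ,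
      ∑ i, (x i : K) = 1 → (x i : K) * c = 1 → ∑ i, b i * x i = 0 := by
    intro i c
    refine ⟨Pi.single i c - 1, fun h => ?_, fun x hx hxc => ?_⟩
    · obtain ⟨k, hk⟩ := exists_ne i
      have := congrFun h k
      simp [hk] at this
    · simp only [Pi.sub_apply, sub_mul, Finset.sum_sub_distrib, Pi.one_apply, one_mul, hx]
      rw [Finset.sum_eq_single i (fun k _ hk => by simp [hk]) (by simp), Pi.single_eq_same,
        mul_comm, hxc, sub_self]
  match i, j, hij with
  | none, none, h => exact absurd rfl h
  | none, some j, _ =>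
    obtain ⟨b, hb, h⟩ := aux j (c / Y j)
    refine ⟨b, hb, fun x hx hxc => h x hx ?_⟩
    simp only [extRatio, Option.elim, Units.val_one, Units.val_div_eq_div_val] at hxc
    rw [hxc]; ring
  | some i, none, _ =>
    by_cases hc : c = 0
    · refine ⟨1, one_ne_zero, fun x hx hxc => ?_⟩
      rw [hc, zero_mul] at hxc
      exact absurd hxc (Units.ne_zero _)
    obtain ⟨b, hb, h⟩ := aux i ((Y i : K)⁻¹ / c)
    refine ⟨b, hb, fun x hx hxc => h x hx ?_⟩
    simp only [extRatio, Option.elim, Units.val_one, Units.val_div_eq_div_val, mul_one] at hxc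
    rw [← hxc] at hc ⊢
    have := (Y i).ne_zero
    have := (x i).ne_zero
    field_simp
  | some i, some j, h =>
    have hij : i ≠ j := fun h' => h (h' ▸ rfl)
    refine ⟨Pi.single i 1 - Pi.single j (c * Y i / Y j), fun h => ?_, fun x hx hxc => ?_⟩
    · have := congrFun h i
      simp [hij] at this
    · simp only [extRatio, Option.elim, Units.val_div_eq_div_val] at hxc
      simp only [Pi.sub_apply, sub_mul, Finset.sum_sub_distrib]
      rw [Finset.sum_eq_single i (fun k _ hk => by simp [hk]) (by simp),
        Finset.sum_eq_single j (fun k _ hk => by simp [hk]) (by simp), Pi.single_eq_same,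
        Pi.single_eq_same, one_mul, sub_eq_zero]
      have := (Y i).ne_zero
      have := (Y j).ne_zero
      rw [div_eq_iff (by assumption)] at hxc
      rw [hxc]; ring

end

namespace HeightSystem

variable {K : Type u} [Field K] {Q : ℕ} (H : HeightSystem K Q) {ι : Type*} [Fintype ι]

theorem sum_nrm_extRatio (Y x : ι → Kˣ) :
    ∑ o, H.nrm (extRatio Y x o) = ‖H.vec x - H.vec Y‖ := by
  rw [← vec_div, norm_vec, Fintype.sum_option]
  simp [extRatio]

/-- Solutions very close to a given one satisfy one of boundedly many relations. -/
theorem exists_relations_of_small [CharZero K] (hι : 2 ≤ Fintype.card ι) {L : ℕ}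
    (hL : L = (Fintype.card ι + 1).factorial) (hQ : 1 + L * L.factorial ≤ Q) {Y : ι → Kˣ}
    (hY : ∀ i, Y i ∈ H.units) {δ : ℝ}
    (hδ : (1 + L * L.factorial) * (L * (L + 1)) * ((Fintype.card ι + 1) * δ) < 1) :
    ∃ B : Finset (ι → K), B.card ≤ L * L.factorial ∧ (∀ b ∈ B, b ≠ 0) ∧
      ∀ x : ι → Kˣ, (∀ i, x i ∈ H.units) → ∑ i, (x i : K) = 1 →
        ‖H.vec x - H.vec Y‖ ≤ δ → ∃ b ∈ B, ∑ i, b i * x i = 0 := by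
  classical
  set M := L.factorial with hM
  have hLJ : L = (Fintype.card (Option ι)).factorial := by rw [Fintype.card_option, hL]
  have hMeven : Even M := by
    have h2 : 2 ≤ L := by
      rw [hL]
      calc 2 = Nat.factorial 2 := rfl
        _ ≤ _ := Nat.factorial_le (by omega)
    exact even_iff_two_dvd.2 (Nat.dvd_factorial (by norm_num) h2)
  have hunit : ∀ x : ι → Kˣ, (∀ i, x i ∈ H.units) → ∀ o, extRatio Y x o ∈ H.units := by
    intro x hx o
    cases o with
    | none => exact H.units.one_mem
    | some i => exact H.units.div_mem (hx i) (hY i)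
  obtain ⟨C, hCcard, hCne, hC⟩ := exists_proportional_cover
    (fun (x : ι → Kˣ) o => extRatio Y x o ^ M)
    {x | (∀ i, x i ∈ H.units) ∧ ∑ i, (x i : K) = 1 ∧ ‖H.vec x - H.vec Y‖ ≤ δ} (by
      intro y hy
      let h : Equiv.Perm (Option ι) → Kˣ := fun π =>
        (Units.map (Int.castRingHom K).toMonoidHom (Equiv.Perm.sign π)) *
          ∏ j, extRatio Y (y j) (π j)
      have hval : ∀ π, (h π : K) = ((Equiv.Perm.sign π : ℤˣ) : ℤ) *
          ∏ j, (extRatio Y (y j) (π j) : K) := by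
        intro π; simp [h]
      have hhM : ∀ π, h π ^ M = ∏ j, extRatio Y (y j) (π j) ^ M := by
        intro π
        simp only [h, mul_pow, Finset.prod_pow]
        rcases Int.units_eq_one_or (Equiv.Perm.sign π) with h1 | h1 <;> rw [h1]
        · simp
        · rw [← map_pow, hMeven.neg_one_pow]; simp
      have hdet : (Matrix.of fun o j => (extRatio Y (y j) o : K)).det = 0 := by
        refine Matrix.exists_vecMul_eq_zero_iff.1 ⟨fun o => o.elim (-1) (fun i => (Y i : K)),
          fun h0 => ?_, ?_⟩
        · have := congrFun h0 none
          simp at this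
        · ext j
          simp only [Matrix.vecMul, dotProduct, Matrix.of_apply, Fintype.sum_option, Option.elim,
            extRatio, Pi.zero_apply]
          have h1 : ∀ i, (Y i : K) * ((y j i / Y i : Kˣ) : K) = y j i := by
            intro i
            rw [← Units.val_mul, mul_div_cancel]
          simp [-Units.val_div_eq_div_val, h1, (hy j).2.1]
      rw [Matrix.det_apply'] at hdet
      obtain ⟨π, -, hπ1, hπ⟩ := H.exists_ne_pow_factorial_eq (s := Finset.univ) (L := L)
        (by rw [Finset.card_univ, Fintype.card_perm, hLJ]) hQ (h := h) (fun π => by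
          refine H.units.mul_mem ?_ (H.units.prod_mem fun j _ => hunit _ (hy j).1 _)
          rcases Int.units_eq_one_or (Equiv.Perm.sign π) with h1 | h1 <;> rw [h1]
          · simp [H.units.one_mem]
          · refine ⟨?_, ?_⟩ <;> simp [H.O.one_mem])
        (δ := (Fintype.card ι + 1) * δ) (fun π _ => by
          have h1 : H.nrm (h π) = H.nrm (∏ j, (extRatio Y (y j) (π j) : K)) := by
            rw [hval]
            rcases Int.units_eq_one_or (Equiv.Perm.sign π) with h1 | h1 <;> rw [h1] <;> simp
          rw [h1]
          refine (H.nrm_prod_le _ _ fun j _ => Units.ne_zero _).trans ?_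
          refine (Finset.sum_le_card_nsmul _ _ δ fun j _ => ?_).trans_eq (by simp)
          refine le_trans ?_ (hy j).2.2
          rw [← sum_nrm_extRatio]
          exact Finset.single_le_sum (f := fun o => H.nrm (extRatio Y (y j) o))
            (fun o _ => H.nrm_nonneg _) (Finset.mem_univ _)) (by rw [← hM]; exact_mod_cast hδ) (by
          simp only [hval]
          exact hdet) (Finset.mem_univ 1)
      refine ⟨π, hπ1, ?_⟩
      rw [← hM, hhM, hhM] at hπ
      exact hπ)
  have hrel : ∀ (i j : Option ι) (c : K), ∃ b : ι → K, i ≠ j → (b ≠ 0 ∧ ∀ x : ι → Kˣ,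
      ∑ i, (x i : K) = 1 → (extRatio Y x i : K) = c * extRatio Y x j → ∑ i, b i * x i = 0) := by
    intro i j c
    by_cases hij : i = j
    · exact ⟨0, fun h => absurd hij h⟩
    · obtain ⟨b, hb⟩ := exists_relation_of_extRatio_eq hι Y i j c hij
      exact ⟨b, fun _ => hb⟩
  choose rel hrel using hrel
  refine ⟨C.biUnion fun c => (Polynomial.nthRoots M (c.2.2 : K)).toFinset.image (rel c.1 c.2.1),
    ?_, ?_, ?_⟩
  · refine (Finset.card_biUnion_le_card_mul _ _ M fun c _ => ?_).trans ?_
    · exact Finset.card_image_le.trans ((Multiset.toFinset_card_le _).trans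
        (Polynomial.card_nthRoots _ _))
    · rw [← hLJ] at hCcard
      exact Nat.mul_le_mul_right _ hCcard
  · intro b hb
    obtain ⟨c, hc, hb⟩ := Finset.mem_biUnion.1 hb
    obtain ⟨t, -, rfl⟩ := Finset.mem_image.1 hb
    exact (hrel _ _ t (hCne c hc)).1
  · intro x hx hx1 hxY
    obtain ⟨c, hc, hxc⟩ := hC x ⟨hx, hx1, hxY⟩
    refine ⟨rel c.1 c.2.1 (extRatio Y x c.1 / extRatio Y x c.2.1),
      Finset.mem_biUnion.2 ⟨c, hc, Finset.mem_image_of_mem _ ?_⟩, ?_⟩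
    · rw [Multiset.mem_toFinset, Polynomial.mem_nthRoots (Nat.factorial_pos _), div_pow,
        div_eq_iff (pow_ne_zero _ (Units.ne_zero _))]
      exact_mod_cast congrArg Units.val hxc
    · refine (hrel _ _ _ (hCne c hc)).2 x hx1 ?_
      rw [div_mul_cancel₀ _ (Units.ne_zero _)]

end HeightSystem

/-- The number of terms in the determinants used for `n` variables. -/
def relTerms (n : ℕ) : ℕ := (n + 1).factorial

/-- A bound for the primes which have to be units in order to treat `n` variables. -/
def relPrimes (n : ℕ) : ℕ := 1 + relTerms n * (relTerms n).factorial

/-- A bound for the number of relations needed near a given solution in `n` variables. -/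
def relCount (n : ℕ) : ℕ := relTerms n * (relTerms n).factorial

theorem one_le_relCount (n : ℕ) : 1 ≤ relCount n :=
  Nat.mul_pos (Nat.factorial_pos _) (Nat.factorial_pos _)

namespace HeightSystem

/-- Solutions of the unit equation. -/
def IsSol {K : Type u} [Field K] {Q : ℕ} (H : HeightSystem K Q) {ι : Type v} [Fintype ι]
    (x : ι → Kˣ) : Prop := (∀ i, x i ∈ H.units) ∧ ∑ i, (x i : K) = 1

/-- Solutions relatively close to a given solution satisfy one of boundedly many relations. -/
theorem exists_relations_near (n : ℕ) (hn : 2 ≤ n) : ∃ ε : ℝ, 0 < ε ∧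
    ∀ {K : Type u} [Field K] [CharZero K] (H : HeightSystem K (relPrimes n)) {ι : Type v}
      [Fintype ι], Fintype.card ι = n → ∀ Y : ι → Kˣ, H.IsSol Y →
      ∃ B : Finset (ι → K), B.card ≤ relCount n ∧ (∀ b ∈ B, b ≠ 0) ∧
        ∀ x : ι → Kˣ, H.IsSol x → ‖H.vec x - H.vec Y‖ ≤ ε * (1 + ‖H.vec Y‖) →
          ∃ b ∈ B, ∑ i, b i * x i = 0 := by
  classical
  set A : ℝ := Real.log n.factorial with hA
  have hA0 : 0 ≤ A := Real.log_natCast_nonneg _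
  set D : ℝ := (1 + relTerms n * (relTerms n).factorial) * (relTerms n * (relTerms n + 1)) *
    (n + 1) * (2 + 4 * n * A) with hD
  have hn0 : (0 : ℝ) < n := by positivity
  have hL0 : (0 : ℝ) < relTerms n := by exact_mod_cast Nat.factorial_pos _
  have hD0 : 0 < D := by positivity
  refine ⟨min (1 / (4 * n ^ 2)) (1 / (2 * D)), by positivity, ?_⟩
  intro K _ _ H ι _ hι Y hY
  set ε : ℝ := min (1 / (4 * n ^ 2)) (1 / (2 * D)) with hε
  have hε1 : ε * (4 * n ^ 2) ≤ 1 := by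
    rw [← le_div_iff₀ (by positivity)]; exact min_le_left _ _
  have hε2 : ε * (2 * D) ≤ 1 := by
    rw [← le_div_iff₀ (by positivity)]; exact min_le_right _ _
  have hε0 : 0 < ε := by positivity
  rcases lt_or_ge (1 + 4 * n * A) ‖H.vec Y‖ with h | h
  · obtain ⟨b, hb, hbx⟩ := H.exists_relation_of_large (Y := Y) hY.1
      (δ := ε * (1 + ‖H.vec Y‖)) (by
        rw [hι, ← hA]
        have h1 : (ε * (4 * n ^ 2)) * (1 + ‖H.vec Y‖) ≤ 1 * (1 + ‖H.vec Y‖) := by gcongr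
        nlinarith)
    exact ⟨{b}, by simpa using one_le_relCount n, by simpa using hb, fun x hx hxY =>
      ⟨b, by simp, hbx x hx.1 hx.2 hxY⟩⟩
  · obtain ⟨B, hB, hB0, hBx⟩ := H.exists_relations_of_small (Y := Y) (L := relTerms n)
      (by rw [hι]; exact hn) (by rw [hι]; rfl) le_rfl hY.1 (δ := ε * (1 + ‖H.vec Y‖)) (by
        rw [hι]
        calc _ ≤ (1 + relTerms n * (relTerms n).factorial : ℝ) * (relTerms n * (relTerms n + 1)) *
              ((n + 1) * (ε * (1 + (1 + 4 * n * A)))) := by gcongr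
          _ = ε * D := by rw [hD]; ring
          _ < 1 := by nlinarith)
    exact ⟨B, hB, hB0, fun x hx hxY => hBx x hx.1 hx.2 hxY⟩

/-- Solutions in a shell satisfy one of boundedly many relations, each of which is only needed
near one of boundedly many solutions. -/
theorem exists_shell_cover (n : ℕ) (hn : 2 ≤ n) : ∃ m₀ : ℕ, ∀ m ≥ m₀, ∀ d : ℕ,
    ∀ {K : Type u} [Field K] [CharZero K] (H : HeightSystem K (relPrimes n)) {ι : Type v}
      [Fintype ι], Fintype.card ι = n → ∀ (F : Submodule ℝ (PiLp 1 (fun _ : ι × H.V => ℝ))),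
      Module.finrank ℝ F ≤ d → ∀ (s : Finset (ι → Kˣ)), (∀ x ∈ s, H.IsSol x ∧ H.vec x ∈ F) →
      ∀ a : ℝ, 0 < a → (∀ x ∈ s, ‖H.vec x‖ ≤ 2 * a ∧ a ≤ 1 + ‖H.vec x‖) →
      ∃ C : Finset ((ι → Kˣ) × (ι → K)), C.card ≤ (5 ^ d) ^ (m + 1) * relCount n ∧
        (∀ c ∈ C, c.1 ∈ s ∧ c.2 ≠ 0) ∧ ∀ x ∈ s, ∃ c ∈ C,
          ‖H.vec x - H.vec c.1‖ ≤ a / 2 ^ m ∧ ∑ i, c.2 i * x i = 0 := by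
  classical
  obtain ⟨ε, hε, hloc⟩ := exists_relations_near.{u, v} n hn
  obtain ⟨m₀, hm₀⟩ := exists_pow_lt_of_lt_one hε (by norm_num : (1 / 2 : ℝ) < 1)
  refine ⟨m₀, fun m hm d K _ _ H ι _ hι F hF s hs a ha hsa => ?_⟩
  have hmε : 1 / 2 ^ m ≤ ε := by
    rw [← one_div_pow]
    exact (pow_le_pow_of_le_one (by norm_num) (by norm_num) hm).trans hm₀.le
  obtain ⟨t, hts, htc, hnet⟩ := exists_net F hF H.vec (r := a / 2 ^ m) (by positivity) m s
    (fun x hx => (hs x hx).2) 0 F.zero_mem (fun x hx => by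
      rw [sub_zero]
      refine (hsa x hx).1.trans_eq ?_
      field_simp
      ring)
  have hB : ∀ Y : ι → Kˣ, ∃ B : Finset (ι → K), Y ∈ t → (B.card ≤ relCount n ∧ (∀ b ∈ B, b ≠ 0) ∧
        ∀ x : ι → Kˣ, H.IsSol x → ‖H.vec x - H.vec Y‖ ≤ ε * (1 + ‖H.vec Y‖) →
          ∃ b ∈ B, ∑ i, b i * x i = 0) := by
    intro Y
    by_cases hY : Y ∈ t
    · obtain ⟨B, hB⟩ := hloc H hι Y (hs Y (hts hY)).1
      exact ⟨B, fun _ => hB⟩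
    · exact ⟨∅, fun h => absurd h hY⟩
  choose B hB using hB
  refine ⟨t.biUnion fun Y => (B Y).image (Prod.mk Y), ?_, ?_, fun x hx => ?_⟩
  · exact (Finset.card_biUnion_le_card_mul _ _ (relCount n) fun Y hY =>
      Finset.card_image_le.trans (hB Y hY).1).trans (Nat.mul_le_mul_right _ htc)
  · intro c hc
    obtain ⟨Y, hY, hc⟩ := Finset.mem_biUnion.1 hc
    obtain ⟨b, hb, rfl⟩ := Finset.mem_image.1 hc
    exact ⟨hts hY, (hB Y hY).2.1 b hb⟩
  · obtain ⟨Y, hY, hxY⟩ := hnet x hx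
    obtain ⟨b, hb, hbx⟩ := (hB Y hY).2.2 x (hs x hx).1 (hxY.trans (by
      rw [div_eq_mul_one_div, mul_comm]
      exact mul_le_mul hmε (hsa Y (hts hY)).2 ha.le hε.le))
    exact ⟨(Y, b), Finset.mem_biUnion.2 ⟨Y, hY, Finset.mem_image_of_mem _ hb⟩, hxY, hbx⟩

/-- No coordinate of a solution dominates all the others. -/
theorem IsSol.nrm_le {K : Type u} [Field K] {Q : ℕ} {H : HeightSystem K Q} {ι : Type v}
    [Fintype ι] [DecidableEq ι] {Y : ι → Kˣ} (hY : H.IsSol Y) (i : ι) :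
    H.nrm (Y i) ≤ 2 * (Real.log (Fintype.card ι) + ∑ j ∈ Finset.univ.erase i, H.nrm (Y j)) := by
  let f : ι → K := fun j => if j = i then 1 else -Y j
  have hf : ∑ j, f j = Y i := by
    rw [← Finset.add_sum_erase _ _ (Finset.mem_univ i),
      Finset.sum_congr rfl (fun j hj => if_neg (Finset.ne_of_mem_erase hj)),
      Finset.sum_neg_distrib]
    have h1 := hY.2
    rw [← Finset.add_sum_erase Finset.univ (fun j => (Y j : K)) (Finset.mem_univ i)] at h1
    simp only [f, if_true]
    linear_combination -h1
  have hv : ∀ v, max (H.l v (Y i)) 0 ≤ H.k v * Real.log (Fintype.card ι) +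
      ∑ j ∈ Finset.univ.erase i, |H.l v (Y j)| := by
    intro v
    have h0 : 0 ≤ ∑ j ∈ Finset.univ.erase i, |H.l v (Y j)| :=
      Finset.sum_nonneg fun _ _ => abs_nonneg _
    have h1 : 0 ≤ H.k v * Real.log (Fintype.card ι) :=
      mul_nonneg (H.k_nonneg v) (Real.log_natCast_nonneg _)
    refine max_le ?_ (by positivity)
    obtain ⟨j, -, -, hj⟩ := H.exists_l_sum_le v (s := Finset.univ) (f := f)
      (by rw [hf]; exact Units.ne_zero _)
    rw [hf, Finset.card_univ] at hj
    refine hj.trans (add_le_add_right ?_ _)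
    by_cases hji : j = i
    · simpa [f, hji] using h0
    · simp only [f, hji, if_false, l_neg]
      exact (le_abs_self _).trans (Finset.single_le_sum (f := fun j => |H.l v (Y j)|)
        (fun _ _ => abs_nonneg _) (by simp [hji]))
  rw [H.nrm_eq_two_mul (hY.1 i)]
  gcongr
  refine (Finset.sum_le_sum fun v _ => hv v).trans_eq ?_
  rw [Finset.sum_add_distrib, ← Finset.sum_mul, H.sum_k, one_mul, Finset.sum_comm]
  rfl

theorem IsSol.two_le_card {K : Type u} [Field K] {Q : ℕ} {H : HeightSystem K Q} {ι : Type v}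
    [Fintype ι] {Y : ι → Kˣ} (hY : H.IsSol Y) {θ : ℝ} {B : Finset ι} (hθ0 : 0 ≤ θ)
    (hB : ∀ i ∉ B, H.nrm (Y i) ≤ θ)
    (hθ : 2 * Real.log (Fintype.card ι) + 3 * (Fintype.card ι * θ) < ‖H.vec Y‖) :
    2 ≤ B.card := by
  classical
  by_contra! hcard
  have hex : ∃ i, ∀ j ≠ i, H.nrm (Y j) ≤ θ := by
    rcases B.eq_empty_or_nonempty with rfl | ⟨i, hi⟩
    · cases isEmpty_or_nonempty ι with
      | inl h =>
        have := hY.2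
        simp at this
      | inr h =>
        obtain ⟨i⟩ := h
        exact ⟨i, fun j _ => hB j (by simp)⟩
    · refine ⟨i, fun j hj => hB j fun hjB => hj ?_⟩
      exact Finset.card_le_one.1 (by omega) j hjB i hi
  obtain ⟨i, hi⟩ := hex
  have h1 : ∑ j ∈ Finset.univ.erase i, H.nrm (Y j) ≤ Fintype.card ι * θ := by
    refine (Finset.sum_le_card_nsmul _ _ θ fun j hj => hi j (Finset.ne_of_mem_erase hj)).trans ?_
    rw [nsmul_eq_mul]
    gcongr
    exact Finset.card_le_univ _
  have h2 := hY.nrm_le i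
  rw [norm_vec, ← Finset.add_sum_erase _ _ (Finset.mem_univ i)] at hθ
  linarith

end HeightSystem

theorem card_le_of_pow_two_bounds (s : Finset ℕ) (q : ℕ) (τ : ℝ)
    (h1 : ∀ k ∈ s, (2 : ℝ) ^ k ≤ 2 ^ q * τ) (h2 : ∀ k ∈ s, τ ≤ 2 ^ (k + 1)) :
    s.card ≤ q + 2 := by
  rcases s.eq_empty_or_nonempty with rfl | hs
  · simp
  have hsub : s ⊆ Finset.Icc (s.min' hs) (s.min' hs + (q + 1)) := by
    intro k hk
    refine Finset.mem_Icc.2 ⟨s.min'_le k hk, ?_⟩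
    have h3 : (2 : ℝ) ^ k ≤ 2 ^ (s.min' hs + (q + 1)) := by
      refine (h1 k hk).trans ?_
      calc (2 : ℝ) ^ q * τ ≤ 2 ^ q * 2 ^ (s.min' hs + 1) := by
            gcongr; exact h2 _ (s.min'_mem hs)
        _ = _ := by ring
    exact (pow_le_pow_iff_right₀ (by norm_num : (1 : ℝ) < 2)).1 h3
  refine (Finset.card_le_card hsub).trans ?_
  rw [Nat.card_Icc]
  omega

namespace HeightSystem

/-- The dyadic size of a vector. -/
noncomputable def shell {K : Type u} [Field K] {Q : ℕ} (H : HeightSystem K Q) {ι : Type v}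
    [Fintype ι] (x : ι → Kˣ) : ℕ := Nat.log 2 ⌊‖H.vec x‖⌋₊

theorem shell_bounds {K : Type u} [Field K] {Q : ℕ} (H : HeightSystem K Q) {ι : Type v}
    [Fintype ι] (x : ι → Kˣ) : ‖H.vec x‖ ≤ 2 * 2 ^ H.shell x ∧ 2 ^ H.shell x ≤ 1 + ‖H.vec x‖ ∧
      (H.shell x ≠ 0 → 2 ^ H.shell x ≤ ‖H.vec x‖) := by
  have h0 : 0 ≤ ‖H.vec x‖ := norm_nonneg _
  have h1 : (⌊‖H.vec x‖⌋₊ : ℝ) ≤ ‖H.vec x‖ := Nat.floor_le h0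
  have h3 : H.shell x ≠ 0 → 2 ^ H.shell x ≤ ‖H.vec x‖ := by
    intro hk
    have h2 : ⌊‖H.vec x‖⌋₊ ≠ 0 := by
      intro h
      rw [shell, h] at hk
      simp at hk
    refine le_trans ?_ h1
    exact_mod_cast Nat.pow_log_le_self 2 h2
  refine ⟨?_, ?_, h3⟩
  · have h2 : (⌊‖H.vec x‖⌋₊ : ℝ) + 1 ≤ 2 ^ (H.shell x + 1) := by
      exact_mod_cast Nat.lt_pow_succ_log_self (by norm_num) ⌊‖H.vec x‖⌋₊
    have := Nat.lt_floor_add_one ‖H.vec x‖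
    rw [pow_succ] at h2
    linarith
  · by_cases hk : H.shell x = 0
    · rw [hk]; simp
    · linarith [h3 hk]

/-- Solutions of a unit equation decompose into pieces satisfying an additional relation, in such
a way that every value of a large coordinate occurs in boundedly many pieces only. -/
theorem exists_decomposition (n : ℕ) (hn : 2 ≤ n) (d : ℕ) : ∃ C : ℕ,
    ∀ {K : Type u} [Field K] [CharZero K] (H : HeightSystem K (relPrimes n)) {ι : Type v}
      [Fintype ι], Fintype.card ι = n → ∀ (F : Submodule ℝ (PiLp 1 (fun _ : ι × H.V => ℝ))),
      Module.finrank ℝ F ≤ d → ∀ (X : Finset (ι → Kˣ)), (∀ x ∈ X, H.IsSol x ∧ H.vec x ∈ F) →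
      ∃ D : Finset (Finset (ι → Kˣ) × Finset ι), (∀ x ∈ X, ∃ p ∈ D, x ∈ p.1) ∧
        (∀ p ∈ D, 2 ≤ p.2.card ∧ p.1 ⊆ X ∧
          ∃ b : ι → K, b ≠ 0 ∧ ∀ x ∈ p.1, ∑ i, b i * x i = 0) ∧
        ∀ (i : ι) (t : Kˣ), {p ∈ (D : Set (Finset (ι → Kˣ) × Finset ι)) |
          i ∈ p.2 ∧ ∃ x ∈ p.1, x i = t}.ncard ≤ C := by
  classical
  obtain ⟨m₀, hcov⟩ := exists_shell_cover.{u, v} n hn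
  set q := 8 * n with hq
  set m := max m₀ (q + 1) with hm
  set N := (5 ^ d) ^ (m + 1) * relCount n with hN
  refine ⟨(4 * n + (q + 3)) * N, fun {K} _ _ H ι _ hι F hF X hX => ?_⟩
  have hC := fun k : ℕ => hcov m (le_max_left _ _) d H hι F hF
    (X.filter fun x => H.shell x = k) (fun x hx => hX x (Finset.mem_filter.1 hx).1)
    (2 ^ k) (by positivity) (fun x hx => by
      obtain ⟨-, rfl⟩ := Finset.mem_filter.1 hx
      exact ⟨(H.shell_bounds x).1, (H.shell_bounds x).2.1⟩)
  choose C hCcard hCs hCx using hC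
  set θ : ℝ := 1 / 2 ^ q with hθ
  let P : ℕ → ((ι → Kˣ) × (ι → K)) → Finset (ι → Kˣ) × Finset ι := fun k c =>
    (X.filter fun x => H.shell x = k ∧ ‖H.vec x - H.vec c.1‖ ≤ 2 ^ k / 2 ^ m ∧
        ∑ i, c.2 i * x i = 0,
      if k < 4 * n then Finset.univ else Finset.univ.filter fun i => θ * 2 ^ k < H.nrm (c.1 i))
  refine ⟨(X.image H.shell).biUnion fun k => (C k).image (P k), fun x hx => ?_, fun p hp => ?_,
    fun i t => ?_⟩
  · obtain ⟨c, hc, hxc, hcx⟩ := hCx (H.shell x) x (Finset.mem_filter.2 ⟨hx, rfl⟩)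
    exact ⟨P (H.shell x) c, Finset.mem_biUnion.2 ⟨_, Finset.mem_image_of_mem _ hx,
      Finset.mem_image_of_mem _ hc⟩, Finset.mem_filter.2 ⟨hx, rfl, hxc, hcx⟩⟩
  · obtain ⟨k, -, hp⟩ := Finset.mem_biUnion.1 hp
    obtain ⟨c, hc, rfl⟩ := Finset.mem_image.1 hp
    refine ⟨?_, Finset.filter_subset _ _, c.2, (hCs k c hc).2, fun x hx =>
      (Finset.mem_filter.1 hx).2.2.2⟩
    obtain ⟨hcX, hck⟩ := Finset.mem_filter.1 (hCs k c hc).1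
    simp only [P]
    split_ifs with hk
    · rw [Finset.card_univ, hι]; exact hn
    · refine (hX c.1 hcX).1.two_le_card (θ := θ * 2 ^ k) (by positivity)
        (fun i hi => by simpa using hi) ?_
      rw [hι]
      have h1 := (H.shell_bounds c.1).2.2 (by rw [hck]; omega)
      rw [hck] at h1
      refine lt_of_lt_of_le ?_ h1
      have h2 : Real.log n ≤ n := by
        have := Real.log_le_sub_one_of_pos (x := (n : ℝ)) (by positivity)
        linarith
      have h3 : ((4 * n : ℕ) : ℝ) < 2 ^ (4 * n) := by exact_mod_cast Nat.lt_two_pow_self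
      have h4 : (2 : ℝ) ^ (4 * n) ≤ 2 ^ k := pow_le_pow_right₀ (by norm_num) (not_lt.1 hk)
      have h5 : n * θ ≤ 1 / 8 := by
        rw [hθ, mul_one_div, div_le_iff₀ (by positivity)]
        have : ((8 * n : ℕ) : ℝ) < 2 ^ q := by exact_mod_cast Nat.lt_two_pow_self
        push_cast at this
        linarith
      have h6 : (n * θ) * 2 ^ k ≤ 1 / 8 * 2 ^ k := by gcongr
      push_cast at h3
      nlinarith
  · set Ks := (X.image H.shell).filter fun k => k < 4 * n ∨
      ((2 : ℝ) ^ k ≤ 2 ^ (q + 1) * H.nrm t ∧ H.nrm t ≤ 2 ^ (k + 1)) with hKs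
    have hKcard : Ks.card ≤ 4 * n + (q + 3) := by
      rw [hKs, Finset.filter_or]
      refine (Finset.card_union_le _ _).trans (add_le_add ?_ ?_)
      · refine (Finset.card_le_card (t := Finset.range (4 * n)) fun k hk => ?_).trans_eq
          (Finset.card_range _)
        exact Finset.mem_range.2 (Finset.mem_filter.1 hk).2
      · exact card_le_of_pow_two_bounds _ (q + 1) (H.nrm t)
          (fun k hk => (Finset.mem_filter.1 hk).2.1) (fun k hk => (Finset.mem_filter.1 hk).2.2)
    have hsub : {p ∈ (((X.image H.shell).biUnion fun k => (C k).image (P k) :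
        Finset (Finset (ι → Kˣ) × Finset ι)) : Set (Finset (ι → Kˣ) × Finset ι)) |
          i ∈ p.2 ∧ ∃ x ∈ p.1, x i = t} ⊆ (Ks.biUnion fun k => (C k).image (P k) :
        Finset (Finset (ι → Kˣ) × Finset ι)) := by
      rintro p ⟨hp, hip, x, hxp, hxt⟩
      obtain ⟨k, hk, hp⟩ := Finset.mem_biUnion.1 hp
      refine Finset.mem_biUnion.2 ⟨k, Finset.mem_filter.2 ⟨hk, ?_⟩, hp⟩
      obtain ⟨c, hc, rfl⟩ := Finset.mem_image.1 hp
      obtain ⟨-, hxk, hxc, -⟩ := Finset.mem_filter.1 hxp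
      by_cases hk : k < 4 * n
      · exact Or.inl hk
      · right
        simp only [P, hk, if_false, Finset.mem_filter, Finset.mem_univ, true_and] at hip
        have h1 := H.nrm_le_add c.1 x i
        rw [norm_sub_rev, hxt] at h1
        have h2 := H.nrm_le_norm_vec x i
        have h3 := (H.shell_bounds x).1
        rw [hxt] at h2
        rw [hxk] at h3
        refine ⟨?_, by rw [pow_succ]; linarith⟩
        have h4 : (2 : ℝ) ^ k / 2 ^ m ≤ θ * 2 ^ k / 2 := by
          rw [hθ, one_div_mul_eq_div, div_div, ← pow_succ]
          exact div_le_div_of_nonneg_left (by positivity) (by positivity)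
            (pow_le_pow_right₀ (by norm_num) (le_max_right _ _))
        have h5 : θ * 2 ^ k / 2 ≤ H.nrm t := by linarith
        rw [hθ, one_div_mul_eq_div, div_div, ← pow_succ, div_le_iff₀ (by positivity)] at h5
        linarith
    refine (Set.ncard_le_ncard hsub (Finset.finite_toSet _)).trans ?_
    rw [Set.ncard_coe_finset]
    refine (Finset.card_biUnion_le_card_mul _ _ N fun k _ =>
      Finset.card_image_le.trans (hCcard k)).trans (Nat.mul_le_mul_right _ hKcard)

end HeightSystem

open Polynomial in
/-- The Padé polynomials attached to the exponents `a`, `b`, `c`. -/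
noncomputable def padePoly (a b c : ℕ) : Polynomial ℤ :=
  ∑ j ∈ Finset.range (a + 1),
    C ((-1) ^ j * ((a + b + c + 1).choose (a - j) : ℤ) * ((b + j).choose j : ℤ)) * X ^ j

section Pade

open Polynomial

theorem padePoly_natDegree_le (a b c : ℕ) : (padePoly a b c).natDegree ≤ a := by
  refine natDegree_sum_le_of_forall_le _ _ fun j hj => ?_
  exact (natDegree_C_mul_X_pow_le _ _).trans (by have := Finset.mem_range.1 hj; omega)

theorem padePoly_iterate_derivative (a b c : ℕ) :
    C ((a.factorial * b.factorial : ℕ) : ℤ) *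
      derivative^[c + 1] (X ^ (b + c + 1) * padePoly a b c) =
    C ((a + b + c + 1).factorial : ℤ) * (X ^ b * (1 - X) ^ a) := by
  have h1 : ((1 : ℤ[X]) - X) ^ a = ∑ j ∈ Finset.range (a + 1), C ((-1) ^ j * (a.choose j : ℤ)) * X ^ j := by
    rw [sub_eq_neg_add, add_pow]
    refine Finset.sum_congr rfl fun j _ => ?_
    rw [one_pow, mul_one, neg_pow]
    simp
    ring
  rw [h1, padePoly, Finset.mul_sum, iterate_derivative_sum, Finset.mul_sum, Finset.mul_sum,
    Finset.mul_sum]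
  refine Finset.sum_congr rfl fun j hj => ?_
  have hj : j ≤ a := by have := Finset.mem_range.1 hj; omega
  rw [mul_left_comm (X ^ (b + c + 1)), ← pow_add, iterate_derivative_C_mul,
    iterate_derivative_X_pow_eq_C_mul, show b + c + 1 + j - (c + 1) = b + j by omega,
    mul_left_comm (X ^ b), ← pow_add]
  have key : a.factorial * b.factorial * ((a + b + c + 1).choose (a - j) * (b + j).choose j *
      (b + c + 1 + j).descFactorial (c + 1)) = (a + b + c + 1).factorial * a.choose j := by
    have e1 := Nat.choose_mul_factorial_mul_factorial (show a - j ≤ a + b + c + 1 by omega)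
    rw [show a + b + c + 1 - (a - j) = b + c + 1 + j by omega] at e1
    have e2 := Nat.choose_mul_factorial_mul_factorial (show j ≤ b + j by omega)
    rw [show b + j - j = b by omega] at e2
    have e3 := Nat.factorial_mul_descFactorial (show c + 1 ≤ b + c + 1 + j by omega)
    rw [show b + c + 1 + j - (c + 1) = b + j by omega] at e3
    have e4 := Nat.choose_mul_factorial_mul_factorial hj
    have hp : 0 < (a - j).factorial * (b + j).factorial * j.factorial := by positivity
    refine Nat.eq_of_mul_eq_mul_left hp ?_
    rw [← e1, ← e3]
    calc _ = a.factorial * ((b + j).choose j * j.factorial * b.factorial) *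
          ((a + b + c + 1).choose (a - j) * (b + c + 1 + j).descFactorial (c + 1) *
            (a - j).factorial * (b + j).factorial) := by ring
      _ = _ := by rw [e2, ← e4]; ring
  rw [← mul_assoc, ← mul_assoc, ← mul_assoc, ← C_mul, ← C_mul, ← C_mul]
  congr 2
  have key' : ((a.factorial * b.factorial * ((a + b + c + 1).choose (a - j) * (b + j).choose j *
      (b + c + 1 + j).descFactorial (c + 1)) : ℕ) : ℤ) =
        ((a + b + c + 1).factorial * a.choose j : ℕ) := by rw [key]
  push_cast at key' ⊢
  linear_combination (-1) ^ j * key'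

/-- The reflected Padé polynomial. -/
noncomputable def padeB (a b c : ℕ) : Polynomial ℤ :=
  (1 - X) ^ (b + c + 1) * (padePoly a b c).comp (1 - X)

theorem padeB_iterate_derivative (a b c : ℕ) :
    C ((a.factorial * b.factorial : ℕ) : ℤ) * derivative^[c + 1] (padeB a b c) =
    C ((-1) ^ (c + 1) * ((a + b + c + 1).factorial : ℤ)) * ((1 - X) ^ b * X ^ a) := by
  have h := congrArg (fun p : ℤ[X] => p.comp (1 - X)) (padePoly_iterate_derivative a b c)
  have hB : padeB a b c = (X ^ (b + c + 1) * padePoly a b c).comp (1 - X) := by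
    simp [padeB]
  rw [hB, iterate_derivative_comp_one_sub_X]
  simp only [mul_comp, C_comp, pow_comp, X_comp, sub_comp, one_comp, sub_sub_cancel] at h
  rw [mul_left_comm, h, C_mul, C_pow, C_neg, C_1]
  ring

theorem padeB_coeff_eq_zero {a b c k : ℕ} (h1 : c < k) (h2 : k ≤ a + c) :
    (padeB a b c).coeff k = 0 := by
  have h := congrArg (fun p : ℤ[X] => p.coeff (k - (c + 1))) (padeB_iterate_derivative a b c)
  simp only [coeff_C_mul, coeff_iterate_derivative, coeff_mul_X_pow'] at h
  rw [if_neg (by omega), mul_zero, show k - (c + 1) + (c + 1) = k by omega, mul_eq_zero] at h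
  rcases h with h | h
  · exact absurd h (by exact_mod_cast (by positivity : a.factorial * b.factorial ≠ 0))
  · rw [smul_eq_zero] at h
    rcases h with h | h
    · rw [Nat.descFactorial_eq_zero_iff_lt] at h; omega
    · exact h

theorem padeB_coeff_ne_zero (a b c : ℕ) : (padeB a b c).coeff (a + c + 1) ≠ 0 := by
  intro h0
  have h := congrArg (fun p : ℤ[X] => p.coeff a) (padeB_iterate_derivative a b c)
  simp only [coeff_C_mul, coeff_iterate_derivative, coeff_mul_X_pow'] at h
  rw [if_pos le_rfl, show a + (c + 1) = a + c + 1 by omega, h0, smul_zero, mul_zero] at h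
  have : ((1 - X : ℤ[X]) ^ b).coeff (a - a) = 1 := by
    rw [Nat.sub_self, coeff_zero_eq_eval_zero]; simp
  rw [this, mul_one] at h
  have h3 : ((a + b + c + 1).factorial : ℤ) ≠ 0 := by exact_mod_cast Nat.factorial_ne_zero _
  have h2 : ((-1 : ℤ)) ^ (c + 1) ≠ 0 := by simp
  exact mul_ne_zero h2 h3 h.symm

theorem padeB_coeff_zero_ne_zero (a b c : ℕ) : (padeB a b c).coeff 0 ≠ 0 := by
  have h1 : (padeB a b c).coeff 0 = ∑ j ∈ Finset.range (a + 1),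
      ((-1) ^ j * ((a + b + c + 1).choose (a - j) : ℤ) * ((b + j).choose j : ℤ)) := by
    rw [coeff_zero_eq_eval_zero]
    simp [padeB, padePoly, eval_finsetSum]
  have h2 : ((1 : PowerSeries ℤ) - PowerSeries.X) ^ (a + b + c + 1) *
      (PowerSeries.invOneSubPow ℤ (b + 1)).val = (1 - PowerSeries.X) ^ (a + c) := by
    rw [show a + b + c + 1 = a + c + (b + 1) by ring, pow_add, mul_assoc,
      ← PowerSeries.invOneSubPow_inv_eq_one_sub_pow ℤ (b + 1), Units.inv_val, mul_one]
  have h4 : ∀ m k : ℕ, PowerSeries.coeff k (((1 : PowerSeries ℤ) - PowerSeries.X) ^ m) =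
      (-1) ^ k * (m.choose k : ℤ) := by
    intro m k
    have : ((1 : PowerSeries ℤ) - PowerSeries.X) ^ m = (((1 - X : ℤ[X]) ^ m : ℤ[X]) : PowerSeries ℤ) := by
      simp
    rw [this, Polynomial.coeff_coe]
    have h5 : ((1 - X : ℤ[X]) ^ m) = ((1 + X : ℤ[X]) ^ m).comp (C (-1) * X) := by
      simp [sub_eq_add_neg]
    rw [h5, comp_C_mul_X_coeff, coeff_one_add_X_pow, mul_comm]
  have h3 := congrArg (PowerSeries.coeff a) h2
  rw [mul_comm, PowerSeries.coeff_mul, Finset.Nat.sum_antidiagonal_eq_sum_range_succ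
    (fun i j => PowerSeries.coeff i (PowerSeries.invOneSubPow ℤ (b + 1)).val *
      PowerSeries.coeff j (((1 : PowerSeries ℤ) - PowerSeries.X) ^ (a + b + c + 1))), h4] at h3
  rw [h1]
  intro h
  have h6 : (-1) ^ a * (((a + c).choose a : ℕ) : ℤ) = 0 := by
    rw [← h3, ← mul_zero ((-1 : ℤ) ^ a), ← h, Finset.mul_sum]
    refine Finset.sum_congr rfl fun j hj => ?_
    have hj : j ≤ a := by have := Finset.mem_range.1 hj; omega
    rw [h4, PowerSeries.invOneSubPow_val_succ_eq_mk_add_choose, PowerSeries.coeff_mk,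
      Nat.choose_symm_add]
    obtain ⟨i, rfl⟩ := Nat.exists_eq_add_of_le hj
    rw [Nat.add_sub_cancel_left, pow_add]
    have : ((-1 : ℤ) ^ j) * (-1) ^ j = 1 := by rw [← mul_pow]; simp
    linear_combination (-((-1 : ℤ) ^ i * ((j + i + b + c + 1).choose i : ℤ) * ((b + j).choose j : ℤ))) * this
  rw [mul_eq_zero] at h6
  rcases h6 with h6 | h6
  · simp at h6
  · have := Nat.choose_pos (show a ≤ a + c by omega)
    exact this.ne' (by exact_mod_cast h6)

end Pade

section Pade

open Polynomial

theorem abs_coeff_one_sub_X_pow_le (m k : ℕ) : |((1 - X : ℤ[X]) ^ m).coeff k| ≤ 2 ^ m := by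
  have h5 : ((1 - X : ℤ[X]) ^ m) = ((1 + X : ℤ[X]) ^ m).comp (C (-1) * X) := by
    simp [sub_eq_add_neg]
  rw [h5, comp_C_mul_X_coeff, coeff_one_add_X_pow, abs_mul, abs_pow, abs_neg, abs_one, one_pow,
    mul_one, Nat.abs_cast]
  exact_mod_cast Nat.choose_le_two_pow m k

theorem abs_pade_term_le (a b c j : ℕ) :
    |((-1) ^ j * ((a + b + c + 1).choose (a - j) : ℤ) * ((b + j).choose j : ℤ))| ≤
      2 ^ (a + b + c + 1) * 2 ^ (b + j) := by
  rw [abs_mul, abs_mul, abs_pow, abs_neg, abs_one, one_pow, one_mul, Nat.abs_cast, Nat.abs_cast]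
  exact_mod_cast Nat.mul_le_mul (Nat.choose_le_two_pow _ _) (Nat.choose_le_two_pow _ _)

theorem abs_padePoly_coeff_le (a b c k : ℕ) :
    |(padePoly a b c).coeff k| ≤ 2 ^ (a + b + c + 1) * 2 ^ (a + b) := by
  rw [padePoly, finsetSum_coeff]
  simp only [coeff_C_mul_X_pow]
  rw [Finset.sum_ite_eq]
  split_ifs with h
  · have := Finset.mem_range.1 h
    exact (abs_pade_term_le a b c k).trans (mul_le_mul_of_nonneg_left
      (pow_le_pow_right₀ (by norm_num) (by omega)) (by positivity))
  · simp

theorem abs_padeB_coeff_le (a b c k : ℕ) : |(padeB a b c).coeff k| ≤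
    (a + 1) * (2 ^ (a + b + c + 1) * 2 ^ (a + b) * 2 ^ (a + b + c + 1)) := by
  have h : padeB a b c = ∑ j ∈ Finset.range (a + 1),
      C ((-1) ^ j * ((a + b + c + 1).choose (a - j) : ℤ) * ((b + j).choose j : ℤ)) *
        (1 - X) ^ (b + c + 1 + j) := by
    rw [padeB, padePoly, ← coe_compRingHom_apply, map_sum, Finset.mul_sum]
    simp only [coe_compRingHom_apply, mul_comp, C_comp, pow_comp, X_comp]
    refine Finset.sum_congr rfl fun j _ => ?_
    ring
  rw [h, finsetSum_coeff]
  refine (Finset.abs_sum_le_sum_abs _ _).trans ?_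
  have h2 : ∀ j ∈ Finset.range (a + 1), |(C ((-1) ^ j * ((a + b + c + 1).choose (a - j) : ℤ) *
      ((b + j).choose j : ℤ)) * (1 - X : ℤ[X]) ^ (b + c + 1 + j)).coeff k| ≤
      2 ^ (a + b + c + 1) * 2 ^ (a + b) * 2 ^ (a + b + c + 1) := by
    intro j hj
    have := Finset.mem_range.1 hj
    rw [coeff_C_mul, abs_mul]
    exact mul_le_mul ((abs_pade_term_le a b c j).trans (mul_le_mul_of_nonneg_left
      (pow_le_pow_right₀ (by norm_num) (by omega)) (by positivity)))
      ((abs_coeff_one_sub_X_pow_le _ _).trans (pow_le_pow_right₀ (by norm_num) (by omega)))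
      (abs_nonneg _) (by positivity)
  simpa using Finset.sum_le_card_nsmul _ _ _ h2

theorem padeB_natDegree_le (a b c : ℕ) : (padeB a b c).natDegree ≤ a + b + c + 1 := by
  have h : (1 - X : ℤ[X]).natDegree ≤ 1 := by
    rw [sub_eq_add_neg]
    exact natDegree_add_le_of_degree_le (by simp) (by simp)
  have h1 := natDegree_pow_le_of_le (b + c + 1) h
  have h2 : ((padePoly a b c).comp (1 - X)).natDegree ≤ a * 1 :=
    natDegree_comp_le.trans (Nat.mul_le_mul (padePoly_natDegree_le a b c) h)
  have := natDegree_mul_le_of_le h1 h2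
  rw [padeB]
  omega

theorem exists_pade_split (a b c : ℕ) : ∃ p r : ℤ[X], X ^ (a + c + 1) * p + padeB a b c = r ∧
    p.natDegree ≤ b ∧ r.natDegree ≤ c ∧ p.coeff 0 ≠ 0 ∧ r.coeff 0 ≠ 0 ∧
    (∀ k, ∃ k', |p.coeff k| ≤ |(padeB a b c).coeff k'|) ∧
    (∀ k, ∃ k', |r.coeff k| ≤ |(padeB a b c).coeff k'|) := by
  have hp : ∀ k, (∑ i ∈ Finset.range (b + 1),
      C (-(padeB a b c).coeff (i + (a + c + 1))) * X ^ i).coeff k =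
      if k ∈ Finset.range (b + 1) then -(padeB a b c).coeff (k + (a + c + 1)) else 0 := by
    intro k
    rw [finsetSum_coeff]
    simp only [coeff_C_mul_X_pow]
    rw [Finset.sum_ite_eq]
  have hr : ∀ k, (∑ i ∈ Finset.range (c + 1), C ((padeB a b c).coeff i) * X ^ i).coeff k =
      if k ∈ Finset.range (c + 1) then (padeB a b c).coeff k else 0 := by
    intro k
    rw [finsetSum_coeff]
    simp only [coeff_C_mul_X_pow]
    rw [Finset.sum_ite_eq]
  refine ⟨∑ i ∈ Finset.range (b + 1), C (-(padeB a b c).coeff (i + (a + c + 1))) * X ^ i,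
    ∑ i ∈ Finset.range (c + 1), C ((padeB a b c).coeff i) * X ^ i, ?_, ?_, ?_, ?_, ?_, ?_, ?_⟩
  · ext k
    rw [coeff_add, hr, mul_comm, coeff_mul_X_pow', hp]
    simp only [Finset.mem_range]
    by_cases h1 : a + c + 1 ≤ k
    · rw [if_pos h1, if_neg (show ¬ k < c + 1 by omega), Nat.sub_add_cancel h1]
      split_ifs with h2
      · simp
      · rw [zero_add]
        exact coeff_eq_zero_of_natDegree_lt ((padeB_natDegree_le a b c).trans_lt (by omega))
    · rw [if_neg h1, zero_add]
      split_ifs with h2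
      · rfl
      · exact padeB_coeff_eq_zero (by omega) (by omega)
  · refine natDegree_sum_le_of_forall_le _ _ fun j hj => ?_
    exact (natDegree_C_mul_X_pow_le _ _).trans (by have := Finset.mem_range.1 hj; omega)
  · refine natDegree_sum_le_of_forall_le _ _ fun j hj => ?_
    exact (natDegree_C_mul_X_pow_le _ _).trans (by have := Finset.mem_range.1 hj; omega)
  · rw [hp, if_pos (by simp), neg_ne_zero, zero_add]; exact padeB_coeff_ne_zero a b c
  · rw [hr, if_pos (by simp)]; exact padeB_coeff_zero_ne_zero a b c
  · intro k
    refine ⟨k + (a + c + 1), ?_⟩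
    rw [hp]; split_ifs <;> simp
  · intro k
    refine ⟨k, ?_⟩
    rw [hr]; split_ifs <;> simp

theorem pade_bound_aux {a N : ℕ} (ha : a ≤ N + 1) :
    ((a + 1) * (2 ^ (a + N + N + 1) * 2 ^ (a + N) * 2 ^ (a + N + N + 1)) : ℤ) ≤ 2 ^ (9 * N + 6) := by
  have h1 : ((a + 1 : ℕ) : ℤ) ≤ 2 ^ (N + 1) := by
    have : a + 1 ≤ 2 ^ (N + 1) := by
      have := Nat.lt_two_pow_self (n := N + 1)
      omega
    exact_mod_cast this
  push_cast at h1
  rw [← pow_add, ← pow_add]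
  calc _ ≤ (2 : ℤ) ^ (N + 1) * 2 ^ (8 * N + 5) :=
        mul_le_mul h1 (pow_le_pow_right₀ (by norm_num) (by omega)) (by positivity) (by positivity)
    _ = _ := by rw [← pow_add]; congr 1; ring

/-- Padé approximations to powers, with a non-vanishing condition. -/
theorem exists_pade (N : ℕ) {K : Type*} [Field K] [CharZero K] (x A : K) (hx : x ≠ 0)
    (hx' : 1 - x ≠ 0) : ∃ p q r : ℤ[X],
      x ^ (2 * N + 1) * aeval x p + (1 - x) ^ (2 * N + 1) * aeval (1 - x) q = aeval x r ∧
      A * aeval x r ≠ x ^ (2 * N + 1) * aeval x p ∧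
      (∀ s ∈ ({p, q, r} : Set ℤ[X]), s.natDegree ≤ N + 1 ∧
        ∀ k, |s.coeff k| ≤ 2 ^ (9 * N + 6)) := by
  obtain ⟨p, r, hpr, hp, hr, hp0, hr0, hpB, hrB⟩ := exists_pade_split N N N
  obtain ⟨p', r', hpr', hp', hr', hp0', hr0', hpB', hrB'⟩ := exists_pade_split (N + 1) N N
  have hev : ∀ s : ℤ[X], aeval x (s.comp (1 - X)) = aeval (1 - x) s := by
    intro s; simp [aeval_comp]
  have e1 : x ^ (2 * N + 1) * aeval x p + (1 - x) ^ (2 * N + 1) * aeval (1 - x) (padePoly N N N) =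
      aeval x r := by
    rw [← hpr, padeB, map_add, map_mul, map_mul, hev]
    simp only [map_pow, map_sub, aeval_X, map_one]
    rw [show N + N + 1 = 2 * N + 1 by ring]
  have e2 : x ^ (2 * N + 1) * aeval x (X * p') +
      (1 - x) ^ (2 * N + 1) * aeval (1 - x) (padePoly (N + 1) N N) = aeval x r' := by
    rw [← hpr', padeB, map_add, map_mul, map_mul, map_mul, hev]
    simp only [map_pow, map_sub, aeval_X, map_one]
    ring
  have hB : ∀ k, |(padeB N N N).coeff k| ≤ 2 ^ (9 * N + 6) := fun k =>
    (abs_padeB_coeff_le N N N k).trans (pade_bound_aux (by omega))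
  have hB' : ∀ k, |(padeB (N + 1) N N).coeff k| ≤ 2 ^ (9 * N + 6) := fun k =>
    (abs_padeB_coeff_le (N + 1) N N k).trans
      (by exact_mod_cast pade_bound_aux (a := N + 1) (N := N) le_rfl)
  have hq : ∀ a, a ≤ N + 1 → ∀ k, |(padePoly a N N).coeff k| ≤ 2 ^ (9 * N + 6) := by
    intro a ha k
    refine (abs_padePoly_coeff_le a N N k).trans ?_
    rw [← pow_add]
    exact pow_le_pow_right₀ (by norm_num) (by omega)
  by_cases hA : A * aeval x r = x ^ (2 * N + 1) * aeval x p
  swap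
  · refine ⟨p, padePoly N N N, r, e1, hA, ?_⟩
    rintro s (rfl | rfl | rfl)
    · exact ⟨by omega, fun k => (hpB k).choose_spec.trans (hB _)⟩
    · exact ⟨(padePoly_natDegree_le _ _ _).trans (by omega), hq _ (by omega)⟩
    · exact ⟨by omega, fun k => (hrB k).choose_spec.trans (hB _)⟩
  refine ⟨X * p', padePoly (N + 1) N N, r', e2, fun hA' => ?_, ?_⟩
  swap
  · rintro s (rfl | rfl | rfl)
    · refine ⟨(natDegree_mul_le_of_le natDegree_X_le hp').trans (by omega), fun k => ?_⟩
      cases k with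
      | zero => simp
      | succ k => rw [coeff_X_mul]; exact (hpB' k).choose_spec.trans (hB' _)
    · exact ⟨(padePoly_natDegree_le _ _ _).trans (by omega), hq _ (by omega)⟩
    · exact ⟨by omega, fun k => (hrB' k).choose_spec.trans (hB' _)⟩
  set W : ℤ[X] := p * r' - X * p' * r with hW
  set E : ℤ[X] := p * (padePoly (N + 1) N N).comp (1 - X) -
    X * p' * (padePoly N N N).comp (1 - X) with hE
  have hWE : W = (1 - X) ^ (2 * N + 1) * E := by
    have hX : (X : ℤ[X]) ^ (2 * N + 1) ≠ 0 := pow_ne_zero _ X_ne_zero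
    refine mul_left_cancel₀ hX ?_
    rw [hW, hE, ← hpr, ← hpr', padeB, padeB]
    ring
  have hW0 : W.coeff 0 ≠ 0 := by
    rw [hW, coeff_sub, mul_coeff_zero, mul_coeff_zero, mul_coeff_zero, coeff_X_zero]
    simpa using ⟨hp0, hr0'⟩
  have hWne : W ≠ 0 := fun h => hW0 (by rw [h, coeff_zero])
  have hWdeg : W.natDegree ≤ 2 * N + 1 := by
    rw [hW]
    have h1 : (p * r').natDegree ≤ 2 * N + 1 := (natDegree_mul_le_of_le hp hr').trans (by omega)
    have h2 : (X * p' * r).natDegree ≤ 2 * N + 1 :=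
      (natDegree_mul_le_of_le (natDegree_mul_le_of_le natDegree_X_le hp') hr).trans (by omega)
    exact (natDegree_sub_le _ _).trans (max_le h1 h2)
  have hEne : E ≠ 0 := fun h => hWne (by rw [hWE, h, mul_zero])
  have h1X : (1 - X : ℤ[X]).natDegree = 1 := by
    rw [← neg_sub, natDegree_neg]; exact natDegree_X_sub_C (1 : ℤ)
  have h1X0 : (1 - X : ℤ[X]) ≠ 0 := fun h => by rw [h] at h1X; simp at h1X
  have hEdeg : E.natDegree = 0 := by
    rw [hWE, natDegree_mul (pow_ne_zero _ h1X0) hEne, natDegree_pow, h1X] at hWdeg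
    omega
  rw [eq_C_of_natDegree_eq_zero hEdeg] at hWE
  have hWx : aeval x W = 0 := by
    have hxM : x ^ (2 * N + 1) ≠ 0 := pow_ne_zero _ hx
    refine mul_left_cancel₀ hxM ?_
    rw [hW, map_sub, map_mul, map_mul]
    linear_combination aeval x r * hA' - aeval x r' * hA
  rw [hWE] at hWx
  simp only [map_mul, map_pow, map_sub, map_one, aeval_X, aeval_C] at hWx
  rw [mul_eq_zero] at hWx
  rcases hWx with h | h
  · exact pow_ne_zero _ hx' h
  · have : E.coeff 0 = 0 := by simpa using h
    exact hWne (by rw [hWE, this]; simp)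

end Pade

namespace HeightSystem

variable {K : Type u} [Field K] {Q : ℕ} (H : HeightSystem K Q)

theorem l_intCast_le (v : H.V) {c : ℤ} (hc : (c : K) ≠ 0) {m : ℕ} (hm : |c| ≤ m) :
    H.l v (c : K) ≤ H.k v * Real.log m := by
  have h0 : c.natAbs ≤ m := by have := Int.natCast_natAbs c; omega
  have h1 : H.l v (c : K) = H.l v (c.natAbs : K) := by
    rcases Int.natAbs_eq c with h | h
    · nth_rewrite 1 [h]; simp
    · nth_rewrite 1 [h]; simp
  have h2 : (c.natAbs : K) = ∑ i ∈ Finset.range c.natAbs, (1 : K) := by simp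
  have h3 : (c.natAbs : K) ≠ 0 := by
    intro h
    rcases Int.natAbs_eq c with h' | h'
    · exact hc (by rw [h', Int.cast_natCast, h])
    · exact hc (by rw [h', Int.cast_neg, Int.cast_natCast, h, neg_zero])
  obtain ⟨i, -, -, hi⟩ := H.exists_l_sum_le v (s := Finset.range c.natAbs) (f := fun _ => (1 : K))
    (by rw [← h2]; exact h3)
  rw [← h2, Finset.card_range, l_one, add_zero] at hi
  rw [h1]
  refine hi.trans (mul_le_mul_of_nonneg_left (Real.log_le_log ?_ (by exact_mod_cast h0))
    (H.k_nonneg v))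
  have : c.natAbs ≠ 0 := fun h => h3 (by rw [h]; simp)
  positivity

/-- The size of the value of an integral polynomial at a place. -/
theorem l_aeval_le (v : H.V) {p : Polynomial ℤ} {m M : ℕ} (hp : p.natDegree ≤ m)
    (hM : ∀ k, |p.coeff k| ≤ M) {x : K} (hx : x ≠ 0) (h : Polynomial.aeval x p ≠ 0) :
    H.l v (Polynomial.aeval x p) ≤
      H.k v * Real.log ((m + 1 : ℕ) * M : ℝ) + m * max 0 (H.l v x) := by
  rw [Polynomial.aeval_eq_sum_range' (Nat.lt_succ_of_le hp)] at h ⊢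
  obtain ⟨i, hi, hi0, hle⟩ := H.exists_l_sum_le v h
  simp only [zsmul_eq_mul] at hi0 hle ⊢
  have hc := left_ne_zero_of_mul hi0
  rw [H.l_mul v hc (pow_ne_zero _ hx), H.l_pow, Finset.card_range] at hle
  have h1 := H.l_intCast_le v hc (hM i)
  have hM0 : M ≠ 0 := by
    rintro rfl
    have := hM i
    have h3 : p.coeff i = 0 := by
      rw [← abs_nonpos_iff]; exact_mod_cast this
    exact hc (by rw [h3]; simp)
  have him : (i : ℝ) ≤ m := by
    have := Finset.mem_range.1 hi
    exact_mod_cast Nat.le_of_lt_succ this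
  have h2 : (i : ℝ) * H.l v x ≤ m * max 0 (H.l v x) :=
    (mul_le_mul_of_nonneg_left (le_max_right _ _) (by positivity)).trans
      (mul_le_mul_of_nonneg_right him (le_max_left _ _))
  rw [Real.log_mul (by positivity) (by positivity), mul_add]
  refine hle.trans ?_
  linarith

theorem l_sub_le (v : H.V) {x y : K} (h : x - y ≠ 0) {T : ℝ} (hx : x ≠ 0 → H.l v x ≤ T)
    (hy : y ≠ 0 → H.l v y ≤ T) : H.l v (x - y) ≤ H.k v * Real.log 2 + T := by
  have h1 : x - y = ∑ i : Fin 2, (![x, -y] : Fin 2 → K) i := by simp [sub_eq_add_neg]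
  rw [h1] at h ⊢
  obtain ⟨i, -, hi0, hi⟩ := H.exists_l_sum_le v h
  refine hi.trans ?_
  simp only [Finset.card_univ, Fintype.card_fin, Nat.cast_ofNat]
  refine add_le_add le_rfl ?_
  fin_cases i
  · exact hx hi0
  · simp only [Fin.mk_one, Matrix.cons_val_one, Matrix.cons_val_fin_one, l_neg] at hi0 ⊢
    exact hy (by simpa using hi0)

theorem aeval_mem_O {x : K} (hx : x ∈ H.O) (p : Polynomial ℤ) : Polynomial.aeval x p ∈ H.O := by
  rw [Polynomial.aeval_eq_sum_range]
  exact H.O.sum_mem fun i _ => H.O.zsmul_mem (H.O.pow_mem hx i) _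

theorem pade_height [CharZero K] {x y A B : Kˣ} (hx : x ∈ H.units) (hy : y ∈ H.units)
    (hA : A ∈ H.units) (hB : B ∈ H.units) (hxy : (x : K) + y = 1) (hAB : (A : K) + B = 1)
    (N : ℕ) : N * (H.nrm x + H.nrm y) / 4 ≤
      Real.log 2 + Real.log ((N + 2 : ℕ) * (2 ^ (9 * N + 6) : ℕ)) +
        (H.nrm (A * (x ^ (2 * N + 1))⁻¹ : Kˣ) + H.nrm (B * (y ^ (2 * N + 1))⁻¹ : Kˣ)) / 2 := by
  have hy1 : 1 - (x : K) = y := by rw [← hxy]; ring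
  obtain ⟨p, q, r, h1, h2, h3⟩ := exists_pade N (x : K) (A : K) x.ne_zero (by rw [hy1]; exact y.ne_zero)
  rw [hy1] at h1
  have hp := h3 p (by simp)
  have hq := h3 q (by simp)
  have hr := h3 r (by simp)
  clear h3
  set m := 2 * N + 1 with hm
  set P := Polynomial.aeval (x : K) p with hP
  set R := Polynomial.aeval (x : K) r with hR
  set S := Polynomial.aeval (y : K) q with hS
  set q₁ : Kˣ := A * (x ^ m)⁻¹ with hq₁
  set q₂ : Kˣ := B * (y ^ m)⁻¹ with hq₂
  have hAq : (A : K) = x ^ m * q₁ := by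
    rw [hq₁]; push_cast; field_simp
  have hBq : (B : K) = y ^ m * q₂ := by
    rw [hq₂]; push_cast; field_simp
  set Δ : K := A * R - x ^ m * P with hΔ
  have hΔ0 : Δ ≠ 0 := sub_ne_zero.2 h2
  have hΔO : Δ ∈ H.O := H.O.sub_mem (H.O.mul_mem hA.1 (H.aeval_mem_O hx.1 r))
    (H.O.mul_mem (H.O.pow_mem hx.1 _) (H.aeval_mem_O hx.1 p))
  have e1 : Δ = x ^ m * (q₁ * R - P) := by rw [hΔ, hAq]; ring
  have e2 : Δ = y ^ m * (S - q₂ * R) := by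
    rw [hΔ, mul_sub, ← mul_assoc, ← hBq, ← h1, ← sub_eq_zero]
    linear_combination ((x : K) ^ m * P + y ^ m * S) * hAB
  have e3 : Δ = (x ^ m * y ^ m) * (q₁ * S - q₂ * P) := by
    rw [hΔ, ← h1, show ((x : K) ^ m * y ^ m) * (q₁ * S - q₂ * P) =
      (x ^ m * q₁) * (y ^ m * S) - (y ^ m * q₂) * (x ^ m * P) by ring, ← hAq, ← hBq]
    linear_combination ((x : K) ^ m * P) * hAB
  set L := Real.log ((N + 2 : ℕ) * (2 ^ (9 * N + 6) : ℕ)) with hL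
  let μ : H.V → ℝ := fun v => max 0 (max (H.l v x) (H.l v y))
  have hμx : ∀ v, max 0 (H.l v x) ≤ μ v := fun v => max_le_max le_rfl (le_max_left _ _)
  have hμy : ∀ v, max 0 (H.l v y) ≤ μ v := fun v => max_le_max le_rfl (le_max_right _ _)
  have hval : ∀ (v : H.V) (s : Polynomial ℤ) (z : Kˣ), max 0 (H.l v z) ≤ μ v →
      (s.natDegree ≤ N + 1 ∧ ∀ k, |s.coeff k| ≤ 2 ^ (9 * N + 6)) →
      Polynomial.aeval (z : K) s ≠ 0 →
      H.l v (Polynomial.aeval (z : K) s) ≤ H.k v * L + (N + 1) * μ v := by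
    intro v s z hz hs h0
    have := H.l_aeval_le v (M := 2 ^ (9 * N + 6)) hs.1 (fun k => by exact_mod_cast hs.2 k)
      z.ne_zero h0
    refine this.trans ?_
    push_cast at hL ⊢
    rw [hL, show (N : ℝ) + 1 + 1 = N + 2 by ring]
    gcongr
  have hmul : ∀ (v : H.V) (u : Kˣ) (z : K) (T : ℝ), (z ≠ 0 → H.l v z ≤ T) →
      (u : K) * z ≠ 0 → H.l v (u * z) ≤ T + max (H.l v u) 0 := by
    intro v u z T hz h0
    have hz0 := right_ne_zero_of_mul h0
    rw [H.l_mul v u.ne_zero hz0]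
    linarith [hz hz0, le_max_left (H.l v u) 0]
  have key : ∀ v, H.l v Δ ≤ H.k v * (Real.log 2 + L) + (N + 1) * μ v +
      (max (H.l v q₁) 0 + max (H.l v q₂) 0) + m * (H.l v x + H.l v y - μ v) := by
    intro v
    have a1 := le_max_right (H.l v q₁) 0
    have a2 := le_max_right (H.l v q₂) 0
    have hPv := hval v p x (hμx v) hp
    have hRv := hval v r x (hμx v) hr
    have hSv := hval v q y (hμy v) hq
    set T := H.k v * L + (N + 1) * μ v
    have hpx : (x : K) ^ m ≠ 0 := pow_ne_zero _ x.ne_zero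
    have hpy : (y : K) ^ m ≠ 0 := pow_ne_zero _ y.ne_zero
    rcases max_choice 0 (max (H.l v x) (H.l v y)) with hc | hc
    · have hμ : μ v = 0 := hc
      have h0 : (q₁ : K) * S - q₂ * P ≠ 0 := fun h => hΔ0 (by rw [e3, h, mul_zero])
      have := H.l_sub_le v h0 (T := T + (max (H.l v q₁) 0 + max (H.l v q₂) 0))
        (fun h => by linarith [hmul v q₁ S T hSv h]) (fun h => by linarith [hmul v q₂ P T hPv h])
      rw [e3, H.l_mul v (mul_ne_zero hpx hpy) h0, H.l_mul v hpx hpy, H.l_pow, H.l_pow, hμ, sub_zero]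
      simp only [T, hμ] at this
      linarith
    · rcases max_choice (H.l v x) (H.l v y) with hc' | hc'
      · have hμ : μ v = H.l v x := hc.trans hc'
        have h0 : S - q₂ * R ≠ 0 := fun h => hΔ0 (by rw [e2, h, mul_zero])
        have := H.l_sub_le v h0 (T := T + (max (H.l v q₁) 0 + max (H.l v q₂) 0))
          (fun h => by linarith [hSv h]) (fun h => by linarith [hmul v q₂ R T hRv h])
        rw [e2, H.l_mul v hpy h0, H.l_pow, show H.l v x + H.l v y - μ v = H.l v y by rw [hμ]; ring]
        simp only [T] at this
        linarith
      · have hμ : μ v = H.l v y := hc.trans hc'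
        have h0 : q₁ * R - P ≠ 0 := fun h => hΔ0 (by rw [e1, h, mul_zero])
        have := H.l_sub_le v h0 (T := T + (max (H.l v q₁) 0 + max (H.l v q₂) 0))
          (fun h => by linarith [hmul v q₁ R T hRv h]) (fun h => by linarith [hPv h])
        rw [e1, H.l_mul v hpx h0, H.l_pow, show H.l v x + H.l v y - μ v = H.l v x by rw [hμ]; ring]
        simp only [T] at this
        linarith
  have hsum := (H.sum_l_nonneg hΔO hΔ0).trans (Finset.sum_le_sum fun v _ => key v)
  simp only [Finset.sum_add_distrib, ← Finset.sum_mul, ← Finset.mul_sum, H.sum_k, one_mul,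
    Finset.sum_sub_distrib, H.sum_l_eq_zero hx, H.sum_l_eq_zero hy] at hsum
  have hq₁u : q₁ ∈ H.units := H.units.mul_mem hA (H.units.inv_mem (H.units.pow_mem hx _))
  have hq₂u : q₂ ∈ H.units := H.units.mul_mem hB (H.units.inv_mem (H.units.pow_mem hy _))
  have n1 := H.nrm_eq_two_mul hq₁u
  have n2 := H.nrm_eq_two_mul hq₂u
  have n3 := H.nrm_eq_two_mul hx
  have n4 := H.nrm_eq_two_mul hy
  have s1 : ∑ v, max (H.l v x) 0 ≤ ∑ v, μ v :=
    Finset.sum_le_sum fun v _ => by rw [max_comm]; exact hμx v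
  have s2 : ∑ v, max (H.l v y) 0 ≤ ∑ v, μ v :=
    Finset.sum_le_sum fun v _ => by rw [max_comm]; exact hμy v
  have hm' : (m : ℝ) = 2 * N + 1 := by rw [hm]; push_cast; ring
  rw [hm'] at hsum
  have : (N : ℝ) * (H.nrm x + H.nrm y) / 4 ≤ N * ∑ v, μ v := by
    rw [mul_div_assoc]
    refine mul_le_mul_of_nonneg_left ?_ (by positivity)
    linarith
  rw [n1, n2]
  linarith

end HeightSystem

namespace HeightSystem

/-- A gap principle: solutions of the two-variable unit equation pointing in similar directions
have comparable sizes. -/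
theorem IsSol.norm_le_of_direction {K : Type u} [Field K] [CharZero K] {Q : ℕ}
    {H : HeightSystem K Q} {ι : Type v} [Fintype ι] (hι : Fintype.card ι = 2) {x y : ι → Kˣ}
    (hx : H.IsSol x) (hy : H.IsSol y) (hx1 : 128 ≤ ‖H.vec x‖)
    (h : ‖‖H.vec y‖⁻¹ • H.vec y - ‖H.vec x‖⁻¹ • H.vec x‖ ≤ 1 / 32) :
    ‖H.vec y‖ ≤ 32 * ‖H.vec x‖ := by
  classical
  set a := ‖H.vec x‖ with ha
  set b := ‖H.vec y‖ with hb
  by_contra! hlt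
  have ha0 : 0 < a := by linarith
  have hb0 : 0 < b := by linarith
  set R := b / a with hR
  have hR32 : 32 < R := by rw [hR, lt_div_iff₀ ha0]; exact hlt
  set N := ⌊(R - 1) / 2⌋₊ with hN
  have hN1 : (N : ℝ) ≤ (R - 1) / 2 := Nat.floor_le (by linarith)
  have hN2 : (R - 1) / 2 < N + 1 := Nat.lt_floor_add_one _
  obtain ⟨i, j, hij, hu⟩ := Finset.card_eq_two.1 (hι : (Finset.univ : Finset ι).card = 2)
  have hsx := hx.2
  have hsy := hy.2
  rw [hu, Finset.sum_pair hij] at hsx hsy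
  have hp := H.pade_height (hx.1 i) (hx.1 j) (hy.1 i) (hy.1 j) hsx hsy N
  have e1 : H.nrm (x i) + H.nrm (x j) = a := by
    rw [ha, norm_vec, hu, Finset.sum_pair hij]
  have e2 : H.nrm (y i * (x i ^ (2 * N + 1))⁻¹ : Kˣ) + H.nrm (y j * (x j ^ (2 * N + 1))⁻¹ : Kˣ) =
      ‖H.vec y - ((2 * N + 1 : ℕ) : ℝ) • H.vec x‖ := by
    rw [← vec_pow, ← vec_div, norm_vec, hu, Finset.sum_pair hij]
    simp only [Pi.div_apply, Pi.pow_apply, div_eq_mul_inv]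
  rw [e1, e2] at hp
  have hlog2 : Real.log 2 ≤ 1 := by
    have := Real.log_le_sub_one_of_pos (x := 2) (by norm_num); linarith
  have hL : Real.log ((N + 2 : ℕ) * (2 ^ (9 * N + 6) : ℕ)) ≤ 10 * N + 7 := by
    have h1 : (N + 2) * 2 ^ (9 * N + 6) ≤ 2 ^ (10 * N + 7) := by
      have : N + 2 ≤ 2 ^ (N + 1) := by
        have := Nat.lt_two_pow_self (n := N + 1); omega
      calc _ ≤ 2 ^ (N + 1) * 2 ^ (9 * N + 6) := Nat.mul_le_mul_right _ this
        _ = _ := by rw [← pow_add]; congr 1; ring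
    have h2 := Real.log_le_log (x := (N + 2 : ℕ) * (2 ^ (9 * N + 6) : ℕ)) (y := 2 ^ (10 * N + 7))
      (by positivity) (by exact_mod_cast h1)
    rw [Real.log_pow] at h2
    refine h2.trans ?_
    push_cast
    nlinarith [Nat.cast_nonneg (α := ℝ) N]
  have hE : ‖H.vec y - ((2 * N + 1 : ℕ) : ℝ) • H.vec x‖ ≤ R * a / 32 + 2 * a := by
    have e3 : H.vec y - ((2 * N + 1 : ℕ) : ℝ) • H.vec x =
        b • (b⁻¹ • H.vec y - a⁻¹ • H.vec x) + (R - (2 * N + 1 : ℕ)) • H.vec x := by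
      rw [smul_sub, smul_smul, smul_smul, mul_inv_cancel₀ hb0.ne', one_smul, sub_smul, hR,
        div_eq_mul_inv]
      abel
    rw [e3]
    refine (norm_add_le _ _).trans ?_
    rw [norm_smul, norm_smul, Real.norm_of_nonneg hb0.le, ← ha]
    have hRa : R * a = b := by rw [hR]; field_simp
    refine add_le_add ?_ (mul_le_mul_of_nonneg_right ?_ ha0.le)
    · rw [hRa, div_eq_mul_one_div]
      exact mul_le_mul_of_nonneg_left h hb0.le
    · push_cast
      rw [Real.norm_of_nonneg (by linarith)]
      linarith
  have hN10 : (10 : ℝ) ≤ N := by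
    have : 15 ≤ N := Nat.le_floor (by push_cast; linarith)
    exact_mod_cast (by omega : 10 ≤ N)
  have hRN : R * a ≤ (2 * N + 3) * a := by
    refine mul_le_mul_of_nonneg_right ?_ ha0.le
    linarith
  nlinarith

theorem IsSol.unique_of_relation {K : Type u} [Field K] {Q : ℕ}
    {H : HeightSystem K Q} {ι : Type v} [Fintype ι] (hι : Fintype.card ι = 2) {x y : ι → Kˣ}
    (hx : H.IsSol x) (hy : H.IsSol y) {b : ι → K} (hb : b ≠ 0) (hbx : ∑ i, b i * x i = 0)
    (hby : ∑ i, b i * y i = 0) : x = y := by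
  classical
  obtain ⟨i, j, hij, hu⟩ := Finset.card_eq_two.1 (hι : (Finset.univ : Finset ι).card = 2)
  have hsx := hx.2
  have hsy := hy.2
  rw [hu, Finset.sum_pair hij] at hsx hsy hbx hby
  have hne : b i ≠ b j := by
    intro h
    have hi : b i = 0 := by linear_combination hbx - b i * hsx + (x j : K) * h
    refine hb (funext fun k => ?_)
    have hk : k ∈ ({i, j} : Finset ι) := hu ▸ Finset.mem_univ k
    rcases Finset.mem_insert.1 hk with rfl | hk
    · exact hi
    · rw [Finset.mem_singleton.1 hk, ← h, hi]; rfl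
  have h0 : (b i - b j) * ((x i : K) - y i) = 0 := by
    linear_combination hbx - hby - b j * hsx + b j * hsy
  have hxi : (x i : K) = y i := by
    rcases mul_eq_zero.1 h0 with h | h
    · exact absurd (sub_eq_zero.1 h) hne
    · exact sub_eq_zero.1 h
  have hxj : (x j : K) = y j := by linear_combination hsx - hsy - hxi
  refine funext fun k => Units.ext ?_
  have hk : k ∈ ({i, j} : Finset ι) := hu ▸ Finset.mem_univ k
  rcases Finset.mem_insert.1 hk with rfl | hk
  · exact hxi
  · rw [Finset.mem_singleton.1 hk, hxj]

/-- The two-variable unit equation has boundedly many solutions. -/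
theorem exists_card_sol_two_le (d : ℕ) : ∃ C : ℕ,
    ∀ {K : Type u} [Field K] [CharZero K] (H : HeightSystem K (relPrimes 2)) {ι : Type v}
      [Fintype ι], Fintype.card ι = 2 → ∀ (F : Submodule ℝ (PiLp 1 (fun _ : ι × H.V => ℝ))),
      Module.finrank ℝ F ≤ d → ∀ (s : Finset (ι → Kˣ)), (∀ x ∈ s, H.IsSol x ∧ H.vec x ∈ F) →
      s.card ≤ C := by
  classical
  obtain ⟨m, hcov⟩ := exists_shell_cover.{u, v} 2 le_rfl
  refine ⟨(5 ^ d) ^ (m + 1) * relCount 2 * (7 + (5 ^ d) ^ (5 + 1) * 7),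
    fun {K} _ _ H ι _ hι F hF s hs => ?_⟩
  have hfib : ∀ k ∈ s.image H.shell, (s.filter fun x => H.shell x = k).card ≤
      (5 ^ d) ^ (m + 1) * relCount 2 := by
    intro k _
    obtain ⟨C, hC, hCs, hCx⟩ := hcov m le_rfl d H hι F hF (s.filter fun x => H.shell x = k)
      (fun x hx => hs x (Finset.mem_filter.1 hx).1) (2 ^ k) (by positivity) (fun x hx => by
        obtain ⟨-, rfl⟩ := Finset.mem_filter.1 hx
        exact ⟨(H.shell_bounds x).1, (H.shell_bounds x).2.1⟩)
    refine le_trans ?_ hC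
    choose! g hg using hCx
    refine Finset.card_le_card_of_injOn g (fun x hx => (hg x hx).1) fun x hx y hy hxy => ?_
    refine IsSol.unique_of_relation hι (hs x (Finset.mem_filter.1 hx).1).1
      (hs y (Finset.mem_filter.1 hy).1).1 (hCs _ (hg x hx).1).2 (hg x hx).2.2 ?_
    rw [hxy]; exact (hg y hy).2.2
  refine (Finset.card_le_mul_card_image s _ hfib).trans (Nat.mul_le_mul_left _ ?_)
  set f : (ι → Kˣ) → PiLp 1 (fun _ : ι × H.V => ℝ) := fun x => ‖H.vec x‖⁻¹ • H.vec x with hf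
  obtain ⟨t, hts, htc, ht⟩ := exists_net F hF f (r := 1 / 64) (by norm_num) 5
    (s.filter fun x => 7 ≤ H.shell x) (fun x hx => F.smul_mem _ (hs x (Finset.mem_filter.1 hx).1).2)
    0 F.zero_mem (fun x hx => by
      rw [sub_zero, hf, norm_smul, norm_inv, norm_norm]
      refine (inv_mul_le_one).trans ?_
      norm_num)
  have hsub : s.image H.shell ⊆ Finset.range 7 ∪ t.biUnion fun y =>
      (s.filter fun x => 7 ≤ H.shell x ∧ ‖f x - f y‖ ≤ 1 / 64).image H.shell := by
    intro k hk
    obtain ⟨x, hx, rfl⟩ := Finset.mem_image.1 hk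
    by_cases h7 : 7 ≤ H.shell x
    · obtain ⟨y, hy, hxy⟩ := ht x (Finset.mem_filter.2 ⟨hx, h7⟩)
      exact Finset.mem_union_right _ (Finset.mem_biUnion.2 ⟨y, hy, Finset.mem_image_of_mem _
        (Finset.mem_filter.2 ⟨hx, h7, hxy⟩)⟩)
    · exact Finset.mem_union_left _ (Finset.mem_range.2 (by omega))
  refine (Finset.card_le_card hsub).trans ((Finset.card_union_le _ _).trans
    (add_le_add (by simp) ((Finset.card_biUnion_le_card_mul _ _ 7 fun y _ => ?_).trans
      (Nat.mul_le_mul_right _ htc))))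
  rcases (s.filter fun x => 7 ≤ H.shell x ∧ ‖f x - f y‖ ≤ 1 / 64).eq_empty_or_nonempty with h | h
  · rw [h]; simp
  obtain ⟨x, hx, hmin⟩ := Finset.exists_min_image _ H.shell h
  refine (Finset.card_le_card (t := Finset.Icc (H.shell x) (H.shell x + 6)) fun k hk => ?_).trans
    (by rw [Nat.card_Icc]; omega)
  obtain ⟨z, hz, rfl⟩ := Finset.mem_image.1 hk
  refine Finset.mem_Icc.2 ⟨hmin z hz, ?_⟩
  obtain ⟨hxs, hx7, hxy⟩ := Finset.mem_filter.1 hx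
  obtain ⟨hzs, hz7, hzy⟩ := Finset.mem_filter.1 hz
  have h1 := (H.shell_bounds x).2.2 (by omega)
  have h2 := (H.shell_bounds z).2.2 (by omega)
  have h3 : (2 : ℝ) ^ 7 ≤ 2 ^ H.shell x := pow_le_pow_right₀ (by norm_num) hx7
  have h4 : ‖f z - f x‖ ≤ 1 / 32 := by
    have := norm_sub_le_norm_sub_add_norm_sub (f z) (f y) (f x)
    rw [norm_sub_rev (f y)] at this
    linarith
  have h5 := IsSol.norm_le_of_direction hι (hs x hxs).1 (hs z hzs).1 (by linarith) h4
  have h6 := (H.shell_bounds x).1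
  have h7 : (2 : ℝ) ^ H.shell z ≤ 2 ^ (H.shell x + 6) := by
    rw [pow_add]; linarith
  exact (pow_le_pow_iff_right₀ (by norm_num : (1 : ℝ) < 2)).1 h7

end HeightSystem

section NumberField

open NumberField

theorem sum_log_places {K : Type u} [Field K] [NumberField K] (S : Finset (FinitePlace K)) {x : K}
    (hx : x ≠ 0) (hS : ∀ v, v ∉ S → v x ≤ 1) :
    0 ≤ (∑ w : InfinitePlace K, w.mult * Real.log (w x)) + ∑ v ∈ S, Real.log (v x) := by
  classical
  have hfin : {v : FinitePlace K | v x ≠ 1}.Finite := FinitePlace.hasFiniteMulSupport hx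
  have h1 : ∏ᶠ v : FinitePlace K, v x = ∏ v ∈ S ∪ hfin.toFinset, v x :=
    finprod_eq_prod_of_mulSupport_subset _ fun v hv =>
      Finset.mem_coe.2 (Finset.mem_union_right _ (hfin.mem_toFinset.2 hv))
  have h2 := prod_abs_eq_one hx
  rw [h1] at h2
  have h3 := congrArg Real.log h2
  rw [Real.log_mul (Finset.prod_ne_zero_iff.2 fun w _ => pow_ne_zero _ (by simpa using hx))
    (Finset.prod_ne_zero_iff.2 fun v _ => by simpa using hx),
    Real.log_prod (fun w _ => pow_ne_zero _ (by simpa using hx)),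
    Real.log_prod (fun v _ => by simpa using hx), Real.log_one] at h3
  simp only [Real.log_pow] at h3
  have h4 : ∑ v ∈ S ∪ hfin.toFinset, Real.log (v x) ≤ ∑ v ∈ S, Real.log (v x) := by
    rw [← Finset.sum_sdiff (Finset.subset_union_left (s₁ := S) (s₂ := hfin.toFinset))]
    have : ∑ v ∈ (S ∪ hfin.toFinset) \ S, Real.log (v x) ≤ 0 :=
      Finset.sum_nonpos fun v hv => Real.log_nonpos (apply_nonneg v x)
        (hS v (Finset.mem_sdiff.1 hv).2)
    linarith
  linarith

theorem sum_log_places_eq {K : Type u} [Field K] [NumberField K] (S : Finset (FinitePlace K))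
    {x : K} (hx : x ≠ 0) (hS : ∀ v, v ∉ S → v x = 1) :
    (∑ w : InfinitePlace K, w.mult * Real.log (w x)) + ∑ v ∈ S, Real.log (v x) = 0 := by
  refine le_antisymm ?_ (sum_log_places S hx fun v hv => (hS v hv).le)
  have := sum_log_places S (inv_ne_zero hx) fun v hv => by rw [map_inv₀, hS v hv, inv_one]
  simp only [map_inv₀, Real.log_inv, mul_neg, Finset.sum_neg_distrib] at this
  linarith

/-- A number field carries a height system for which prescribed elements are units. -/
theorem exists_heightSystem (K : Type u) [Field K] [NumberField K] (Q : ℕ) (T : Finset Kˣ) :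
    ∃ H : HeightSystem K Q, ∀ x ∈ T, x ∈ H.units := by
  classical
  have hd : (0 : ℝ) < (Module.finrank ℚ K : ℕ) := Nat.cast_pos.2 Module.finrank_pos
  set d : ℝ := ((Module.finrank ℚ K : ℕ) : ℝ) with hd_def
  have hfin : ∀ x : Kˣ, {v : FinitePlace K | v (x : K) ≠ 1}.Finite := fun x =>
    FinitePlace.hasFiniteMulSupport x.ne_zero
  have hfin' : ∀ n : ℕ, {v : FinitePlace K | n ≠ 0 ∧ v (n : K) ≠ 1}.Finite := fun n => by
    by_cases h : n = 0
    · simp [h]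
    · exact (FinitePlace.hasFiniteMulSupport (Nat.cast_ne_zero.2 h)).subset fun v hv => hv.2
  let S : Finset (FinitePlace K) := (T.biUnion fun x => (hfin x).toFinset) ∪
    (Finset.range (Q + 1)).biUnion fun n => (hfin' n).toFinset
  have hST : ∀ x ∈ T, ∀ v ∉ S, v (x : K) = 1 := by
    intro x hx v hv
    by_contra h
    exact hv (Finset.mem_union_left _ (Finset.mem_biUnion.2 ⟨x, hx, by simpa using h⟩))
  have hSQ : ∀ n ≤ Q, n ≠ 0 → ∀ v ∉ S, v (n : K) = 1 := by
    intro n hn h0 v hv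
    by_contra h
    exact hv (Finset.mem_union_right _ (Finset.mem_biUnion.2
      ⟨n, Finset.mem_range.2 (by omega), by simpa using ⟨h0, h⟩⟩))
  have hnn : ∀ (v : FinitePlace K) (x y : K), v (x + y) ≤ max (v x) (v y) := fun v x y => v.add_le x y
  let O : Subring K :=
    { carrier := {x | ∀ v ∉ S, v x ≤ 1}
      mul_mem' := fun {a b} ha hb v hv => by
        rw [map_mul]; exact mul_le_one₀ (ha v hv) (apply_nonneg _ _) (hb v hv)
      one_mem' := fun v _ => by rw [map_one]
      add_mem' := fun {a b} ha hb v hv => (hnn v a b).trans (max_le (ha v hv) (hb v hv))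
      zero_mem' := fun v _ => by rw [map_zero]; exact zero_le_one
      neg_mem' := fun {a} ha v hv => by
        have : v (-a) = v a := map_neg_eq_map v a
        rw [this]; exact ha v hv }
  have hsplit : ∀ x : K, ∑ p : InfinitePlace K ⊕ S,
      (p.elim (fun w => w.mult / d) fun _ => 1 / d) *
        Real.log (p.elim (fun w => w.1) (fun v => v.1.1) x) =
      ((∑ w : InfinitePlace K, w.mult * Real.log (w x)) + ∑ v ∈ S, Real.log (v x)) / d := by
    intro x
    rw [Fintype.sum_sum_type, add_div, Finset.sum_div, Finset.sum_div]
    congr 1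
    · refine Finset.sum_congr rfl fun w _ => ?_
      simp only [Sum.elim_inl]
      rw [div_mul_eq_mul_div]; rfl
    · rw [← Finset.sum_coe_sort S]
      refine Finset.sum_congr rfl fun v _ => ?_
      simp only [Sum.elim_inr]
      rw [div_mul_eq_mul_div, one_mul]; rfl
  let H : HeightSystem K Q :=
    { V := InfinitePlace K ⊕ S
      fintypeV := inferInstance
      abv := fun p => p.elim (fun w => w.1) (fun v => v.1.1)
      arch := fun p => p.isLeft
      w := fun p => p.elim (fun w => w.mult / d) fun _ => 1 / d
      w_pos := by
        rintro (w | v)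
        · exact div_pos (by exact_mod_cast w.mult_pos) hd
        · exact div_pos one_pos hd
      nonarch := by
        rintro (w | v) h
        · simp at h
        · exact fun x y => hnn v.1 x y
      sum_arch := by
        rw [Fintype.sum_sum_type]
        simp only [Sum.isLeft_inl, Sum.isLeft_inr, Sum.elim_inl, if_true, Bool.false_eq_true,
          if_false, Finset.sum_const_zero, add_zero]
        rw [← Finset.sum_div, ← Nat.cast_sum, InfinitePlace.sum_mult_eq, div_self hd.ne']
      O := O
      sum_nonneg := fun x hx h0 => by
        rw [hsplit]; exact div_nonneg (sum_log_places S h0 hx) hd.le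
      sum_prime := fun p hp hpQ => by
        have h1 := sum_log_places_eq S (x := (p : K)) (Nat.cast_ne_zero.2 hp.ne_zero)
          (hSQ p hpQ hp.ne_zero)
        have h2 : ∑ w : InfinitePlace K, w.mult * Real.log (w (p : K)) = d * Real.log p := by
          have : ∀ w : InfinitePlace K, w (p : K) = p := fun w => by
            rw [← InfinitePlace.norm_embedding_eq]; simp
          simp only [this]
          rw [← Finset.sum_mul, ← Nat.cast_sum, InfinitePlace.sum_mult_eq]
        rw [Fintype.sum_sum_type]
        simp only [Sum.isLeft_inl, Sum.isLeft_inr, Sum.elim_inr, if_true, Bool.false_eq_true,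
          if_false, Finset.sum_const_zero, zero_add]
        rw [← Finset.mul_sum]
        have h3 : ∑ v : S, Real.log (v.1.1 (p : K)) = ∑ v ∈ S, Real.log (v (p : K)) :=
          Finset.sum_coe_sort S fun v => Real.log (v (p : K))
        rw [h3]
        have h4 : ∑ v ∈ S, Real.log (v (p : K)) = -(d * Real.log p) := by linarith
        rw [h4]; field_simp }
  refine ⟨H, fun x hx => ⟨fun v hv => (hST x hx v hv).le, fun v hv => ?_⟩⟩
  rw [Units.val_inv_eq_inv_val, map_inv₀, hST x hx v hv, inv_one]

end NumberField

section Count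

variable {ι M : Type*}

open scoped Classical in
/-- The number of distinct restrictions to `J` of the functions in `X`. -/
noncomputable def cnt (X : Finset (ι → M)) (J : Finset ι) : ℕ := (X.image J.restrict).card

theorem restrict_eq_restrict_iff {J : Finset ι} {x y : ι → M} :
    J.restrict x = J.restrict y ↔ ∀ i ∈ J, x i = y i := by
  simp [funext_iff]

theorem cnt_mono {X Y : Finset (ι → M)} (h : X ⊆ Y) (J : Finset ι) : cnt X J ≤ cnt Y J := by
  classical
  exact Finset.card_le_card (Finset.image_subset_image h)

theorem one_le_cnt {X : Finset (ι → M)} (h : X.Nonempty) (J : Finset ι) : 1 ≤ cnt X J := by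
  classical
  exact Finset.card_pos.2 (h.image _)

@[simp] theorem cnt_empty (J : Finset ι) : cnt (∅ : Finset (ι → M)) J = 0 := by simp [cnt]

theorem cnt_univ [Fintype ι] (X : Finset (ι → M)) : cnt X Finset.univ = X.card := by
  classical
  exact Finset.card_image_of_injective _ fun _ _ h =>
    funext fun i => restrict_eq_restrict_iff.1 h i (Finset.mem_univ i)

theorem cnt_singleton [DecidableEq M] (X : Finset (ι → M)) (i : ι) :
    cnt X {i} = (X.image fun x => x i).card := by
  classical
  have : X.image (fun x => x i) =
      (X.image (Finset.restrict {i})).image fun y => y ⟨i, Finset.mem_singleton_self i⟩ := by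
    rw [Finset.image_image]; rfl
  rw [this, Finset.card_image_of_injective, cnt]
  · congr!
  · intro x y h
    funext ⟨j, hj⟩
    obtain rfl := Finset.mem_singleton.1 hj
    exact h

theorem cnt_le_of_fiber {X : Finset (ι → M)} {I J L : Finset ι} (hI : ∀ i ∈ I, i ∈ J ∨ i ∈ L)
    (B : ℕ) (h : ∀ Y ⊆ X, (∀ x ∈ Y, ∀ y ∈ Y, ∀ i ∈ J, x i = y i) → cnt Y L ≤ B) :
    cnt X I ≤ cnt X J * B := by
  classical
  have h1 : X.image I.restrict ⊆ (X.image J.restrict).biUnion fun z =>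
      (X.filter fun x => J.restrict x = z).image I.restrict := by
    intro z hz
    obtain ⟨x, hx, rfl⟩ := Finset.mem_image.1 hz
    exact Finset.mem_biUnion.2 ⟨_, Finset.mem_image_of_mem _ hx,
      Finset.mem_image_of_mem _ (Finset.mem_filter.2 ⟨hx, rfl⟩)⟩
  have h2 : cnt X I ≤ _ := (Finset.card_le_card (by convert h1)).trans
    (Finset.card_biUnion_le_card_mul _ _ B fun z hz => ?_)
  · refine h2.trans (le_of_eq ?_)
    congr 1
  have hY : ∀ x ∈ X.filter (fun x => J.restrict x = z),
      ∀ y ∈ X.filter (fun x => J.restrict x = z), ∀ i ∈ J, x i = y i := fun x hx y hy =>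
    restrict_eq_restrict_iff.1 ((Finset.mem_filter.1 hx).2.trans (Finset.mem_filter.1 hy).2.symm)
  refine le_trans ?_ (h _ (Finset.filter_subset _ X) hY)
  generalize X.filter (fun x => J.restrict x = z) = Y at hY
  have h3 : ((Y.image I.restrict : Finset _) : Set _).InjOn
      (fun w : I → M => fun j : L => if hj : (j : ι) ∈ I then some (w ⟨j, hj⟩) else none) := by
    intro w hw w' hw' hww
    obtain ⟨x, hx, rfl⟩ := Finset.mem_image.1 (Finset.mem_coe.1 hw)
    obtain ⟨y, hy, rfl⟩ := Finset.mem_image.1 (Finset.mem_coe.1 hw')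
    refine restrict_eq_restrict_iff.2 fun i hi => ?_
    rcases hI i hi with hJ | hL
    · exact hY x hx y hy i hJ
    · have := congrFun hww ⟨i, hL⟩
      simpa [hi] using this
  rw [← Finset.card_image_of_injOn h3, Finset.image_image]
  have h4 : Y.image ((fun w : I → M => fun j : L =>
      if hj : (j : ι) ∈ I then some (w ⟨j, hj⟩) else none) ∘ I.restrict) =
      (Y.image L.restrict).image fun w : L → M => fun j : L =>
        if (j : ι) ∈ I then some (w j) else none := by
    rw [Finset.image_image]
    refine Finset.image_congr fun x _ => ?_
    funext j
    simp only [Function.comp, Finset.restrict]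
    split <;> rfl
  rw [h4]
  refine Finset.card_image_le.trans (le_of_eq ?_)
  rw [cnt]

theorem cnt_le_mul {X : Finset (ι → M)} {I J L : Finset ι} (hI : ∀ i ∈ I, i ∈ J ∨ i ∈ L) :
    cnt X I ≤ cnt X J * cnt X L :=
  cnt_le_of_fiber hI _ fun _ hY _ => cnt_mono hY L

end Count

section Induction

variable {K : Type u} [Field K] {ι : Type v}

/-- The functions in `X` have values in `Γ`, and every coordinate takes at most `A` values. -/
structure IsAdmissible (Γ : Subgroup Kˣ) (A : ℕ) (X : Finset (ι → Kˣ)) : Prop where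
  mem : ∀ x ∈ X, ∀ i, x i ∈ Γ
  cnt_le : ∀ i, cnt X {i} ≤ A

theorem IsAdmissible.mono {Γ : Subgroup Kˣ} {A : ℕ} {X Y : Finset (ι → Kˣ)}
    (h : IsAdmissible Γ A X) (hY : Y ⊆ X) : IsAdmissible Γ A Y :=
  ⟨fun x hx => h.mem x (hY hx), fun i => (cnt_mono hY _).trans (h.cnt_le i)⟩

/-- The expected bound for inhomogeneous equations in fewer than `n` of the variables. -/
def InhomBound (Γ : Subgroup Kˣ) (ι : Type v) (n C A : ℕ) : Prop :=
  ∀ J : Finset ι, J.Nonempty → J.card < n → ∀ X : Finset (ι → Kˣ), IsAdmissible Γ A X →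
    ∀ (c : ι → K) (a : K), a ≠ 0 → (∀ i ∈ J, c i ≠ 0) → (∀ x ∈ X, ∑ i ∈ J, c i * x i = a) →
    cnt X J ≤ C * A ^ ((J.card - 1) / 2)

theorem InhomBound.cnt_le_fix [DecidableEq ι] {Γ : Subgroup Kˣ} {n C A : ℕ}
    (hB : InhomBound Γ ι n C A) {J : Finset ι} (hJ : J.card ≤ n) (hJ2 : 2 ≤ J.card)
    {X : Finset (ι → Kˣ)} (hX : IsAdmissible Γ A X) {c : ι → K} {a : K} (hc : ∀ i ∈ J, c i ≠ 0)
    (hs : ∀ x ∈ X, ∑ i ∈ J, c i * x i = a) {i : ι} (hi : i ∈ J)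
    (h0 : ∀ x ∈ X, ∑ j ∈ J.erase i, c j * x j ≠ 0) :
    cnt X J ≤ cnt X {i} * (C * A ^ ((J.card - 2) / 2)) := by
  refine cnt_le_of_fiber (L := J.erase i) (fun j hj => ?_) _ fun Y hY hYi => ?_
  · by_cases h : j = i
    · exact Or.inl (Finset.mem_singleton.2 h)
    · exact Or.inr (Finset.mem_erase.2 ⟨h, hj⟩)
  rcases Y.eq_empty_or_nonempty with rfl | ⟨y, hy⟩
  · simp
  have hcard := Finset.card_erase_of_mem hi
  have := hB (J.erase i) (Finset.card_pos.1 (by omega)) (by omega) Y (hX.mono hY) c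
    (∑ j ∈ J.erase i, c j * y j) (h0 y (hY hy)) (fun j hj => hc j (Finset.mem_of_mem_erase hj))
    (fun x hx => by
      have h1 := Finset.add_sum_erase J (fun j => c j * (x j : K)) hi
      have h2 := Finset.add_sum_erase J (fun j => c j * (y j : K)) hi
      have h3 : x i = y i := hYi x hx y hy i (Finset.mem_singleton_self i)
      rw [hs x (hY hx), h3] at h1
      rw [hs y (hY hy)] at h2
      exact add_left_cancel (h1.trans h2.symm))
  rwa [hcard, Nat.sub_sub] at this

theorem InhomBound.cnt_le_hom {Γ : Subgroup Kˣ} {n C A : ℕ}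
    (hB : InhomBound Γ ι n C A) {J : Finset ι} (hJ : J.card ≤ n) (hJ0 : J.Nonempty)
    {X : Finset (ι → Kˣ)} (hX : IsAdmissible Γ A X) {c : ι → K} (hc : ∀ i ∈ J, c i ≠ 0)
    (hs : ∀ x ∈ X, ∑ i ∈ J, c i * x i = 0) : cnt X J ≤ C * A ^ (J.card / 2) := by
  classical
  obtain ⟨i, hi⟩ := hJ0
  have hne : ∀ x ∈ X, ∑ j ∈ J.erase i, c j * (x j : K) ≠ 0 := fun x hx h => by
    have h1 := Finset.add_sum_erase J (fun j => c j * (x j : K)) hi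
    rw [hs x hx, h, add_zero] at h1
    exact mul_ne_zero (hc i hi) (x i).ne_zero h1
  by_cases h2 : 2 ≤ J.card
  · refine (hB.cnt_le_fix hJ h2 hX hc hs hi hne).trans ?_
    refine (Nat.mul_le_mul_right _ (hX.cnt_le i)).trans (le_of_eq ?_)
    have : J.card / 2 = (J.card - 2) / 2 + 1 := by omega
    rw [this]; ring
  · rcases X.eq_empty_or_nonempty with rfl | ⟨x, hx⟩
    · simp
    refine absurd ?_ (hne x hx)
    have : J.erase i = ∅ := Finset.card_eq_zero.1 (by rw [Finset.card_erase_of_mem hi]; omega)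
    rw [this, Finset.sum_empty]

theorem InhomBound.card_le_degenerate [Fintype ι] [DecidableEq ι] {Γ : Subgroup Kˣ} {C A : ℕ}
    (hB : InhomBound Γ ι (Fintype.card ι) C A) (hA : 1 ≤ A) {I : Finset ι} (hI : I.Nonempty)
    (hI' : I ≠ Finset.univ) {X : Finset (ι → Kˣ)} (hX : IsAdmissible Γ A X) {c : ι → K} {a : K}
    (ha : a ≠ 0) (hc : ∀ i, c i ≠ 0) (hs : ∀ x ∈ X, ∑ i, c i * x i = a)
    (h0 : ∀ x ∈ X, ∑ i ∈ I, c i * x i = 0) :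
    X.card ≤ C ^ 2 * A ^ ((Fintype.card ι - 1) / 2) := by
  have h1 : cnt X Finset.univ ≤ cnt X I * cnt X Iᶜ := cnt_le_mul fun i _ => by
    rw [Finset.mem_compl]; exact em _
  have h2 := hB.cnt_le_hom (Finset.card_le_univ I) hI hX (fun i _ => hc i) h0
  have hIc := Finset.card_add_card_compl I
  have hI1 := Finset.card_pos.2 hI
  have hI2 : 0 < Iᶜ.card := by
    have := (Finset.card_lt_iff_ne_univ _).2 hI'
    omega
  have h3 := hB Iᶜ (Finset.card_pos.1 hI2) (by omega) X hX c a ha (fun i _ => hc i) fun x hx => by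
    have := Finset.sum_add_sum_compl I fun i => c i * (x i : K)
    rwa [h0 x hx, zero_add, hs x hx] at this
  rw [cnt_univ] at h1
  refine h1.trans ((Nat.mul_le_mul h2 h3).trans ?_)
  calc _ = C ^ 2 * A ^ (I.card / 2 + (Iᶜ.card - 1) / 2) := by ring
    _ ≤ _ := Nat.mul_le_mul_left _ (Nat.pow_le_pow_right hA (by omega))

/-- No proper nonempty subsum vanishes. -/
def IsNondegenerate [Fintype ι] (c : ι → K) (x : ι → Kˣ) : Prop :=
  ∀ I : Finset ι, I.Nonempty → I ≠ Finset.univ → ∑ i ∈ I, c i * x i ≠ 0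

theorem InhomBound.card_le_odd [Fintype ι] {Γ : Subgroup Kˣ} {C A : ℕ}
    (hB : InhomBound Γ ι (Fintype.card ι) C A) (hn : 3 ≤ Fintype.card ι)
    (hodd : Odd (Fintype.card ι)) {X : Finset (ι → Kˣ)} (hX : IsAdmissible Γ A X) {c : ι → K}
    {a : K} (hc : ∀ i, c i ≠ 0) (hs : ∀ x ∈ X, ∑ i, c i * x i = a)
    (hnd : ∀ x ∈ X, IsNondegenerate c x) :
    X.card ≤ C * A ^ ((Fintype.card ι - 1) / 2) := by
  classical
  obtain ⟨i⟩ : Nonempty ι := Fintype.card_pos_iff.1 (by omega)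
  have hcard := Finset.card_erase_of_mem (Finset.mem_univ i)
  rw [Finset.card_univ] at hcard
  have h := hB.cnt_le_fix (J := Finset.univ) (by simp) (by simp; omega) hX (fun i _ => hc i) hs
    (Finset.mem_univ i) fun x hx => hnd x hx _ (Finset.card_pos.1 (by omega)) fun h => by
      rw [h, Finset.card_univ] at hcard; omega
  rw [cnt_univ] at h
  refine h.trans ((Nat.mul_le_mul_right _ (hX.cnt_le i)).trans (le_of_eq ?_))
  rw [Finset.card_univ]
  obtain ⟨m, hm⟩ := hodd
  have : (Fintype.card ι - 1) / 2 = (Fintype.card ι - 2) / 2 + 1 := by omega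
  rw [this]; ring

/-- Solutions for which a fixed subsum of a modified equation already attains the right hand
side. -/
theorem InhomBound.card_le_even_aux [Fintype ι] [DecidableEq ι] {Γ : Subgroup Kˣ} {C A m : ℕ}
    (hB : InhomBound Γ ι (Fintype.card ι) C A) (hm : 2 ≤ m) (hn : Fintype.card ι = 2 * m)
    {X : Finset (ι → Kˣ)} (hX : IsAdmissible Γ A X) {c e : ι → K}
    {a : K} (ha : a ≠ 0) (hc : ∀ i, c i ≠ 0) (hs : ∀ x ∈ X, ∑ i, c i * x i = a)
    (hnd : ∀ x ∈ X, IsNondegenerate c x) {B : Finset ι} (hB2 : 2 ≤ B.card) {J : Finset ι}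
    (hJ : J ≠ Finset.univ) (he : ∀ x ∈ X, ∑ i ∈ J, e i * x i = a) (he0 : ∀ i ∈ J, e i ≠ 0)
    (hmin : ∀ x ∈ X, ∀ i ∈ J, 2 ≤ J.card → ∑ j ∈ J.erase i, e j * x j ≠ 0) :
    X.card ≤ C ^ 2 * A ^ (m - 2) * ∑ i ∈ B, cnt X {i} := by
  rcases X.eq_empty_or_nonempty with rfl | hne
  · simp
  obtain ⟨x₀, hx₀⟩ := hne
  have hJ0 : J.Nonempty := by
    rw [Finset.nonempty_iff_ne_empty]
    rintro rfl
    exact ha (by simpa using (he x₀ hx₀).symm)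
  have hcc := Finset.card_add_card_compl J
  have hJ1 := Finset.card_pos.2 hJ0
  have hJ2 : 0 < Jᶜ.card := by
    have := (Finset.card_lt_iff_ne_univ _).2 hJ
    omega
  have hsub : ∀ I ⊆ Jᶜ, I.Nonempty → ∀ x ∈ X, ∑ i ∈ I, c i * (x i : K) ≠ 0 :=
    fun I hI hI0 x hx => hnd x hx I hI0 fun h => by
      have := Finset.card_le_card hI
      rw [h, Finset.card_univ] at this
      omega
  have hfib : ∀ Y ⊆ X, (∀ x ∈ Y, ∀ y ∈ Y, ∀ i ∈ J, x i = y i) → ∃ a' : K, a' ≠ 0 ∧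
      ∀ x ∈ Y, ∑ i ∈ Jᶜ, c i * (x i : K) = a' := by
    intro Y hY hYJ
    rcases Y.eq_empty_or_nonempty with rfl | ⟨y, hy⟩
    · exact ⟨1, one_ne_zero, by simp⟩
    refine ⟨_, hsub _ subset_rfl (Finset.card_pos.1 hJ2) y (hY hy), fun x hx => ?_⟩
    have h1 := Finset.sum_add_sum_compl J fun i => c i * (x i : K)
    have h2 := Finset.sum_add_sum_compl J fun i => c i * (y i : K)
    have h3 : ∑ i ∈ J, c i * (x i : K) = ∑ i ∈ J, c i * (y i : K) :=
      Finset.sum_congr rfl fun i hi => by rw [hYJ x hx y hy i hi]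
    rw [hs x (hY hx), h3] at h1
    rw [hs y (hY hy)] at h2
    exact add_left_cancel (h1.trans h2.symm)
  have huniv : ∀ i ∈ (Finset.univ : Finset ι), i ∈ J ∨ i ∈ Jᶜ := fun i _ => by
    rw [Finset.mem_compl]; exact em _
  have hJb := hB J hJ0 (by omega) X hX e a ha he0 he
  have hcb : ∀ Y ⊆ X, (∀ x ∈ Y, ∀ y ∈ Y, ∀ i ∈ J, x i = y i) →
      cnt Y Jᶜ ≤ C * A ^ ((Jᶜ.card - 1) / 2) := fun Y hY hYJ => by
    obtain ⟨a', ha', hYa⟩ := hfib Y hY hYJ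
    exact hB Jᶜ (Finset.card_pos.1 hJ2) (by omega) Y (hX.mono hY) c a' ha' (fun i _ => hc i) hYa
  rw [← cnt_univ]
  suffices h : ∃ i ∈ B, cnt X Finset.univ ≤ C ^ 2 * A ^ (m - 2) * cnt X {i} by
    obtain ⟨i, hi, h⟩ := h
    exact h.trans (Nat.mul_le_mul_left _
      (Finset.single_le_sum (f := fun i => cnt X {i}) (fun _ _ => Nat.zero_le _) hi))
  by_cases hpar : Even J.card
  · obtain ⟨i, hi⟩ : B.Nonempty := Finset.card_pos.1 (by omega)
    refine ⟨i, hi, ((cnt_le_of_fiber huniv _ hcb).trans (Nat.mul_le_mul_right _ hJb)).trans ?_⟩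
    obtain ⟨p, hp⟩ := hpar
    have : m - 2 = (J.card - 1) / 2 + (Jᶜ.card - 1) / 2 := by omega
    calc _ = C ^ 2 * A ^ (m - 2) * 1 := by rw [this]; ring
      _ ≤ _ := Nat.mul_le_mul_left _ (one_le_cnt ⟨x₀, hx₀⟩ _)
  obtain ⟨p, hp⟩ := Nat.not_even_iff_odd.1 hpar
  by_cases h1 : ∃ i ∈ B, i ∈ J ∧ 2 ≤ J.card
  · obtain ⟨i, hiB, hiJ, h2⟩ := h1
    have h3 := hB.cnt_le_fix (Finset.card_le_univ J) h2 hX he0 he hiJ fun x hx =>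
      hmin x hx i hiJ h2
    refine ⟨i, hiB, ((cnt_le_of_fiber huniv _ hcb).trans (Nat.mul_le_mul_right _ h3)).trans
      (le_of_eq ?_)⟩
    have : m - 2 = (J.card - 2) / 2 + (Jᶜ.card - 1) / 2 := by omega
    rw [this]; ring
  by_cases h2 : ∃ i ∈ B, i ∈ Jᶜ ∧ 2 ≤ Jᶜ.card
  · obtain ⟨i, hiB, hiJ, h2⟩ := h2
    refine ⟨i, hiB, ((cnt_le_of_fiber huniv (cnt X {i} * (C * A ^ ((Jᶜ.card - 2) / 2)))
      fun Y hY hYJ => ?_).trans (Nat.mul_le_mul_right _ hJb)).trans (le_of_eq ?_)⟩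
    · obtain ⟨a', ha', hYa⟩ := hfib Y hY hYJ
      refine (hB.cnt_le_fix (Finset.card_le_univ _) h2 (hX.mono hY) (fun i _ => hc i) hYa hiJ
        fun x hx => hsub _ (Finset.erase_subset _ _) (Finset.card_pos.1 ?_) x (hY hx)).trans
        (Nat.mul_le_mul_right _ (cnt_mono hY _))
      rw [Finset.card_erase_of_mem hiJ]; omega
    have : m - 2 = (J.card - 1) / 2 + (Jᶜ.card - 2) / 2 := by omega
    rw [this]; ring
  exfalso
  by_cases h3 : 2 ≤ J.card
  · have : B ⊆ Jᶜ := fun i hi => Finset.mem_compl.2 fun hiJ => h1 ⟨i, hi, hiJ, h3⟩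
    have := Finset.card_le_card this
    obtain ⟨i, hi⟩ : B.Nonempty := Finset.card_pos.1 (by omega)
    exact h2 ⟨i, hi, ‹B ⊆ Jᶜ› hi, by omega⟩
  · have : B ⊆ J := fun i hi => by
      by_contra hiJ
      exact h2 ⟨i, hi, Finset.mem_compl.2 hiJ, by omega⟩
    have := Finset.card_le_card this
    omega

theorem InhomBound.card_le_piece [Fintype ι] {Γ : Subgroup Kˣ} {C A m : ℕ}
    (hB : InhomBound Γ ι (Fintype.card ι) C A) (hm : 2 ≤ m) (hn : Fintype.card ι = 2 * m)
    {X : Finset (ι → Kˣ)} (hX : IsAdmissible Γ A X) {c b : ι → K}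
    {a : K} (ha : a ≠ 0) (hc : ∀ i, c i ≠ 0) (hs : ∀ x ∈ X, ∑ i, c i * x i = a)
    (hnd : ∀ x ∈ X, IsNondegenerate c x) {B : Finset ι} (hB2 : 2 ≤ B.card) (hb : b ≠ 0)
    (hbs : ∀ x ∈ X, ∑ i, b i * x i = 0) :
    X.card ≤ 2 ^ (2 * m) * (C ^ 2 * A ^ (m - 2)) * ∑ i ∈ B, cnt X {i} := by
  classical
  obtain ⟨i₀, hi₀⟩ := Function.ne_iff.1 hb
  set e : ι → K := fun i => c i - c i₀ / b i₀ * b i with he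
  have hei₀ : e i₀ = 0 := by rw [he]; field_simp [show b i₀ ≠ 0 from hi₀]; ring
  have hes : ∀ x ∈ X, ∑ i, e i * (x i : K) = a := fun x hx => by
    simp only [he, sub_mul, Finset.sum_sub_distrib, mul_assoc]
    rw [← Finset.mul_sum, hbs x hx, hs x hx, mul_zero, sub_zero]
  have hex : ∀ x ∈ X, ∃ J : Finset ι, (i₀ ∉ J ∧ ∑ i ∈ J, e i * (x i : K) = a) ∧
      ∀ L : Finset ι, i₀ ∉ L ∧ ∑ i ∈ L, e i * (x i : K) = a → J.card ≤ L.card := by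
    intro x hx
    obtain ⟨J, hJ, hmin⟩ := Finset.exists_min_image
      (Finset.univ.filter fun J : Finset ι => i₀ ∉ J ∧ ∑ i ∈ J, e i * (x i : K) = a) Finset.card
      ⟨Finset.univ.erase i₀, Finset.mem_filter.2 ⟨Finset.mem_univ _, by simp, by
        have := Finset.add_sum_erase Finset.univ (fun i => e i * (x i : K)) (Finset.mem_univ i₀)
        rwa [hei₀, zero_mul, zero_add, hes x hx] at this⟩⟩
    exact ⟨J, (Finset.mem_filter.1 hJ).2, fun L hL =>
      hmin L (Finset.mem_filter.2 ⟨Finset.mem_univ _, hL⟩)⟩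
  choose! g hg hgmin using hex
  have hcov : X ⊆ Finset.univ.biUnion fun J : Finset ι => X.filter fun x => g x = J := fun x hx =>
    Finset.mem_biUnion.2 ⟨g x, Finset.mem_univ _, Finset.mem_filter.2 ⟨hx, rfl⟩⟩
  refine (Finset.card_le_card hcov).trans ((Finset.card_biUnion_le_card_mul _ _
    (C ^ 2 * A ^ (m - 2) * ∑ i ∈ B, cnt X {i}) fun J _ => ?_).trans (le_of_eq ?_))
  · set Y := X.filter fun x => g x = J with hY
    have hYX : Y ⊆ X := Finset.filter_subset _ _
    have hgY : ∀ x ∈ Y, g x = J := fun x hx => (Finset.mem_filter.1 hx).2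
    rcases Y.eq_empty_or_nonempty with h | ⟨y, hy⟩
    · rw [h]; simp
    have hiJ : i₀ ∉ J := by rw [← hgY y hy]; exact (hg y (hYX hy)).1
    have hmin : ∀ x ∈ Y, ∀ L : Finset ι, i₀ ∉ L → ∑ i ∈ L, e i * (x i : K) = a →
        J.card ≤ L.card := fun x hx L h1 h2 => by
      rw [← hgY x hx]; exact hgmin x (hYX hx) L ⟨h1, h2⟩
    have hJs : ∀ x ∈ Y, ∑ i ∈ J, e i * (x i : K) = a := fun x hx => by
      rw [← hgY x hx]; exact (hg x (hYX hx)).2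
    refine (hB.card_le_even_aux hm hn (hX.mono hYX) ha hc (fun x hx => hs x (hYX hx))
      (fun x hx => hnd x (hYX hx)) hB2 (J := J) (e := e) ?_ hJs ?_ ?_).trans
      (Nat.mul_le_mul_left _ (Finset.sum_le_sum fun i _ => cnt_mono hYX _))
    · rintro rfl; exact hiJ (Finset.mem_univ _)
    · intro i hi h0
      have h1 := Finset.add_sum_erase J (fun i => e i * (y i : K)) hi
      rw [h0, zero_mul, zero_add, hJs y hy] at h1
      have := hmin y hy _ (fun h => hiJ (Finset.mem_of_mem_erase h)) h1
      rw [Finset.card_erase_of_mem hi] at this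
      have := Finset.card_pos.2 ⟨i, hi⟩
      omega
    · intro x hx i hi h2 h0
      have h1 := Finset.add_sum_erase J (fun i => e i * (x i : K)) hi
      rw [h0, add_zero, hJs x hx] at h1
      have := hmin x hx {i} (fun h => hiJ (by rwa [Finset.mem_singleton.1 h]))
        (by rw [Finset.sum_singleton, h1])
      rw [Finset.card_singleton] at this
      omega
  · rw [Finset.card_univ, Fintype.card_finset, hn]; ring

end Induction

/-- The elements of a commutative group having a positive power in the subgroup generated by
`S`. -/
def rootClosure {G : Type u} [CommGroup G] (S : Finset G) : Subgroup G where
  carrier := {x | ∃ k : ℕ, 0 < k ∧ x ^ k ∈ Subgroup.closure (S : Set G)}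
  one_mem' := ⟨1, one_pos, by rw [one_pow]; exact one_mem _⟩
  mul_mem' := by
    rintro x y ⟨k, hk, hx⟩ ⟨l, hl, hy⟩
    refine ⟨k * l, Nat.mul_pos hk hl, ?_⟩
    rw [mul_pow, pow_mul, pow_mul' y]
    exact mul_mem (pow_mem hx _) (pow_mem hy _)
  inv_mem' := by
    rintro x ⟨k, hk, hx⟩
    exact ⟨k, hk, by rw [inv_pow]; exact inv_mem hx⟩

theorem subset_rootClosure {G : Type u} [CommGroup G] {S : Finset G} {x : G} (hx : x ∈ S) :
    x ∈ rootClosure S :=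
  ⟨1, one_pos, by rw [pow_one]; exact Subgroup.subset_closure hx⟩

theorem rootClosure_mono {G : Type u} [CommGroup G] {S T : Finset G} (h : S ⊆ T) :
    rootClosure S ≤ rootClosure T := by
  rintro x ⟨k, hk, hx⟩
  exact ⟨k, hk, Subgroup.closure_mono (Finset.coe_subset.2 h) hx⟩

section NumberField

theorem HeightSystem.vec_one {K : Type u} [Field K] {Q : ℕ} (H : HeightSystem K Q) {ι : Type v}
    [Fintype ι] : H.vec (1 : ι → Kˣ) = 0 := by
  have := H.vec_div (1 : ι → Kˣ) 1
  rwa [div_one, sub_self] at this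

theorem HeightSystem.exists_submodule {K : Type u} [Field K] {Q : ℕ} (H : HeightSystem K Q)
    (S : Finset Kˣ) (ι : Type v) [Fintype ι] :
    ∃ F : Submodule ℝ (PiLp 1 (fun _ : ι × H.V => ℝ)),
      Module.finrank ℝ F ≤ Fintype.card ι * S.card ∧
      ∀ x : ι → Kˣ, (∀ i, x i ∈ rootClosure S) → H.vec x ∈ F := by
  classical
  set f : ι × S → PiLp 1 (fun _ : ι × H.V => ℝ) := fun p => H.vec (Pi.mulSingle p.1 (p.2 : Kˣ))
  refine ⟨Submodule.span ℝ (Set.range f), (finrank_range_le_card f).trans (by simp), ?_⟩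
  set F := Submodule.span ℝ (Set.range f) with hF
  let G : Subgroup (ι → Kˣ) :=
    { carrier := {x | H.vec x ∈ F}
      one_mem' := by
        change H.vec 1 ∈ F
        rw [H.vec_one]; exact F.zero_mem
      mul_mem' := fun {x y} hx hy => by
        change H.vec (x * y) ∈ F
        rw [H.vec_mul]; exact F.add_mem hx hy
      inv_mem' := fun {x} hx => by
        change H.vec x⁻¹ ∈ F
        rw [H.vec_inv]; exact F.neg_mem hx }
  have hroot : ∀ (x : ι → Kˣ) (k : ℕ), 0 < k → x ^ k ∈ G → x ∈ G := fun x k hk hx => by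
    have h1 : H.vec (x ^ k) ∈ F := hx
    rw [H.vec_pow] at h1
    exact (F.smul_mem_iff (Nat.cast_ne_zero.2 hk.ne')).1 h1
  have hsingle : ∀ i, Subgroup.closure (S : Set Kˣ) ≤ G.comap (MonoidHom.mulSingle _ i) := fun i =>
    (Subgroup.closure_le _).2 fun g hg => Submodule.subset_span ⟨(i, ⟨g, hg⟩), rfl⟩
  intro x hx
  change x ∈ G
  rw [← Finset.univ_prod_mulSingle x]
  refine Subgroup.prod_mem _ fun i _ => ?_
  obtain ⟨k, hk, hxk⟩ := hx i
  refine hroot _ k hk ?_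
  rw [← Pi.mulSingle_pow]
  exact hsingle i hxk

theorem exists_heightSystem_submodule {K : Type u} [Field K] [NumberField K] (Q : ℕ)
    (S : Finset Kˣ) {ι : Type v} [Fintype ι] (X : Finset (ι → Kˣ))
    (hX : ∀ x ∈ X, ∀ i, x i ∈ rootClosure S) (hs : ∀ x ∈ X, ∑ i, (x i : K) = 1) :
    ∃ (H : HeightSystem K Q) (F : Submodule ℝ (PiLp 1 (fun _ : ι × H.V => ℝ))),
      Module.finrank ℝ F ≤ Fintype.card ι * S.card ∧ ∀ x ∈ X, H.IsSol x ∧ H.vec x ∈ F := by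
  classical
  obtain ⟨H, hH⟩ := exists_heightSystem K Q (X.biUnion fun x => Finset.univ.image x)
  obtain ⟨F, hF, hFx⟩ := H.exists_submodule S ι
  refine ⟨H, F, hF, fun x hx => ⟨⟨fun i => hH _ (Finset.mem_biUnion.2 ⟨x, hx,
    Finset.mem_image_of_mem _ (Finset.mem_univ _)⟩), hs x hx⟩, hFx x (hX x hx)⟩⟩

/-- The expected bound over number fields. -/
def NumberFieldBound (n ρ C : ℕ) : Prop :=
  ∀ (K : Type u) [Field K] [NumberField K] (S : Finset Kˣ), S.card ≤ ρ → ∀ (ι : Type v)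
    [Fintype ι], Fintype.card ι = n → ∀ (A : ℕ) (X : Finset (ι → Kˣ)),
    IsAdmissible (rootClosure S) A X → ∀ (c : ι → K) (a : K), a ≠ 0 → (∀ i, c i ≠ 0) →
    (∀ x ∈ X, ∑ i, c i * x i = a) → X.card ≤ C * A ^ ((n - 1) / 2)

/-- The expected bound over number fields for equations with all coefficients equal to one. -/
def NormalizedBound (n ρ C : ℕ) : Prop :=
  ∀ (K : Type u) [Field K] [NumberField K] (S : Finset Kˣ), S.card ≤ ρ → ∀ (ι : Type v)
    [Fintype ι], Fintype.card ι = n → ∀ (A : ℕ) (X : Finset (ι → Kˣ)),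
    IsAdmissible (rootClosure S) A X → (∀ x ∈ X, ∑ i, (x i : K) = 1) →
    X.card ≤ C * A ^ ((n - 1) / 2)

theorem NormalizedBound.numberFieldBound {n ρ C : ℕ} (h : NormalizedBound.{u, v} n (ρ + n) C) :
    NumberFieldBound.{u, v} n ρ C := by
  classical
  intro K _ _ S hS ι _ hι A X hX c a ha hc hs
  set g : ι → Kˣ := fun i => Units.mk0 (c i / a) (div_ne_zero (hc i) ha) with hg
  have hinj : Function.Injective fun x : ι → Kˣ => g * x := mul_right_injective g
  rw [← Finset.card_image_of_injective X hinj]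
  refine h K (S ∪ Finset.univ.image g) ((Finset.card_union_le _ _).trans (add_le_add hS
    (Finset.card_image_le.trans (by rw [Finset.card_univ, hι])))) ι hι A _ ⟨?_, ?_⟩ ?_
  · intro z hz i
    obtain ⟨x, hx, rfl⟩ := Finset.mem_image.1 hz
    exact mul_mem (subset_rootClosure (Finset.mem_union_right _
      (Finset.mem_image_of_mem _ (Finset.mem_univ i))))
      (rootClosure_mono Finset.subset_union_left (hX.mem x hx i))
  · intro i
    refine le_trans ?_ (hX.cnt_le i)
    rw [cnt_singleton, cnt_singleton, Finset.image_image]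
    have : (X.image ((fun x => x i) ∘ fun x : ι → Kˣ => g * x)) =
        (X.image fun x => x i).image fun t => g i * t := by
      rw [Finset.image_image]; rfl
    rw [this]
    exact Finset.card_image_le
  · intro z hz
    obtain ⟨x, hx, rfl⟩ := Finset.mem_image.1 hz
    have : ∀ i, (((g * x) i : Kˣ) : K) = (c i * x i) / a := fun i => by
      simp [hg, div_mul_eq_mul_div]
    simp only [this]
    rw [← Finset.sum_div, hs x hx, div_self ha]

theorem NumberFieldBound.mono {n ρ C C' : ℕ} (h : NumberFieldBound.{u, v} n ρ C) (hC : C ≤ C') :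
    NumberFieldBound.{u, v} n ρ C' :=
  fun K _ _ S hS ι _ hι A X hX c a ha hc hs =>
    (h K S hS ι hι A X hX c a ha hc hs).trans (Nat.mul_le_mul_right _ hC)

theorem inhomBound_of_numberFieldBound {n ρ C : ℕ}
    (h : ∀ m, 0 < m → m < n → NumberFieldBound.{u, v} m ρ C) (K : Type u) [Field K]
    [NumberField K] (S : Finset Kˣ) (hS : S.card ≤ ρ) (ι : Type v) (A : ℕ) :
    InhomBound (rootClosure S) ι n C A := by
  classical
  intro J hJ0 hJ X hX c a ha hc hs
  have h1 := h J.card (Finset.card_pos.2 hJ0) hJ K S hS J (Fintype.card_coe J) A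
    (X.image J.restrict) ⟨?_, ?_⟩ (fun i => c i) a ha (fun i => hc i i.2) ?_
  · rw [cnt]; convert h1
  · intro z hz i
    obtain ⟨x, hx, rfl⟩ := Finset.mem_image.1 hz
    exact hX.mem x hx i
  · intro i
    refine le_trans (le_of_eq ?_) (hX.cnt_le i)
    rw [cnt_singleton, cnt_singleton, Finset.image_image]
    rfl
  · intro z hz
    obtain ⟨x, hx, rfl⟩ := Finset.mem_image.1 hz
    rw [← hs x hx, ← Finset.sum_coe_sort J]
    rfl

theorem numberFieldBound_one (ρ : ℕ) : NumberFieldBound.{u, v} 1 ρ 1 := by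
  intro K _ _ S hS ι _ hι A X hX c a ha hc hs
  simp only [Nat.sub_self, Nat.zero_div, pow_zero, mul_one]
  obtain ⟨i, hi⟩ := Fintype.card_eq_one_iff.1 hι
  have : Unique ι := ⟨⟨i⟩, hi⟩
  refine Finset.card_le_one.2 fun x hx y hy => funext fun j => ?_
  have h := (hs x hx).trans (hs y hy).symm
  rw [Fintype.sum_unique, Fintype.sum_unique] at h
  rw [hi j, ← hi default]
  exact Units.ext (mul_left_cancel₀ (hc _) h)

theorem exists_numberFieldBound_two (ρ : ℕ) : ∃ C, NumberFieldBound.{u, v} 2 ρ C := by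
  obtain ⟨C, hC⟩ := HeightSystem.exists_card_sol_two_le.{u, v} (2 * (ρ + 2))
  refine ⟨C, NormalizedBound.numberFieldBound fun K _ _ S hS ι _ hι A X hX hs => ?_⟩
  obtain ⟨H, F, hF, hFX⟩ := exists_heightSystem_submodule (relPrimes 2) S X hX.mem hs
  rw [Nat.div_eq_of_lt (by norm_num), pow_zero, mul_one]
  refine hC H hι F (hF.trans ?_) X hFX
  rw [hι]; exact Nat.mul_le_mul_left _ hS

theorem sum_cnt_le {ι M : Type*} [Fintype ι] {X : Finset (ι → M)} {A C : ℕ}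
    (hA : ∀ i, cnt X {i} ≤ A) {D : Finset (Finset (ι → M) × Finset ι)} (hD : ∀ p ∈ D, p.1 ⊆ X)
    (hC : ∀ (i : ι) (t : M), {p ∈ (D : Set (Finset (ι → M) × Finset ι)) | i ∈ p.2 ∧ ∃ x ∈ p.1, x i = t}.ncard ≤ C) :
    ∑ p ∈ D, ∑ i ∈ p.2, cnt p.1 {i} ≤ Fintype.card ι * (A * C) := by
  classical
  have h1 : ∀ p ∈ D, ∑ i ∈ p.2, cnt p.1 {i} = ∑ i, if i ∈ p.2 then cnt p.1 {i} else 0 :=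
    fun p _ => by rw [← Finset.sum_filter]; simp
  rw [Finset.sum_congr rfl h1, Finset.sum_comm, ← smul_eq_mul (Fintype.card ι), ← Finset.card_univ]
  refine Finset.sum_le_card_nsmul _ _ _ fun i _ => ?_
  rw [← Finset.sum_filter]
  set r : Finset (ι → M) × Finset ι → M → Prop := fun p t => ∃ x ∈ p.1, x i = t with hr
  have h2 : ∀ p ∈ D.filter (fun p => i ∈ p.2), cnt p.1 {i} =
      ((X.image fun x => x i).bipartiteAbove r p).card := fun p hp => by
    rw [cnt_singleton]
    congr 1
    ext t
    simp only [Finset.mem_image, Finset.mem_bipartiteAbove, hr]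
    refine ⟨fun h => ⟨?_, h⟩, fun h => h.2⟩
    obtain ⟨x, hx, hxt⟩ := h
    exact ⟨x, hD p (Finset.mem_filter.1 hp).1 hx, hxt⟩
  rw [Finset.sum_congr rfl h2, Finset.sum_card_bipartiteAbove_eq_sum_card_bipartiteBelow]
  refine (Finset.sum_le_card_nsmul _ _ C fun t _ => ?_).trans ?_
  · refine le_trans (le_of_eq ?_) (hC i t)
    rw [← Set.ncard_coe_finset]
    congr 1
    ext p
    simp [Finset.bipartiteBelow, hr, and_assoc]
  · rw [smul_eq_mul, ← cnt_singleton]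
    exact Nat.mul_le_mul_right _ (hA i)

theorem exists_normalizedBound_step {n ρ C : ℕ} (hn : 3 ≤ n)
    (h : ∀ m, 0 < m → m < n → NumberFieldBound.{u, v} m ρ C) :
    ∃ C', NormalizedBound.{u, v} n ρ C' := by
  classical
  obtain ⟨E, hE⟩ := HeightSystem.exists_decomposition.{u, v} n (by omega) (n * ρ)
  refine ⟨2 ^ n * C ^ 2 + (C + 2 ^ n * C ^ 2 * (n * E)), fun K _ _ S hS ι _ hι A X hX hs => ?_⟩
  rcases X.eq_empty_or_nonempty with rfl | hne
  · simp
  obtain ⟨i₀⟩ : Nonempty ι := Fintype.card_pos_iff.1 (by omega)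
  have hA : 1 ≤ A := (one_le_cnt hne {i₀}).trans (hX.cnt_le i₀)
  have hB : InhomBound (rootClosure S) ι (Fintype.card ι) C A := by
    rw [hι]; exact inhomBound_of_numberFieldBound h K S hS ι A
  set X₀ := X.filter fun x => IsNondegenerate (fun _ => (1 : K)) x with hX₀
  have hX₀X : X₀ ⊆ X := Finset.filter_subset _ _
  have hnd : ∀ x ∈ X₀, IsNondegenerate (fun _ => (1 : K)) x := fun x hx =>
    (Finset.mem_filter.1 hx).2
  set T : Finset (Finset ι) := Finset.univ.filter fun I => I.Nonempty ∧ I ≠ Finset.univ with hT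
  have hs1 : ∀ x ∈ X, ∑ i, (1 : K) * (x i : K) = 1 := fun x hx => by
    simpa only [one_mul] using hs x hx
  have hcov : X ⊆ (T.biUnion fun I => X.filter fun x => ∑ i ∈ I, (1 : K) * (x i : K) = 0) ∪ X₀ := by
    intro x hx
    by_cases hxn : IsNondegenerate (fun _ => (1 : K)) x
    · exact Finset.mem_union_right _ (Finset.mem_filter.2 ⟨hx, hxn⟩)
    · simp only [IsNondegenerate, not_forall, not_not] at hxn
      obtain ⟨I, h1, h2, h3⟩ := hxn
      exact Finset.mem_union_left _ (Finset.mem_biUnion.2 ⟨I,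
        Finset.mem_filter.2 ⟨Finset.mem_univ _, h1, h2⟩, Finset.mem_filter.2 ⟨hx, h3⟩⟩)
  refine (Finset.card_le_card hcov).trans ((Finset.card_union_le _ _).trans ?_)
  rw [add_mul]
  refine add_le_add ?_ ?_
  · refine (Finset.card_biUnion_le_card_mul _ _ (C ^ 2 * A ^ ((n - 1) / 2)) fun I hI => ?_).trans ?_
    · obtain ⟨-, h1, h2⟩ := Finset.mem_filter.1 hI
      have h3 := hB.card_le_degenerate hA h1 h2 (hX.mono (Finset.filter_subset
        (fun x => ∑ i ∈ I, (1 : K) * (x i : K) = 0) X)) one_ne_zero (fun _ => one_ne_zero)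
        (fun x hx => hs1 x (Finset.mem_filter.1 hx).1) fun x hx => (Finset.mem_filter.1 hx).2
      rwa [hι] at h3
    · rw [← mul_assoc]
      refine Nat.mul_le_mul_right _ (Nat.mul_le_mul_right _ ?_)
      refine (Finset.card_le_univ T).trans (le_of_eq ?_)
      rw [Fintype.card_finset, hι]
  rcases Nat.even_or_odd n with hev | hodd
  · obtain ⟨m, hm⟩ := hev
    obtain ⟨H, F, hF, hFX⟩ := exists_heightSystem_submodule (relPrimes n) S X₀
      (fun x hx => hX.mem x (hX₀X hx)) fun x hx => hs x (hX₀X hx)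
    obtain ⟨D, hDcov, hD, hDC⟩ := hE H hι F (hF.trans (by
      rw [hι]; exact Nat.mul_le_mul_left _ hS)) X₀ hFX
    have h1 : X₀.card ≤ ∑ p ∈ D, p.1.card := by
      refine (Finset.card_le_card fun x hx => ?_).trans (Finset.card_biUnion_le (t := Prod.fst))
      obtain ⟨p, hp, hxp⟩ := hDcov x hx
      exact Finset.mem_biUnion.2 ⟨p, hp, hxp⟩
    have h2 : ∀ p ∈ D, p.1.card ≤ 2 ^ (2 * m) * (C ^ 2 * A ^ (m - 2)) * ∑ i ∈ p.2, cnt p.1 {i} := by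
      intro p hp
      obtain ⟨hp2, hpX, b, hb, hbp⟩ := hD p hp
      exact hB.card_le_piece (by omega) (by omega) (hX.mono (hpX.trans hX₀X)) one_ne_zero
        (fun _ => one_ne_zero) (fun x hx => hs1 x (hX₀X (hpX hx))) (fun x hx => hnd x (hpX hx))
        hp2 hb hbp
    have h3 := sum_cnt_le (hX.mono hX₀X).cnt_le (fun p hp => (hD p hp).2.1) hDC
    calc X₀.card ≤ _ := h1.trans (Finset.sum_le_sum h2)
      _ = 2 ^ (2 * m) * (C ^ 2 * A ^ (m - 2)) * ∑ p ∈ D, ∑ i ∈ p.2, cnt p.1 {i} := by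
        rw [Finset.mul_sum]
      _ ≤ 2 ^ (2 * m) * (C ^ 2 * A ^ (m - 2)) * (Fintype.card ι * (A * E)) :=
        Nat.mul_le_mul_left _ h3
      _ = 2 ^ n * C ^ 2 * (n * E) * A ^ ((n - 1) / 2) := by
        have : (n - 1) / 2 = m - 2 + 1 := by omega
        rw [this, hι, show 2 * m = n by omega]; ring
      _ ≤ _ := Nat.mul_le_mul_right _ (Nat.le_add_left _ _)
  · have h1 := hB.card_le_odd (by omega) (by rwa [hι]) (hX.mono hX₀X) (fun _ => one_ne_zero)
      (fun x hx => hs1 x (hX₀X hx)) hnd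
    rw [hι] at h1
    exact h1.trans (Nat.mul_le_mul_right _ (Nat.le_add_right _ _))

theorem exists_numberFieldBound (n : ℕ) (hn : 0 < n) (ρ : ℕ) :
    ∃ C, NumberFieldBound.{u, v} n ρ C := by
  induction n using Nat.strong_induction_on generalizing ρ with
  | _ n ih =>
    by_cases h1 : n = 1
    · subst h1; exact ⟨1, numberFieldBound_one ρ⟩
    by_cases h2 : n = 2
    · subst h2; exact exists_numberFieldBound_two ρ
    have : ∀ m, ∃ C, 0 < m → m < n → NumberFieldBound.{u, v} m (ρ + n) C := fun m => by
      by_cases h : 0 < m ∧ m < n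
      · obtain ⟨C, hC⟩ := ih m h.2 h.1 (ρ + n)
        exact ⟨C, fun _ _ => hC⟩
      · exact ⟨0, fun h3 h4 => absurd ⟨h3, h4⟩ h⟩
    choose f hf using this
    obtain ⟨C', hC'⟩ := exists_normalizedBound_step (n := n) (ρ := ρ + n)
      (C := ∑ m ∈ Finset.range n, f m) (by omega) fun m h0 hm => (hf m h0 hm).mono
        (Finset.single_le_sum (fun _ _ => Nat.zero_le _) (Finset.mem_range.2 hm))
    exact ⟨C', hC'.numberFieldBound⟩

end NumberField

theorem exists_ringHom_numberField (B : Type u) [CommRing B] [Nontrivial B] [Algebra ℚ B]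
    [Algebra.FiniteType ℚ B] : ∃ (L : Type u) (_ : Field L), NumberField L ∧ Nonempty (B →+* L) := by
  obtain ⟨M, hM⟩ := Ideal.exists_maximal B
  let F : Field (B ⧸ M) := Ideal.Quotient.field M
  have hft : Algebra.FiniteType ℚ (B ⧸ M) :=
    Algebra.FiniteType.of_surjective (Ideal.Quotient.mkₐ ℚ M) (Ideal.Quotient.mkₐ_surjective ℚ M)
  have hfin : Module.Finite ℚ (B ⧸ M) := finite_of_finite_type_of_isJacobsonRing ℚ (B ⧸ M)
  have hchar : CharZero (B ⧸ M) := algebraRat.charZero (B ⧸ M)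
  refine ⟨B ⧸ M, F, @NumberField.mk _ F hchar ?_, ⟨Ideal.Quotient.mk M⟩⟩
  convert hfin
  exact Subsingleton.elim _ _

theorem exists_subring_ringHom_numberField (K : Type u) [Field K] [CharZero K] (T : Finset Kˣ) :
    ∃ (L : Type u) (_ : Field L) (_ : NumberField L) (R : Subring K) (_ : R →+* L),
      ∀ x ∈ T, x ∈ R.toSubmonoid.units := by
  set s : Set K := {y | ∃ x ∈ T, y = x ∨ y = (x⁻¹ : Kˣ)} with hs
  have hsf : s.Finite := by
    refine ((T.finite_toSet.image fun x : Kˣ => (x : K)).union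
      (T.finite_toSet.image fun x : Kˣ => ((x⁻¹ : Kˣ) : K))).subset ?_
    rintro y ⟨x, hx, rfl | rfl⟩
    · exact Or.inl ⟨x, hx, rfl⟩
    · exact Or.inr ⟨x, hx, rfl⟩
  have hft : Algebra.FiniteType ℚ (Algebra.adjoin ℚ s) :=
    (Subalgebra.fg_iff_finiteType _).1 ⟨hsf.toFinset, by rw [hsf.coe_toFinset]⟩
  obtain ⟨L, hL, hLn, ⟨φ⟩⟩ := exists_ringHom_numberField (Algebra.adjoin ℚ s)
  exact ⟨L, hL, hLn, (Algebra.adjoin ℚ s).toSubring, φ, fun x hx =>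
    ⟨Algebra.subset_adjoin ⟨x, hx, Or.inl rfl⟩, Algebra.subset_adjoin ⟨x, hx, Or.inr rfl⟩⟩⟩

/-- Finitely many elements of a field of characteristic zero can be specialised to a number
field, compatibly with root closures. -/
theorem exists_specialization (K : Type u) [Field K] [CharZero K] (T : Finset Kˣ) :
    ∃ (L : Type u) (_ : Field L) (_ : NumberField L) (R : Subring K) (φ : R →+* L)
      (f : Kˣ → Lˣ), (∀ x ∈ T, ∃ h : (x : K) ∈ R, (f x : L) = φ ⟨x, h⟩) ∧
      ∀ [DecidableEq Lˣ] (S : Finset Kˣ), S ⊆ T → ∀ x ∈ T, x ∈ rootClosure S →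
        f x ∈ rootClosure (S.image f) := by
  classical
  obtain ⟨L, _, _, R, φ, hR⟩ := exists_subring_ringHom_numberField K T
  set U : Subgroup Kˣ := R.toSubmonoid.units with hU
  set ψ : U →* Lˣ := (Units.map (φ : R →* L)).comp
    (R.toSubmonoid.unitsEquivUnitsType : U →* (R.toSubmonoid)ˣ) with hψ
  set f : Kˣ → Lˣ := fun x => if h : x ∈ U then ψ ⟨x, h⟩ else 1 with hf
  have hfx : ∀ x (h : x ∈ U), f x = ψ ⟨x, h⟩ := fun x h => dif_pos h
  refine ⟨L, inferInstance, inferInstance, R, φ, f, fun x hx => ⟨(hR x hx).1, ?_⟩, ?_⟩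
  · rw [hfx x (hR x hx)]; rfl
  intro _ S hST x hx hxS
  obtain ⟨k, hk, hxk⟩ := hxS
  have hle : Subgroup.closure (S : Set Kˣ) ≤
      ((Subgroup.closure ((S.image f : Finset Lˣ) : Set Lˣ)).comap ψ).map U.subtype :=
    (Subgroup.closure_le _).2 fun s hs => ⟨⟨s, hR s (hST hs)⟩, Subgroup.subset_closure (by
      rw [← hfx s]; exact Finset.mem_coe.2 (Finset.mem_image_of_mem f hs)), rfl⟩
  obtain ⟨w, hw, hwx⟩ := hle hxk
  have hw' : w = (⟨x, hR x hx⟩ : U) ^ k := Subtype.ext hwx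
  refine ⟨k, hk, ?_⟩
  rw [hfx x (hR x hx), ← map_pow, ← hw']
  exact hw

theorem count_solutions_inhomogeneous (n ρ : ℕ) (hn : 0 < n) :
    ∃ C : ℝ, 0 < C ∧ ∀ (K : Type*) [Field K] [CharZero K] (Γ : Subgroup Kˣ),
      FinRank Γ ρ →
      ∀ A : Finset K, (∀ a ∈ A, ∃ u : Kˣ, u ∈ Γ ∧ (u : K) = a) →
      ∀ (a₀ : K) (a : Fin n → K), a₀ ≠ 0 → (∀ i, a i ≠ 0) →
      ({x : Fin n → K | (∀ i, x i ∈ A) ∧ ∑ i, a i * x i = a₀}.ncard : ℝ) ≤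
        C * (A.card : ℝ) ^ ((n - 1) / 2) := by
  classical
  obtain ⟨C, hC⟩ := exists_numberFieldBound n hn ρ
  refine ⟨C + 1, by positivity, fun K _ _ Γ hΓ A hA a₀ a ha₀ ha => ?_⟩
  obtain ⟨S, hS, -, hSΓ⟩ := hΓ
  set g : K → Kˣ := fun x => if h : x = 0 then 1 else Units.mk0 x h with hg
  have hgx : ∀ x, x ≠ 0 → (g x : K) = x := fun x hx => by rw [hg]; simp [hx]
  have hA0 : ∀ x ∈ A, x ≠ 0 := fun x hx => by
    obtain ⟨u, -, rfl⟩ := hA x hx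
    exact u.ne_zero
  have hAS : ∀ x ∈ A, g x ∈ rootClosure S := fun x hx => by
    obtain ⟨u, hu, rfl⟩ := hA x hx
    rw [show g u = u from Units.ext (hgx _ u.ne_zero)]
    exact hSΓ u hu
  set T₀ : Finset K := A ∪ ((A ×ˢ A).image (fun p => p.1 - p.2) ∪ (Finset.univ.image a ∪ {a₀}))
  obtain ⟨L, _, _, R, φ, f, hf, hfS⟩ := exists_specialization K (S ∪ T₀.image g)
  have hfg : ∀ x ∈ T₀, x ≠ 0 → ∃ h : x ∈ R, (f (g x) : L) = φ ⟨x, h⟩ := fun x hx hx0 => by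
    obtain ⟨h1, h2⟩ := hf (g x) (Finset.mem_union_right _ (Finset.mem_image_of_mem g hx))
    simp only [hgx x hx0] at h1 h2
    exact ⟨h1, h2⟩
  have hTA : ∀ x ∈ A, x ∈ T₀ := fun x hx => Finset.mem_union_left _ hx
  have hTa : ∀ i, a i ∈ T₀ := fun i => Finset.mem_union_right _ (Finset.mem_union_right _
    (Finset.mem_union_left _ (Finset.mem_image_of_mem a (Finset.mem_univ i))))
  have hTa₀ : a₀ ∈ T₀ := Finset.mem_union_right _ (Finset.mem_union_right _
    (Finset.mem_union_right _ (Finset.mem_singleton_self _)))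
  have hinj : ∀ x ∈ A, ∀ y ∈ A, f (g x) = f (g y) → x = y := fun x hx y hy hxy => by
    by_contra hne
    obtain ⟨h1, h2⟩ := hfg x (hTA x hx) (hA0 x hx)
    obtain ⟨h3, h4⟩ := hfg y (hTA y hy) (hA0 y hy)
    obtain ⟨h5, h6⟩ := hfg (x - y) (Finset.mem_union_right _ (Finset.mem_union_left _
      (Finset.mem_image.2 ⟨(x, y), Finset.mk_mem_product hx hy, rfl⟩))) (sub_ne_zero.2 hne)
    have h7 : (⟨x - y, h5⟩ : R) = ⟨x, h1⟩ - ⟨y, h3⟩ := rfl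
    rw [h7, map_sub, ← h2, ← h4, hxy, sub_self] at h6
    exact (f (g (x - y))).ne_zero h6
  set X : Finset (Fin n → K) :=
    (Fintype.piFinset fun _ => A).filter fun x => ∑ i, a i * x i = a₀ with hX
  have hXmem : ∀ x, x ∈ X ↔ (∀ i, x i ∈ A) ∧ ∑ i, a i * x i = a₀ := fun x => by
    rw [hX, Finset.mem_filter, Fintype.mem_piFinset]
  have hset : {x : Fin n → K | (∀ i, x i ∈ A) ∧ ∑ i, a i * x i = a₀} = X := by
    ext x; simp [hXmem]
  rw [hset, Set.ncard_coe_finset]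
  have hcard : (X.image fun x i => f (g (x i))).card = X.card :=
    Finset.card_image_of_injOn fun x hx y hy hxy => funext fun i =>
      hinj _ (((hXmem x).1 hx).1 i) _ (((hXmem y).1 hy).1 i) (congrFun hxy i)
  have hmain := hC L (S.image f) (Finset.card_image_le.trans hS.le) (Fin n) (Fintype.card_fin n)
    A.card (X.image fun x i => f (g (x i))) ⟨?_, ?_⟩ (fun i => (f (g (a i)) : L)) (f (g a₀) : L)
    (Units.ne_zero _) (fun i => Units.ne_zero _) ?_
  · rw [hcard] at hmain
    calc (X.card : ℝ) ≤ C * (A.card : ℝ) ^ ((n - 1) / 2) := by exact_mod_cast hmain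
      _ ≤ _ := mul_le_mul_of_nonneg_right (by linarith) (by positivity)
  · intro z hz i
    obtain ⟨x, hx, rfl⟩ := Finset.mem_image.1 hz
    have hxA := ((hXmem x).1 hx).1 i
    exact hfS S Finset.subset_union_left _ (Finset.mem_union_right _
      (Finset.mem_image_of_mem g (hTA _ hxA))) (hAS _ hxA)
  · intro i
    rw [cnt_singleton, Finset.image_image]
    refine (Finset.card_le_card (t := A.image fun y => f (g y)) fun t ht => ?_).trans
      Finset.card_image_le
    obtain ⟨x, hx, rfl⟩ := Finset.mem_image.1 ht
    exact Finset.mem_image_of_mem (fun y => f (g y)) (((hXmem x).1 hx).1 i)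
  · intro z hz
    obtain ⟨x, hx, rfl⟩ := Finset.mem_image.1 hz
    obtain ⟨hxA, hxs⟩ := (hXmem x).1 hx
    choose ha1 ha2 using fun i => hfg (a i) (hTa i) (ha i)
    choose hx1 hx2 using fun i => hfg (x i) (hTA _ (hxA i)) (hA0 _ (hxA i))
    obtain ⟨h1, h2⟩ := hfg a₀ hTa₀ ha₀
    simp only [ha2, hx2, h2]
    simp only [← map_mul]
    rw [← map_sum]
    congr 1
    apply Subtype.ext
    simpa using hxs
end

section
/- Let K be a field and n ≥ 2 an integer. For any non-singular matrix X ∈ M_n(K) all of whose entries are non-zero, and for any fixed index i ∈ {1, …, n}, the number of indices j ∈ {1, …, n} such that det X_{i,j} = 0 is at most n − 2, where X_{i,j} denotes the (n−1)×(n−1) submatrix of X obtained by deleting the i-th row and j-th column; the same bound holds for the minors arising from expansion about any fixed column. -/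
/-- If `A` is non-singular with no zero entries, then expanding `det A` along any row involves at
least two non-zero minors. -/
theorem Matrix.ncard_det_submatrix_succAbove_eq_zero_le {K : Type*} [Field K] {n : ℕ} (hn : 1 ≤ n)
    (A : Matrix (Fin (n + 1)) (Fin (n + 1)) K) (hA : A.det ≠ 0)
    (hent : ∀ i j, A i j ≠ 0) (i : Fin (n + 1)) :
    {j : Fin (n + 1) | (A.submatrix i.succAbove j.succAbove).det = 0}.ncard ≤ n - 1 := by
  by_contra! h
  set S := {j : Fin (n + 1) | (A.submatrix i.succAbove j.succAbove).det = 0}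
  have hcard : S.ncard + Sᶜ.ncard = n + 1 := by
    simpa using Set.ncard_add_ncard_compl S
  obtain ⟨j₀, hj₀⟩ :=
    (Set.ncard_le_one_iff_subset_singleton Sᶜ.toFinite).mp (show Sᶜ.ncard ≤ 1 by omega)
  have hadj : ∀ j, j ≠ j₀ → A.adjugate j i = 0 := by
    intro j hj
    have hjS : j ∈ S := by
      by_contra hjS
      exact hj (hj₀ hjS)
    have hdet : (A.submatrix i.succAbove j.succAbove).det = 0 := hjS
    rw [Matrix.adjugate_fin_succ_eq_det_submatrix, hdet, mul_zero]
  have hmul : ∀ k, A k j₀ * A.adjugate j₀ i = (A * A.adjugate) k i := by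
    intro k
    rw [Matrix.mul_apply, Fintype.sum_eq_single j₀ fun j hj => by rw [hadj j hj, mul_zero]]
  simp only [Matrix.mul_adjugate, Matrix.smul_apply, smul_eq_mul] at hmul
  have : Nontrivial (Fin (n + 1)) := Fin.nontrivial_iff_two_le.mpr (by omega)
  obtain ⟨k, hk⟩ := exists_ne i
  have hzero : A.adjugate j₀ i = 0 := by
    have := hmul k
    rw [Matrix.one_apply_ne hk, mul_zero] at this
    exact (mul_eq_zero.mp this).resolve_left (hent k j₀)
  apply hA
  simpa [hzero] using (hmul i).symm

theorem vanishing_minors_in_laplace_expansion (K : Type*) [Field K] (n : ℕ) (hn : 1 ≤ n)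
    (X : Matrix (Fin (n + 1)) (Fin (n + 1)) K) (hX : X.det ≠ 0)
    (hent : ∀ i j, X i j ≠ 0) :
    (∀ i : Fin (n + 1),
        {j : Fin (n + 1) | (X.submatrix i.succAbove j.succAbove).det = 0}.ncard ≤ n - 1) ∧
    (∀ j : Fin (n + 1),
        {i : Fin (n + 1) | (X.submatrix i.succAbove j.succAbove).det = 0}.ncard ≤ n - 1) := by
  refine ⟨X.ncard_det_submatrix_succAbove_eq_zero_le hn hX hent, fun j => ?_⟩
  have h := X.transpose.ncard_det_submatrix_succAbove_eq_zero_le hn (by rwa [Matrix.det_transpose])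
    (fun i j => hent j i) j
  simpa only [← Matrix.transpose_submatrix, Matrix.det_transpose] using h
end
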